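/- Let K be a field of characteristic zero and Γ a subgroup of K^* of finite rank, and let n ≥ 2 be an integer. Then there exists a constant C > 0, depending only on n and the rank of Γ, such that for every d ∈ K and every finite subset A of Γ of cardinality A = #A, the number of n×n matrices over A with determinant d satisfies #D_n(A; d) ≤ C·A^{n² − ⌈n/2⌉} if d = 0, and #D_n(A; d) ≤ C·A^{n² − ⌈(n+1)/2⌉} if d ≠ 0. -/

import Mathlib

/-- A subgroup `Γ` of a (commutative) group has finite rank `ρ` if there is a finitely
generated subgroup `Γ₀ ≤ Γ`, generated by `ρ` elements, such that every `x ∈ Γ` has a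
positive power lying in `Γ₀`. -/
def FinRank {G : Type*} [CommGroup G] (Γ : Subgroup G) (ρ : ℕ) : Prop :=
  ∃ S : Finset G, S.card = ρ ∧ (S : Set G) ⊆ (Γ : Set G) ∧
    ∀ x ∈ Γ, ∃ k : ℕ, 0 < k ∧ x ^ k ∈ Subgroup.closure (S : Set G)

/-- A finite family of logarithmic absolute values on a field `L` adapted to a group `G` of
units: the product formula holds on `G`, and nonzero elements of the subring generated by `G`
have nonnegative total size. The weights `wt` vanish at the nonarchimedean places. -/
structure PlaceSystem (L : Type*) [Field L] (G : Subgroup Lˣ) (ι : Type*) [Fintype ι] where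
  lg : ι → L → ℝ
  wt : ι → ℝ
  wt_nonneg : ∀ v, 0 ≤ wt v
  wt_sum : ∑ v, wt v = 1
  lg_mul : ∀ v x y, x ≠ 0 → y ≠ 0 → lg v (x * y) = lg v x + lg v y
  lg_sum : ∀ v (σ : Type) (s : Finset σ) (n : σ → ℤ) (a : σ → L), (∀ i ∈ s, a i ≠ 0) →
    ∑ i ∈ s, (n i : L) * a i ≠ 0 →
    ∃ i ∈ s, lg v (∑ i ∈ s, (n i : L) * a i) ≤
      wt v * Real.log (∑ i ∈ s, |(n i : ℝ)|) + lg v (a i)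
  lg_frob : ∀ v (σ : Type) (s : Finset σ) (t : σ → L) (p : ℕ) (β : L), p.Prime →
    (∀ i ∈ s, t i ≠ 0) → ∑ i ∈ s, t i = 0 → ∑ i ∈ s, t i ^ p = p * β → β ≠ 0 →
    ∃ i ∈ s, lg v β ≤ wt v * (Real.log s.card - Real.log p) + p * lg v (t i)
  sum_unit : ∀ u ∈ G, ∑ v, lg v (u : Lˣ) = 0
  sum_nonneg : ∀ α ∈ Subring.closure {x : L | ∃ u ∈ G, (u : L) = x}, α ≠ 0 → 0 ≤ ∑ v, lg v α

namespace PlaceSystem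

variable {L : Type*} [Field L] {G : Subgroup Lˣ} {ι : Type*} [Fintype ι]

/-- The vector of logarithmic absolute values of a unit, with the `ℓ¹` norm. -/
noncomputable def vec (P : PlaceSystem L G ι) (u : Lˣ) : PiLp 1 (fun _ : ι => ℝ) :=
  WithLp.toLp 1 fun v => P.lg v u

lemma norm_vec (P : PlaceSystem L G ι) (u : Lˣ) : ‖P.vec u‖ = ∑ v, |P.lg v u| := by
  simp [vec, PiLp.norm_eq_of_L1]

lemma vec_mul (P : PlaceSystem L G ι) (u w : Lˣ) : P.vec (u * w) = P.vec u + P.vec w := by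
  ext v
  simp [vec, P.lg_mul v u w u.ne_zero w.ne_zero]

lemma vec_one (P : PlaceSystem L G ι) : P.vec 1 = 0 := by
  have := P.vec_mul 1 1
  simpa using this

lemma vec_inv (P : PlaceSystem L G ι) (u : Lˣ) : P.vec u⁻¹ = -P.vec u := by
  have := P.vec_mul u u⁻¹
  rw [mul_inv_cancel, vec_one] at this
  exact (neg_eq_of_add_eq_zero_right this.symm).symm

lemma vec_div (P : PlaceSystem L G ι) (u w : Lˣ) : P.vec (u / w) = P.vec u - P.vec w := by
  rw [div_eq_mul_inv, vec_mul, vec_inv, sub_eq_add_neg]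

lemma vec_pow (P : PlaceSystem L G ι) (u : Lˣ) (k : ℕ) : P.vec (u ^ k) = (k : ℝ) • P.vec u := by
  induction k with
  | zero => simp [vec_one]
  | succ k ih => rw [pow_succ, vec_mul, ih]; push_cast; rw [add_smul, one_smul]

lemma lg_one (P : PlaceSystem L G ι) (v : ι) : P.lg v 1 = 0 := by
  have := P.lg_mul v 1 1 one_ne_zero one_ne_zero
  simpa using this

lemma lg_pow (P : PlaceSystem L G ι) (v : ι) (x : L) (hx : x ≠ 0) (k : ℕ) :
    P.lg v (x ^ k) = k * P.lg v x := by
  induction k with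
  | zero => simp [lg_one]
  | succ k ih => rw [pow_succ, P.lg_mul v _ _ (pow_ne_zero _ hx) hx, ih]; push_cast; ring

lemma lg_prod (P : PlaceSystem L G ι) (v : ι) {σ : Type*} (s : Finset σ) (x : σ → L)
    (hx : ∀ i ∈ s, x i ≠ 0) : P.lg v (∏ i ∈ s, x i) = ∑ i ∈ s, P.lg v (x i) := by
  classical
  induction s using Finset.induction_on with
  | empty => simp [lg_one]
  | insert a s ha ih =>
    rw [Finset.prod_insert ha, Finset.sum_insert ha, P.lg_mul v _ _ (hx a (by simp))
      (Finset.prod_ne_zero_iff.2 fun i hi => hx i (by simp [hi])),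
      ih fun i hi => hx i (by simp [hi])]

/-- The positive part of the logarithmic vector of `u ∈ G` has half the total mass. -/
lemma sum_max_zero (P : PlaceSystem L G ι) {u : Lˣ} (hu : u ∈ G) :
    ∑ v, max 0 (P.lg v u) = ‖P.vec u‖ / 2 := by
  have h := P.sum_unit u hu
  have : ∀ v, max 0 (P.lg v u) = (P.lg v u + |P.lg v u|) / 2 := by
    intro v
    rcases le_total 0 (P.lg v u) with h | h
    · rw [max_eq_right h, abs_of_nonneg h]; ring
    · rw [max_eq_left h, abs_of_nonpos h]; ring
  simp_rw [this]
  rw [← Finset.sum_div, Finset.sum_add_distrib, h, norm_vec, zero_add]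

/-- The real span of the logarithmic vectors of a finite set of units. -/
noncomputable def spanVec (P : PlaceSystem L G ι) (S : Finset Lˣ) :
    Submodule ℝ (PiLp 1 (fun _ : ι => ℝ)) :=
  Submodule.span ℝ (P.vec '' (S : Set Lˣ))

lemma finrank_spanVec (P : PlaceSystem L G ι) (S : Finset Lˣ) :
    Module.finrank ℝ (P.spanVec S) ≤ S.card := by
  classical
  have : P.vec '' (S : Set Lˣ) = ((S.image P.vec : Finset _) : Set _) := by simp
  rw [spanVec, this]
  exact (finrank_span_finset_le_card _).trans Finset.card_image_le

lemma vec_mem_spanVec (P : PlaceSystem L G ι) (S : Finset Lˣ) {u : Lˣ} {k : ℕ} (hk : 0 < k)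
    (hu : u ^ k ∈ Subgroup.closure (S : Set Lˣ)) : P.vec u ∈ P.spanVec S := by
  have key : ∀ w ∈ Subgroup.closure (S : Set Lˣ), P.vec w ∈ P.spanVec S := by
    intro w hw
    induction hw using Subgroup.closure_induction with
    | mem x hx => exact Submodule.subset_span ⟨x, hx, rfl⟩
    | one => rw [vec_one]; exact Submodule.zero_mem _
    | mul x y _ _ hx hy => rw [vec_mul]; exact Submodule.add_mem _ hx hy
    | inv x _ hx => rw [vec_inv]; exact Submodule.neg_mem _ hx
  have h := key _ hu
  rw [vec_pow] at h
  have hk' : (k : ℝ) ≠ 0 := by positivity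
  exact ((P.spanVec S).smul_mem_iff hk').1 h

end PlaceSystem

/-- The group `G` has rank at most `ρ`, witnessed by a finite set not required to lie in `G`. -/
def RankLE {H : Type*} [CommGroup H] (G : Subgroup H) (ρ : ℕ) : Prop :=
  ∃ S : Finset H, S.card ≤ ρ ∧ ∀ x ∈ G, ∃ k : ℕ, 0 < k ∧ x ^ k ∈ Subgroup.closure (S : Set H)

lemma RankLE.mono {H : Type*} [CommGroup H] {G G' : Subgroup H} {ρ ρ' : ℕ} (h : RankLE G ρ)
    (hG : G' ≤ G) (hρ : ρ ≤ ρ') : RankLE G' ρ' := by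
  obtain ⟨S, hS, h⟩ := h
  exact ⟨S, hS.trans hρ, fun x hx => h x (hG hx)⟩

lemma RankLE.sup_closure {H : Type*} [CommGroup H] {G : Subgroup H} {ρ : ℕ} (h : RankLE G ρ)
    (B : Finset H) : RankLE (G ⊔ Subgroup.closure (B : Set H)) (ρ + B.card) := by
  classical
  obtain ⟨S, hS, h⟩ := h
  refine ⟨S ∪ B, (Finset.card_union_le _ _).trans (by omega), fun x hx => ?_⟩
  obtain ⟨y, hy, z, hz, rfl⟩ := Subgroup.mem_sup.1 hx
  obtain ⟨k, hk, hyk⟩ := h y hy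
  refine ⟨k, hk, ?_⟩
  rw [mul_pow]
  refine Subgroup.mul_mem _ ?_ (Subgroup.pow_mem _ ?_ k)
  · exact Subgroup.closure_mono (by simp) hyk
  · exact Subgroup.closure_mono (by simp) hz

/-- In a space of dimension at most `D`, a ball can be covered by boundedly many balls of half
the radius. -/
lemma exists_cover_half {E : Type*} [NormedAddCommGroup E] [NormedSpace ℝ E]
    [FiniteDimensional ℝ E] {D : ℕ} (hD : Module.finrank ℝ E ≤ D) (R : ℝ) :
    ∃ T : Finset E, T.card ≤ 5 ^ D ∧ ∀ x : E, ‖x‖ ≤ R → ∃ c ∈ T, ‖x - c‖ ≤ R / 2 := by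
  classical
  rcases le_or_gt R 0 with hR | hR
  · refine ⟨{0}, by simpa using Nat.one_le_pow _ _ (by norm_num), fun x hx => ⟨0, by simp, ?_⟩⟩
    have : ‖x‖ = 0 := le_antisymm (hx.trans hR) (norm_nonneg _)
    have h2 : R = 0 := le_antisymm hR (this ▸ hx)
    simp [this, h2]
  have hbound : ∀ s : Finset E, ((∀ c ∈ s, ‖c‖ ≤ 2) ∧ (∀ c ∈ s, ∀ d ∈ s, c ≠ d → 1 ≤ ‖c - d‖)) →
      s.card ≤ 5 ^ D := fun s hs =>
    (Besicovitch.card_le_of_separated s hs.1 hs.2).trans (Nat.pow_le_pow_right (by norm_num) hD)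
  let Q : ℕ → Prop := fun k => ∃ s : Finset E, s.card = k ∧ (∀ c ∈ s, ‖c‖ ≤ 2) ∧
    (∀ c ∈ s, ∀ d ∈ s, c ≠ d → 1 ≤ ‖c - d‖)
  have hQ0 : Q 0 := ⟨∅, by simp⟩
  obtain ⟨s, hcard, hs2, hs1⟩ := Nat.findGreatest_spec (P := Q) (Nat.zero_le (5 ^ D)) hQ0
  have hR' : 0 < R / 2 := by positivity
  refine ⟨s.image fun c => (R / 2) • c, Finset.card_image_le.trans (hbound s ⟨hs2, hs1⟩), ?_⟩
  intro x hx
  set y := (R / 2)⁻¹ • x with hy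
  have hxy : x = (R / 2) • y := by rw [hy, smul_smul, mul_inv_cancel₀ hR'.ne', one_smul]
  have hy2 : ‖y‖ ≤ 2 := by
    rw [hy, norm_smul, Real.norm_of_nonneg (by positivity), inv_mul_le_iff₀ hR']; linarith
  by_cases hfar : ∀ c ∈ s, 1 ≤ ‖y - c‖
  · exfalso
    have hys : y ∉ s := fun h => by
      have := hfar y h
      simp at this
      linarith
    have hQ : Q (s.card + 1) := by
      refine ⟨insert y s, Finset.card_insert_of_notMem hys, ?_, ?_⟩
      · simp only [Finset.mem_insert, forall_eq_or_imp]; exact ⟨hy2, hs2⟩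
      · simp only [Finset.mem_insert]
        rintro c (rfl | hc) d (rfl | hd) hcd
        · exact absurd rfl hcd
        · exact hfar d hd
        · rw [norm_sub_rev]; exact hfar c hc
        · exact hs1 c hc d hd hcd
    have hle : s.card + 1 ≤ 5 ^ D := by
      obtain ⟨s', h1, h2⟩ := hQ
      rw [← h1]
      exact hbound s' h2
    have := Nat.le_findGreatest (P := Q) hle hQ
    omega
  · push Not at hfar
    obtain ⟨c, hc, hlt⟩ := hfar
    refine ⟨(R / 2) • c, Finset.mem_image_of_mem _ hc, ?_⟩
    rw [hxy, ← smul_sub, norm_smul, Real.norm_of_nonneg hR'.le]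
    nlinarith

lemma exists_cover {E : Type*} [NormedAddCommGroup E] [NormedSpace ℝ E]
    [FiniteDimensional ℝ E] {D : ℕ} (hD : Module.finrank ℝ E ≤ D) (k : ℕ) (R : ℝ) :
    ∃ T : Finset E, T.card ≤ (5 ^ D) ^ k ∧ ∀ x : E, ‖x‖ ≤ R → ∃ c ∈ T, ‖x - c‖ ≤ R / 2 ^ k := by
  classical
  induction k with
  | zero => exact ⟨{0}, by simp, fun x hx => ⟨0, by simp, by simpa using hx⟩⟩
  | succ k ih =>
    obtain ⟨T, hT, hcov⟩ := ih
    obtain ⟨T', hT', hcov'⟩ := exists_cover_half (E := E) hD (R / 2 ^ k)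
    refine ⟨Finset.image₂ (· + ·) T T', ?_, fun x hx => ?_⟩
    · rw [pow_succ]
      exact Finset.card_image₂_le _ _ _ |>.trans (Nat.mul_le_mul hT hT')
    · obtain ⟨c, hc, hxc⟩ := hcov x hx
      obtain ⟨c', hc', hxc'⟩ := hcov' _ hxc
      refine ⟨c + c', Finset.mem_image₂_of_mem hc hc', ?_⟩
      rw [← sub_sub, pow_succ, ← div_div]
      exact hxc'

/-- Points of a ball in a space of dimension at most `D` can be coloured with boundedly many
colours so that points of the same colour are close. -/
lemma exists_coloring {E : Type*} [NormedAddCommGroup E] [NormedSpace ℝ E]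
    (W : Submodule ℝ E) [FiniteDimensional ℝ W] {D : ℕ} (hD : Module.finrank ℝ W ≤ D) (k : ℕ)
    (R : ℝ) : ∃ col : E → Fin ((5 ^ D) ^ (k + 1)), ∀ x ∈ W, ∀ y ∈ W, ‖x‖ ≤ R → ‖y‖ ≤ R →
      col x = col y → ‖x - y‖ ≤ R / 2 ^ k := by
  classical
  obtain ⟨T, hT, hcov⟩ := exists_cover hD (k + 1) R
  have hpos : 0 < (5 ^ D) ^ (k + 1) := by positivity
  let g : T → Fin ((5 ^ D) ^ (k + 1)) := fun c => ⟨T.equivFin c, (T.equivFin c).2.trans_le hT⟩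
  have hg : Function.Injective g := fun a b h => by
    simpa [g, Fin.ext_iff, Fin.val_inj] using h
  choose! c hcT hc using hcov
  let col : E → Fin ((5 ^ D) ^ (k + 1)) := fun x =>
    if h : x ∈ W ∧ ‖x‖ ≤ R then g ⟨c ⟨x, h.1⟩, hcT ⟨x, h.1⟩ h.2⟩ else ⟨0, hpos⟩
  refine ⟨col, fun x hx y hy hxR hyR h => ?_⟩
  simp only [col, dif_pos (And.intro hx hxR), dif_pos (And.intro hy hyR)] at h
  have h' := congrArg Subtype.val (hg h)
  simp only at h'
  have h1 := hc ⟨x, hx⟩ hxR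
  have h2 := hc ⟨y, hy⟩ hyR
  rw [← h'] at h2
  have h3 := norm_sub_le_norm_sub_add_norm_sub (⟨x, hx⟩ : W) (c ⟨x, hx⟩) ⟨y, hy⟩
  rw [norm_sub_rev (c ⟨x, hx⟩)] at h3
  have h4 : ‖x - y‖ = ‖(⟨x, hx⟩ : W) - ⟨y, hy⟩‖ := rfl
  rw [h4]
  calc _ ≤ R / 2 ^ (k + 1) + R / 2 ^ (k + 1) := by linarith
    _ = R / 2 ^ k := by rw [pow_succ]; field_simp; ring

/-- A family of vectors not annihilated by a common nonzero linear form contains a square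
matrix with nonzero determinant. -/
lemma exists_relation_of_det_eq_zero {L : Type*} [Field L] {κ : Type*} [Fintype κ]
    [DecidableEq κ] (Z : Set (κ → L))
    (hdet : ∀ x : κ → κ → L, (∀ i, x i ∈ Z) → (Matrix.of x).det = 0) :
    ∃ a : κ → L, a ≠ 0 ∧ ∀ z ∈ Z, ∑ j, a j * z j = 0 := by
  by_cases htop : Submodule.span L Z = ⊤
  · exfalso
    obtain ⟨f, hfZ, -, hind⟩ := Submodule.exists_fun_fin_finrank_span_eq L Z
    have hcard : Module.finrank L (Submodule.span L Z) = Fintype.card κ := by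
      rw [htop, finrank_top, Module.finrank_fintype_fun_eq_card]
    let e : κ ≃ Fin (Module.finrank L (Submodule.span L Z)) :=
      (Fintype.equivFin κ).trans (finCongr hcard.symm)
    have hind' : LinearIndependent L (fun i => f (e i)) := hind.comp e e.injective
    have h1 := hdet (fun i => f (e i)) fun i => hfZ _
    have h2 : IsUnit (Matrix.of fun i => f (e i)) :=
      Matrix.linearIndependent_rows_iff_isUnit.1 hind'
    rw [Matrix.isUnit_iff_isUnit_det, h1] at h2
    exact not_isUnit_zero h2
  · obtain ⟨φ, hφ, hker⟩ := Submodule.exists_le_ker_of_lt_top _ (lt_top_iff_ne_top.2 htop)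
    have hrep : ∀ z : κ → L, φ z = ∑ j, φ (Pi.single j 1) * z j := by
      intro z
      conv_lhs => rw [pi_eq_sum_univ' z, map_sum]
      refine Finset.sum_congr rfl fun j _ => ?_
      rw [map_smul, smul_eq_mul, mul_comm]
    refine ⟨fun j => φ (Pi.single j 1), fun h => hφ ?_, fun z hz => ?_⟩
    · ext j
      have := congrFun h j
      simpa using this
    · rw [← hrep]
      exact hker (Submodule.subset_span hz)

/-- A linear relation with a nonzero coefficient turns `∑ z = 1` into an equation in fewer
variables. -/
lemma exists_shorter_equation {L : Type*} [Field L] {κ : Type*} [Fintype κ] {Z : Set (κ → L)}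
    {a : κ → L} (ha : a ≠ 0) (hZ : ∀ z ∈ Z, ∑ j, z j = 1) (h : ∀ z ∈ Z, ∑ j, a j * z j = 0) :
    ∃ b : κ → L, ∃ j, b j = 0 ∧ ∀ z ∈ Z, ∑ i, b i * z i = 1 := by
  obtain ⟨j, hj⟩ := Function.ne_iff.1 ha
  refine ⟨fun i => (a j - a i) / a j, j, by simp, fun z hz => ?_⟩
  have hj' : a j ≠ 0 := hj
  have : ∀ i, (a j - a i) / a j * z i = z i - (a i * z i) / a j := fun i => by field_simp
  simp_rw [this]
  rw [Finset.sum_sub_distrib, ← Finset.sum_div, h z hz, hZ z hz]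
  simp

namespace PlaceSystem

variable {L : Type*} [Field L] {G : Subgroup Lˣ} {ι : Type*} [Fintype ι]

lemma eq_zero_of_sum_neg (P : PlaceSystem L G ι) {α : L}
    (hα : α ∈ Subring.closure {x : L | ∃ u ∈ G, (u : L) = x}) (f : ι → ℝ)
    (hf : α ≠ 0 → ∀ v, P.lg v α ≤ f v) (hneg : ∑ v, f v < 0) : α = 0 := by
  by_contra h
  have h1 := P.sum_nonneg α hα h
  have h2 := Finset.sum_le_sum fun v (_ : v ∈ Finset.univ) => hf h v
  linarith

lemma lg_det_le (P : PlaceSystem L G ι) (v : ι) {κ : Type} [Fintype κ] [DecidableEq κ]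
    (y : Matrix κ κ L) (hy : ∀ i j, y i j ≠ 0) (b : κ → ℝ) (e : κ → κ → ℝ)
    (he : ∀ i j, 0 ≤ e i j) (h : ∀ i j, P.lg v (y i j) ≤ b j + e i j) (hdet : y.det ≠ 0) :
    P.lg v y.det ≤ P.wt v * Real.log (Fintype.card κ).factorial + ∑ j, b j
      + ∑ i, ∑ j, e i j := by
  have hne := hdet
  rw [Matrix.det_apply'] at hne ⊢
  obtain ⟨σ, -, hσ⟩ := P.lg_sum v (Equiv.Perm κ) Finset.univ
    (fun σ => (Equiv.Perm.sign σ : ℤ)) (fun σ => ∏ i, y (σ i) i)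
    (fun σ _ => Finset.prod_ne_zero_iff.2 fun i _ => hy _ _) hne
  have h1 : ∑ σ : Equiv.Perm κ, |(((Equiv.Perm.sign σ : ℤˣ) : ℤ) : ℝ)| =
      (Fintype.card κ).factorial := by
    have : ∀ σ : Equiv.Perm κ, |(((Equiv.Perm.sign σ : ℤˣ) : ℤ) : ℝ)| = 1 := fun σ => by
      rcases Int.units_eq_one_or (Equiv.Perm.sign σ) with h | h <;> simp [h]
    simp [this, Fintype.card_perm]
  rw [h1] at hσ
  refine hσ.trans ?_
  rw [P.lg_prod v _ _ fun i _ => hy _ _, add_assoc]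
  gcongr
  calc ∑ i, P.lg v (y (σ i) i) ≤ ∑ i, (b i + e (σ i) i) := Finset.sum_le_sum fun i _ => h _ _
    _ = ∑ i, b i + ∑ i, e (σ i) i := Finset.sum_add_distrib
    _ ≤ ∑ i, b i + ∑ j, ∑ i, e i j := by
      gcongr with j
      exact Finset.single_le_sum (f := fun i => e i j) (fun _ _ => he _ _) (Finset.mem_univ (σ j))
    _ = _ := by rw [Finset.sum_comm]

lemma coe_mem {u : Lˣ} (hu : u ∈ G) :
    (u : L) ∈ Subring.closure {x : L | ∃ u ∈ G, (u : L) = x} :=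
  Subring.subset_closure ⟨u, hu, rfl⟩

lemma det_mem {κ : Type*} [Fintype κ] [DecidableEq κ] (y : Matrix κ κ L)
    (hy : ∀ i j, y i j ∈ Subring.closure {x : L | ∃ u ∈ G, (u : L) = x}) :
    y.det ∈ Subring.closure {x : L | ∃ u ∈ G, (u : L) = x} := by
  rw [Matrix.det_apply']
  exact sum_mem fun σ _ => mul_mem (intCast_mem _ _) (prod_mem fun i _ => hy _ _)

/-- Close solutions of large height of the unit equation are linearly dependent. -/
lemma det_eq_zero_of_close (P : PlaceSystem L G ι) {κ : Type} [Fintype κ] [DecidableEq κ]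
    (x : κ → κ → Lˣ) (hx : ∀ i j, x i j ∈ G) (hsum : ∀ i, ∑ j, (x i j : L) = 1) (η : ℝ)
    (i₀ j₀ : κ) (hclose : ∀ i j, ‖P.vec (x i j) - P.vec (x i₀ j)‖ ≤ η)
    (hbig : Real.log (Fintype.card κ).factorial + (Fintype.card κ : ℝ) ^ 2 * η <
      ‖P.vec (x i₀ j₀)‖ / 2) :
    (Matrix.of fun i j => (x i j : L)).det = 0 := by
  set y : Matrix κ κ L := Matrix.of fun i j => (x i j : L) with hy
  set e : ι → κ → κ → ℝ := fun v i j => |P.lg v (x i j) - P.lg v (x i₀ j)| with he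
  have hdet : y.det = (y.updateCol j₀ fun _ => 1).det := by
    have := Matrix.det_updateCol_sum y j₀ (fun _ => 1)
    rw [one_smul] at this
    rw [← this]
    congr 2
    ext k
    simpa [hy] using hsum k
  refine P.eq_zero_of_sum_neg (det_mem _ fun i j => coe_mem (hx i j))
    (fun v => P.wt v * Real.log (Fintype.card κ).factorial + (∑ j, P.lg v (x i₀ j)
      - max 0 (P.lg v (x i₀ j₀))) + ∑ i, ∑ j, e v i j) (fun hne v => ?_) ?_
  · rcases max_choice 0 (P.lg v (x i₀ j₀)) with hm | hm
    · rw [hm, sub_zero]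
      refine P.lg_det_le v y (fun i j => (x i j).ne_zero) _ _ (fun i j => abs_nonneg _)
        (fun i j => ?_) hne
      have := le_abs_self (P.lg v (x i j) - P.lg v (x i₀ j))
      simp only [hy, Matrix.of_apply]
      linarith
    · rw [hm]
      have hs : ∑ j, P.lg v (x i₀ j) - P.lg v (x i₀ j₀) =
          ∑ j, (if j = j₀ then 0 else P.lg v (x i₀ j)) := by
        rw [Finset.sum_ite, Finset.sum_const_zero, zero_add, Finset.filter_ne',
          ← Finset.sum_erase_add _ _ (Finset.mem_univ j₀)]
        ring
      rw [hs, hdet]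
      refine P.lg_det_le v _ (fun i j => ?_) _ _ (fun i j => abs_nonneg _) (fun i j => ?_)
        (hdet ▸ hne)
      · rw [Matrix.updateCol_apply]
        split_ifs
        · exact one_ne_zero
        · exact (x i j).ne_zero
      · rw [Matrix.updateCol_apply]
        have := le_abs_self (P.lg v (x i j) - P.lg v (x i₀ j))
        split_ifs
        · rw [P.lg_one, zero_add]; exact abs_nonneg _
        · simp only [hy, Matrix.of_apply]; linarith
  · rw [Finset.sum_add_distrib, Finset.sum_add_distrib, Finset.sum_sub_distrib, ← Finset.sum_mul,
      P.wt_sum, P.sum_max_zero (hx i₀ j₀), Finset.sum_comm (s := Finset.univ (α := ι))]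
    have h0 : ∑ j, ∑ v, P.lg v (x i₀ j) = 0 :=
      Finset.sum_eq_zero fun j _ => P.sum_unit _ (hx i₀ j)
    have hE : ∑ v, ∑ i, ∑ j, e v i j ≤ (Fintype.card κ : ℝ) ^ 2 * η := by
      rw [Finset.sum_comm]
      have : ∀ i, ∑ v, ∑ j, e v i j ≤ Fintype.card κ * η := fun i => by
        rw [Finset.sum_comm]
        have : ∀ j ∈ Finset.univ, ∑ v, e v i j ≤ η := fun j _ => by
          refine le_trans (le_of_eq ?_) (hclose i j)
          rw [PiLp.norm_eq_of_L1]
          rfl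
        simpa using Finset.sum_le_sum this
      have := Finset.sum_le_sum fun i (_ : i ∈ (Finset.univ : Finset κ)) => this i
      simp only [Finset.sum_const, Finset.card_univ, nsmul_eq_mul] at this
      linarith
    rw [h0]
    linarith

lemma exists_relation_of_large (P : PlaceSystem L G ι) {κ : Type} [Fintype κ] [DecidableEq κ]
    [Nonempty κ] (Z : Set (κ → Lˣ)) (hZ : ∀ z ∈ Z, ∀ j, z j ∈ G)
    (hsum : ∀ z ∈ Z, ∑ j, (z j : L) = 1) (η : ℝ)
    (hclose : ∀ z ∈ Z, ∀ z' ∈ Z, ∀ j, ‖P.vec (z j) - P.vec (z' j)‖ ≤ η)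
    (hbig : ∀ z ∈ Z, ∃ j, Real.log (Fintype.card κ).factorial + (Fintype.card κ : ℝ) ^ 2 * η <
      ‖P.vec (z j)‖ / 2) :
    ∃ a : κ → L, a ≠ 0 ∧ ∀ z ∈ Z, ∑ j, a j * (z j : L) = 0 := by
  obtain ⟨i₀⟩ := ‹Nonempty κ›
  obtain ⟨a, ha, h⟩ := exists_relation_of_det_eq_zero (L := L)
      ((fun z : κ → Lˣ => fun j => (z j : L)) '' Z) (by
        intro x hx
        choose z hzZ hz using hx
        have hxz : x = fun i j => (z i j : L) := by funext i; exact (hz i).symm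
        obtain ⟨j₀, hj₀⟩ := hbig (z i₀) (hzZ i₀)
        rw [hxz]
        exact P.det_eq_zero_of_close z (fun i => hZ _ (hzZ i)) (fun i => hsum _ (hzZ i)) η i₀ j₀
          (fun i j => hclose _ (hzZ i) _ (hzZ i₀) j) hj₀)
  exact ⟨a, ha, fun z hz => h _ ⟨z, hz, rfl⟩⟩

end PlaceSystem

lemma exists_sum_pow_prime_eq {R : Type*} [CommRing R] {p : ℕ} (hp : p.Prime) {σ : Type*}
    (s : Finset σ) (t : σ → R) : ∃ r, (∑ i ∈ s, t i) ^ p = ∑ i ∈ s, t i ^ p + p * r := by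
  classical
  induction s using Finset.induction_on with
  | empty => exact ⟨0, by simp [hp.ne_zero]⟩
  | insert a s ha ih =>
    obtain ⟨r, hr⟩ := ih
    obtain ⟨r', hr'⟩ := exists_add_pow_prime_eq hp (t a) (∑ i ∈ s, t i)
    refine ⟨r + t a * (∑ i ∈ s, t i) * r', ?_⟩
    rw [Finset.sum_insert ha, Finset.sum_insert ha, hr', hr]
    ring

/-- If sufficiently many weighted power sums of a family vanish, every fibre of the base points
has vanishing weight. -/
lemma sum_filter_eq_zero_of_sum_mul_pow {L : Type*} [Field L] [DecidableEq L] {σ : Type*}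
    (s : Finset σ) (t w : σ → L) (h : ∀ j < s.card, ∑ i ∈ s, t i * w i ^ j = 0) (v : L)
    (hv : v ∈ s.image w) : ∑ i ∈ s with w i = v, t i = 0 := by
  set p : Polynomial L := ∏ u ∈ (s.image w).erase v, (Polynomial.X - Polynomial.C u) with hp
  have hdeg : p.natDegree < s.card := by
    rw [hp, Polynomial.natDegree_prod_of_monic _ _ fun u _ => Polynomial.monic_X_sub_C u]
    simp only [Polynomial.natDegree_X_sub_C, Finset.sum_const, smul_eq_mul, mul_one]
    have h1 := Finset.card_erase_lt_of_mem hv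
    have h2 : (s.image w).card ≤ s.card := Finset.card_image_le
    omega
  have hzero : ∑ i ∈ s, t i * p.eval (w i) = 0 := by
    simp_rw [Polynomial.eval_eq_sum_range, Finset.mul_sum]
    rw [Finset.sum_comm]
    refine Finset.sum_eq_zero fun j hj => ?_
    have := h j (by have := Finset.mem_range.1 hj; omega)
    calc _ = p.coeff j * ∑ i ∈ s, t i * w i ^ j := by
            rw [Finset.mul_sum]; exact Finset.sum_congr rfl fun i _ => by ring
      _ = 0 := by rw [this, mul_zero]
  have heval : ∀ i ∈ s, w i ≠ v → p.eval (w i) = 0 := by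
    intro i hi hne
    rw [hp, Polynomial.eval_prod]
    exact Finset.prod_eq_zero (Finset.mem_erase.2 ⟨hne, Finset.mem_image_of_mem w hi⟩) (by simp)
  have hvne : p.eval v ≠ 0 := by
    rw [hp, Polynomial.eval_prod]
    refine Finset.prod_ne_zero_iff.2 fun u hu => ?_
    simpa [sub_eq_zero] using (Finset.ne_of_mem_erase hu).symm
  rw [← Finset.sum_filter_add_sum_filter_not s (fun i => w i = v)] at hzero
  rw [Finset.sum_eq_zero (s := s.filter fun i => ¬ w i = v) fun i hi => by
    rw [heval i (Finset.mem_filter.1 hi).1 (Finset.mem_filter.1 hi).2, mul_zero], add_zero,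
    Finset.sum_congr rfl (g := fun i => t i * p.eval v) fun i hi => by
      rw [(Finset.mem_filter.1 hi).2], ← Finset.sum_mul] at hzero
  exact (mul_eq_zero.1 hzero).resolve_right hvne

/-- The elements of each fibre of the `Q`-th power map can be distinguished by `Q` labels. -/
lemma exists_label_pow {L : Type*} [Field L] {Q : ℕ} (hQ : 0 < Q) :
    ∃ f : Lˣ → Fin Q, ∀ x y, x ^ Q = y ^ Q → f x = f y → x = y := by
  classical
  have hmem : ∀ x : Lˣ, (x : L) ∈ (Polynomial.nthRoots Q ((x : L) ^ Q)).toFinset := fun x => by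
    rw [Multiset.mem_toFinset, Polynomial.mem_nthRoots hQ]
  have hcard : ∀ w : L, (Polynomial.nthRoots Q w).toFinset.card ≤ Q := fun w =>
    (Multiset.toFinset_card_le _).trans (Polynomial.card_nthRoots Q w)
  have key : ∀ w : L, ∃ g : L → Fin Q, ∀ x ∈ (Polynomial.nthRoots Q w).toFinset,
      ∀ y ∈ (Polynomial.nthRoots Q w).toFinset, g x = g y → x = y := by
    intro w
    let F := (Polynomial.nthRoots Q w).toFinset
    refine ⟨fun x => if h : x ∈ F then ⟨F.equivFin ⟨x, h⟩, (F.equivFin _).2.trans_le (hcard w)⟩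
      else ⟨0, hQ⟩, fun x hx y hy h => ?_⟩
    change x ∈ F at hx
    change y ∈ F at hy
    simpa [hx, hy, Fin.ext_iff, Fin.val_inj] using h
  choose g hg using key
  refine ⟨fun x => g ((x : L) ^ Q) x, fun x y hxy h => ?_⟩
  have hxy' : (x : L) ^ Q = (y : L) ^ Q := by
    have := congrArg Units.val hxy
    simpa using this
  simp only [← hxy'] at h
  exact Units.ext (hg _ _ (hmem x) _ (hxy' ▸ hmem y) h)

namespace PlaceSystem

variable {L : Type*} [Field L] {G : Subgroup Lˣ} {ι : Type*} [Fintype ι]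

lemma sum_pow_prime_eq_zero (P : PlaceSystem L G ι) {σ : Type} (s : Finset σ) (t : σ → L)
    (ht : ∀ i ∈ s, t i ∈ Subring.closure {x : L | ∃ u ∈ G, (u : L) = x})
    (ht0 : ∀ i ∈ s, t i ≠ 0) (M : ι → ℝ) (hM : ∀ i ∈ s, ∀ v, P.lg v (t i) ≤ M v) {p : ℕ}
    (hp : p.Prime) (hsmall : p * ∑ v, M v < Real.log p - Real.log s.card)
    (hsum : ∑ i ∈ s, t i = 0) : ∑ i ∈ s, t i ^ p = 0 := by
  obtain ⟨r, hr⟩ := exists_sum_pow_prime_eq hp s.attach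
    (fun i => (⟨t i, ht i i.2⟩ : Subring.closure {x : L | ∃ u ∈ G, (u : L) = x}))
  have hr' := congrArg Subtype.val hr
  simp only [Subring.coe_pow, AddSubmonoidClass.coe_finsetSum, Subring.coe_add, Subring.coe_mul,
    Subring.coe_natCast, Finset.sum_attach s t, Finset.sum_attach s (fun i => t i ^ p), hsum,
    zero_pow hp.ne_zero] at hr'
  have hβ : ∑ i ∈ s, t i ^ p = p * (-(r : L)) := by
    rw [mul_neg]; exact eq_neg_of_add_eq_zero_left hr'.symm
  have : -(r : L) = 0 := by
    refine P.eq_zero_of_sum_neg (neg_mem r.2)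
      (fun v => P.wt v * (Real.log s.card - Real.log p) + p * M v) (fun hne v => ?_) ?_
    · obtain ⟨i, hi, h⟩ := P.lg_frob v σ s t p _ hp ht0 hsum hβ hne
      have := hM i hi v
      have hp0 : (0 : ℝ) ≤ p := by positivity
      nlinarith
    · rw [Finset.sum_add_distrib, ← Finset.sum_mul, P.wt_sum, ← Finset.mul_sum]
      linarith
  rw [hβ, this, mul_zero]

lemma sum_pow_eq_zero (P : PlaceSystem L G ι) {σ : Type} (s : Finset σ) (hs : s.Nonempty)
    (t : σ → L) (ht : ∀ i ∈ s, t i ∈ Subring.closure {x : L | ∃ u ∈ G, (u : L) = x})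
    (ht0 : ∀ i ∈ s, t i ≠ 0) (M : ι → ℝ) (hM : ∀ i ∈ s, ∀ v, P.lg v (t i) ≤ M v)
    (hM0 : 0 ≤ ∑ v, M v) (hsum : ∑ i ∈ s, t i = 0) (e : ℕ) (he : e ≠ 0)
    (hprime : ∀ q : ℕ, q.Prime → q ∣ e → s.card < q)
    (hsmall : e * ∑ v, M v < Real.log (s.card + 1) - Real.log s.card) :
    ∑ i ∈ s, t i ^ e = 0 := by
  induction e using induction_on_primes with
  | zero => exact absurd rfl he
  | one => simpa using hsum
  | prime_mul p a hp ih =>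
    have ha : a ≠ 0 := right_ne_zero_of_mul he
    have hp1 : (1 : ℝ) ≤ p := by exact_mod_cast hp.one_lt.le
    push_cast at hsmall
    have ha0 : (0 : ℝ) ≤ a * ∑ v, M v := by positivity
    have h1 := ih ha (fun q hq hqa => hprime q hq (hqa.mul_left p)) (by nlinarith)
    have hsp : s.card < p := hprime p hp (dvd_mul_right _ _)
    have h2 := P.sum_pow_prime_eq_zero s (fun i => t i ^ a) (fun i hi => pow_mem (ht i hi) _)
      (fun i hi => pow_ne_zero _ (ht0 i hi)) (fun v => a * M v)
      (fun i hi v => by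
        rw [P.lg_pow v _ (ht0 i hi)]
        exact mul_le_mul_of_nonneg_left (hM i hi v) (by positivity)) hp (by
        rw [← Finset.mul_sum]
        have : Real.log (s.card + 1) ≤ Real.log p :=
          Real.log_le_log (by positivity) (by exact_mod_cast hsp)
        linarith) h1
    simpa [← pow_mul, mul_comm a p] using h2

/-- A vanishing sum of terms of very small height decomposes according to the values of a fixed
power of its terms. -/
lemma exists_ne_pow_eq (P : PlaceSystem L G ι) {σ : Type} (s : Finset σ)
    (t : σ → L) (ht : ∀ i ∈ s, t i ∈ Subring.closure {x : L | ∃ u ∈ G, (u : L) = x})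
    (ht0 : ∀ i ∈ s, t i ≠ 0) (M : ι → ℝ) (hM : ∀ i ∈ s, ∀ v, P.lg v (t i) ≤ M v)
    (hM0 : 0 ≤ ∑ v, M v) (hsum : ∑ i ∈ s, t i = 0)
    (hsmall : (1 + s.card * s.card.factorial : ℕ) * ∑ v, M v <
      Real.log (s.card + 1) - Real.log s.card) (i₀ : σ) (hi₀ : i₀ ∈ s) :
    ∃ i ∈ s, i ≠ i₀ ∧ t i ^ s.card.factorial = t i₀ ^ s.card.factorial := by
  classical
  set Q := s.card.factorial with hQ
  have h1 : ∀ j < s.card, ∑ i ∈ s, t i * (t i ^ Q) ^ j = 0 := by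
    intro j hj
    have := P.sum_pow_eq_zero s ⟨i₀, hi₀⟩ t ht ht0 M hM hM0 hsum (1 + Q * j) (by omega)
      (fun q hq hqd => by
        by_contra hle
        have hqQ : q ∣ Q := hq.dvd_factorial.2 (not_lt.1 hle)
        have : q ∣ 1 := (Nat.dvd_add_left (hqQ.mul_right j)).1 hqd
        exact hq.one_lt.ne' (Nat.dvd_one.1 this)) (by
        refine lt_of_le_of_lt (mul_le_mul_of_nonneg_right ?_ hM0) hsmall
        have : 1 + Q * j ≤ 1 + s.card * Q := by nlinarith
        exact_mod_cast this)
    simpa [pow_add, pow_mul] using this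
  have h2 := sum_filter_eq_zero_of_sum_mul_pow s t (fun i => t i ^ Q) h1 (t i₀ ^ Q)
    (Finset.mem_image_of_mem _ hi₀)
  by_contra hcon
  push Not at hcon
  have h3 : s.filter (fun i => t i ^ Q = t i₀ ^ Q) = {i₀} := by
    ext i
    simp only [Finset.mem_filter, Finset.mem_singleton]
    refine ⟨fun h => ?_, by rintro rfl; exact ⟨hi₀, rfl⟩⟩
    by_contra hne
    exact hcon i h.1 hne h.2
  rw [h3, Finset.sum_singleton] at h2
  exact ht0 i₀ hi₀ h2

lemma lg_neg_one (P : PlaceSystem L G ι) (v : ι) : P.lg v (-1) = 0 := by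
  have h := P.lg_mul v (-1) (-1) (by simp) (by simp)
  simp only [mul_neg, mul_one, neg_neg, P.lg_one] at h
  linarith

/-- The multiplicative relation forced by the vanishing of a determinant of close points. -/
lemma exists_perm_prod_pow_eq (P : PlaceSystem L G ι) {κ : Type} [Fintype κ] [DecidableEq κ]
    [Nonempty κ]
    (x : κ → κ → Lˣ) (hx : ∀ i j, x i j ∈ G) (c : κ → L) (hc : c ≠ 0)
    (hrel : ∀ i, ∑ j, c j * (x i j : L) = 0) (η : ℝ)
    (hclose : ∀ i i' j, ‖P.vec (x i j) - P.vec (x i' j)‖ ≤ η)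
    (hsmall : (1 + (Fintype.card κ).factorial * (Fintype.card κ).factorial.factorial : ℕ) *
      ((Fintype.card κ : ℝ) ^ 2 * η) <
      Real.log ((Fintype.card κ).factorial + 1) - Real.log (Fintype.card κ).factorial) :
    ∃ σ : Equiv.Perm κ, σ ≠ 1 ∧
      (∏ i, x i (σ i)) ^ (2 * (Fintype.card κ).factorial.factorial) =
      (∏ i, x i i) ^ (2 * (Fintype.card κ).factorial.factorial) := by
  obtain ⟨i₀⟩ := ‹Nonempty κ›
  have hη : 0 ≤ η := (norm_nonneg _).trans (hclose i₀ i₀ i₀)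
  have hcardperm : (Finset.univ : Finset (Equiv.Perm κ)).card = (Fintype.card κ).factorial := by
    rw [Finset.card_univ, Fintype.card_perm]
  have hdet : (Matrix.of fun j i => (x i j : L)).det = 0 := by
    refine Matrix.exists_vecMul_eq_zero_iff.1 ⟨c, hc, ?_⟩
    ext i
    simpa [Matrix.vecMul, dotProduct] using hrel i
  rw [Matrix.det_apply'] at hdet
  simp only [Matrix.of_apply] at hdet
  set e : ι → κ → κ → ℝ := fun v i j => |P.lg v (x i j) - P.lg v (x i₀ j)| with he
  set M : ι → ℝ := fun v => ∑ j, P.lg v (x i₀ j) + ∑ i, ∑ j, e v i j with hMdef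
  have hsign : ∀ σ : Equiv.Perm κ, (((Equiv.Perm.sign σ : ℤˣ) : ℤ) : L) = 1 ∨
      (((Equiv.Perm.sign σ : ℤˣ) : ℤ) : L) = -1 := fun σ => by
    rcases Int.units_eq_one_or (Equiv.Perm.sign σ) with h | h <;> simp [h]
  have hprod0 : ∀ σ : Equiv.Perm κ, (∏ i, (x i (σ i) : L)) ≠ 0 := fun σ =>
    Finset.prod_ne_zero_iff.2 fun i _ => (x _ _).ne_zero
  have hM : ∀ σ : Equiv.Perm κ, ∀ v,
      P.lg v ((((Equiv.Perm.sign σ : ℤˣ) : ℤ) : L) * ∏ i, (x i (σ i) : L)) ≤ M v := by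
    intro σ v
    rw [P.lg_mul v _ _ (by rcases hsign σ with h | h <;> simp [h]) (hprod0 σ),
      P.lg_prod v _ _ fun i _ => (x _ _).ne_zero]
    have h0 : P.lg v (((Equiv.Perm.sign σ : ℤˣ) : ℤ) : L) = 0 := by
      rcases hsign σ with h | h <;> rw [h]
      exacts [P.lg_one v, P.lg_neg_one v]
    rw [h0, zero_add]
    calc ∑ i, P.lg v (x i (σ i)) ≤ ∑ i, (P.lg v (x i₀ (σ i)) + e v i (σ i)) := by
          refine Finset.sum_le_sum fun i _ => ?_
          have := le_abs_self (P.lg v (x i (σ i)) - P.lg v (x i₀ (σ i)))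
          simp only [he]
          linarith
      _ = ∑ i, P.lg v (x i₀ i) + ∑ i, e v i (σ i) := by
          rw [Finset.sum_add_distrib, Equiv.sum_comp σ fun i => P.lg v (x i₀ i)]
      _ ≤ M v := by
          simp only [hMdef]
          gcongr with i
          exact Finset.single_le_sum (f := fun j => e v i j) (fun _ _ => abs_nonneg _)
            (Finset.mem_univ _)
  have hMsum : ∑ v, M v = ∑ i, ∑ j, ‖P.vec (x i j) - P.vec (x i₀ j)‖ := by
    simp only [hMdef]
    rw [Finset.sum_add_distrib, Finset.sum_comm,
      Finset.sum_eq_zero fun j _ => P.sum_unit _ (hx i₀ j), zero_add, Finset.sum_comm]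
    refine Finset.sum_congr rfl fun i _ => ?_
    rw [Finset.sum_comm]
    refine Finset.sum_congr rfl fun j _ => ?_
    rw [PiLp.norm_eq_of_L1]
    rfl
  have hMle : ∑ v, M v ≤ (Fintype.card κ : ℝ) ^ 2 * η := by
    rw [hMsum]
    calc _ ≤ ∑ _i : κ, ∑ _j : κ, η :=
          Finset.sum_le_sum fun i _ => Finset.sum_le_sum fun j _ => hclose i i₀ j
      _ = _ := by simp; ring
  have hM0 : 0 ≤ ∑ v, M v := by
    rw [hMsum]
    exact Finset.sum_nonneg fun i _ => Finset.sum_nonneg fun j _ => norm_nonneg _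
  obtain ⟨σ, -, hσ1, hσ⟩ := P.exists_ne_pow_eq (Finset.univ : Finset (Equiv.Perm κ))
    (fun σ => (((Equiv.Perm.sign σ : ℤˣ) : ℤ) : L) * ∏ i, (x i (σ i) : L))
    (fun σ _ => mul_mem (intCast_mem _ _) (prod_mem fun i _ => coe_mem (hx _ _)))
    (fun σ _ => mul_ne_zero (by rcases hsign σ with h | h <;> simp [h]) (hprod0 σ))
    M (fun σ _ => hM σ) hM0 hdet (by
      rw [hcardperm]
      exact lt_of_le_of_lt (mul_le_mul_of_nonneg_left hMle (by positivity)) hsmall) 1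
    (Finset.mem_univ _)
  refine ⟨σ, hσ1, ?_⟩
  rw [hcardperm] at hσ
  have h2 := congrArg (· ^ 2) hσ
  simp only [mul_pow, ← pow_mul, mul_comm _ 2] at h2
  have hs2 : ∀ σ : Equiv.Perm κ, ((((Equiv.Perm.sign σ : ℤˣ) : ℤ) : L)) ^
      (2 * (Fintype.card κ).factorial.factorial) = 1 := fun σ => by
    rw [pow_mul]
    rcases hsign σ with h | h <;> simp [h]
  rw [hs2, hs2, one_mul, one_mul] at h2
  ext
  push_cast
  simpa using h2

/-- Close points on a hyperplane split into boundedly many classes, in each of which two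
coordinates are proportional. -/
lemma exists_coloring_proportional (P : PlaceSystem L G ι) {κ : Type} [Fintype κ]
    [DecidableEq κ] [Nonempty κ] (Z : Set (κ → Lˣ)) (hZ : ∀ z ∈ Z, ∀ j, z j ∈ G) (c : κ → L)
    (hc : c ≠ 0) (hrel : ∀ z ∈ Z, ∑ j, c j * (z j : L) = 0) (η : ℝ)
    (hclose : ∀ z ∈ Z, ∀ z' ∈ Z, ∀ j, ‖P.vec (z j) - P.vec (z' j)‖ ≤ η)
    (hsmall : (1 + (Fintype.card κ).factorial * (Fintype.card κ).factorial.factorial : ℕ) *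
      ((Fintype.card κ : ℝ) ^ 2 * η) <
      Real.log ((Fintype.card κ).factorial + 1) - Real.log (Fintype.card κ).factorial) :
    ∃ col : (κ → Lˣ) → Equiv.Perm κ × Fin (2 * (Fintype.card κ).factorial.factorial),
      ∀ z₀ ∈ Z, ∃ r j, r ≠ j ∧ ∃ y : Lˣ, ∀ z ∈ Z, col z = col z₀ → z j = y * z r := by
  set Q := 2 * (Fintype.card κ).factorial.factorial with hQdef
  have hQ : 0 < Q := by positivity
  rcases Z.eq_empty_or_nonempty with rfl | ⟨z₁, hz₁⟩
  · exact ⟨fun _ => (1, ⟨0, hQ⟩), by simp⟩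
  let Good : Finset κ → Prop := fun s => ∃ x : κ → κ → Lˣ, (∀ i, x i ∈ Z) ∧
    ∀ σ : Equiv.Perm κ, σ ≠ 1 → (∀ i, i ∉ s → σ i = i) →
      (∏ i, x i (σ i)) ^ Q ≠ (∏ i, x i i) ^ Q
  have hstep : ∃ s : Finset κ, ∃ r, r ∉ s ∧ Good s ∧ ¬ Good (insert r s) := by
    by_contra hcon
    push Not at hcon
    have hall : ∀ s : Finset κ, Good s := by
      intro s
      induction s using Finset.induction_on with
      | empty =>
        refine ⟨fun _ => z₁, fun _ => hz₁, fun σ hσ h => absurd ?_ hσ⟩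
        ext i
        simpa using h i
      | insert a s ha ih => exact hcon s a ha ih
    obtain ⟨x, hxZ, hx⟩ := hall Finset.univ
    obtain ⟨σ, hσ1, hσ⟩ := P.exists_perm_prod_pow_eq x (fun i => hZ _ (hxZ i)) c hc
      (fun i => hrel _ (hxZ i)) η (fun i i' j => hclose _ (hxZ i) _ (hxZ i') j) hsmall
    exact hx σ hσ1 (by simp) hσ
  obtain ⟨s, r, hrs, ⟨x, hxZ, hx⟩, hbad⟩ := hstep
  have hex : ∀ z ∈ Z, ∃ σ : Equiv.Perm κ, σ r ≠ r ∧
      (z (σ r) / z r) ^ Q = (∏ i ∈ Finset.univ.erase r, (x i i / x i (σ i))) ^ Q := by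
    intro z hz
    by_contra hcon
    push Not at hcon
    refine hbad ⟨Function.update x r z, fun i => ?_, fun σ hσ1 hfix heq => ?_⟩
    · rcases eq_or_ne i r with rfl | h
      · simpa using hz
      · simpa [h] using hxZ i
    have hsplit : ∀ τ : κ → κ, ∏ i, Function.update x r z i (τ i) =
        z (τ r) * ∏ i ∈ Finset.univ.erase r, x i (τ i) := by
      intro τ
      rw [← Finset.mul_prod_erase _ _ (Finset.mem_univ r)]
      congr 1
      · simp
      · refine Finset.prod_congr rfl fun i hi => ?_
        rw [Function.update_of_ne (Finset.ne_of_mem_erase hi)]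
    have hid := hsplit id
    simp only [id] at hid
    rw [hsplit σ, hid] at heq
    by_cases hr : σ r = r
    · refine hx σ hσ1 (fun i hi => ?_) ?_
      · rcases eq_or_ne i r with rfl | h
        · exact hr
        · exact hfix i (by simp [h, hi])
      · rw [hr] at heq
        simp only [mul_pow, mul_right_inj] at heq
        rw [← Finset.mul_prod_erase _ _ (Finset.mem_univ r), hr,
          ← Finset.mul_prod_erase _ (fun i => x i i) (Finset.mem_univ r), mul_pow, heq,
          mul_pow]
    · refine hcon σ hr ?_
      rw [Finset.prod_div_distrib, div_pow, div_pow, div_eq_div_iff_mul_eq_mul, ← mul_pow,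
        ← mul_pow, heq, mul_comm]
  choose! σ hσr hσ using hex
  obtain ⟨f, hf⟩ := exists_label_pow (L := L) hQ
  refine ⟨fun z => (σ z, f (z (σ z r) / z r)), fun z₀ hz₀ => ⟨r, σ z₀ r, (hσr z₀ hz₀).symm,
    z₀ (σ z₀ r) / z₀ r, fun z hz hcol => ?_⟩⟩
  obtain ⟨h1, h2⟩ := Prod.mk.inj hcol
  have h3 := hf _ _ ((hσ z hz).trans (by rw [h1]; exact (hσ z₀ hz₀).symm)) h2
  rw [← h3, h1, div_mul_cancel]

end PlaceSystem

lemma exists_injective_fin {γ : Type*} [Fintype γ] {K : ℕ} (h : Fintype.card γ ≤ K) :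
    ∃ f : γ → Fin K, Function.Injective f :=
  ⟨fun x => Fin.castLE h (Fintype.equivFin γ x), fun x y hxy => by simpa using hxy⟩

/-- `Z` splits into at most `K` classes, on each of which some equation `∑ b i * z i = 1` with
a vanishing coefficient holds. -/
def ShortColoring {L κ : Type*} [Field L] [Fintype κ] (Z : Set (κ → Lˣ)) (K : ℕ) : Prop :=
  ∃ col : (κ → Lˣ) → Fin K, ∀ z₀ ∈ Z, ∃ b : κ → L, ∃ j, b j = 0 ∧
    ∀ z ∈ Z, col z = col z₀ → ∑ i, b i * (z i : L) = 1

lemma ShortColoring.mono {L κ : Type*} [Field L] [Fintype κ] {Z : Set (κ → Lˣ)} {K K' : ℕ}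
    (h : ShortColoring Z K) (hK : K ≤ K') : ShortColoring Z K' := by
  obtain ⟨col, h⟩ := h
  exact ⟨fun z => Fin.castLE hK (col z), fun z₀ hz₀ => by
    obtain ⟨b, j, hj, hb⟩ := h z₀ hz₀
    exact ⟨b, j, hj, fun z hz hc => hb z hz (by simpa using hc)⟩⟩

/-- The solutions in `G` of the unit equation `∑ z j = 1`. -/
def unitSolutions {L : Type*} [Field L] (G : Subgroup Lˣ) (κ : Type*) [Fintype κ] :
    Set (κ → Lˣ) :=
  {z | (∀ j, z j ∈ G) ∧ ∑ j, (z j : L) = 1}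

namespace PlaceSystem

variable {L : Type*} [Field L] {G : Subgroup Lˣ} {ι : Type*} [Fintype ι]

/-- The height of a tuple of units. -/
noncomputable def height (P : PlaceSystem L G ι) {κ : Type*} [Fintype κ] (z : κ → Lˣ) : ℝ :=
  ∑ j, ‖P.vec (z j)‖

lemma norm_vec_le_height (P : PlaceSystem L G ι) {κ : Type*} [Fintype κ] (z : κ → Lˣ) (j : κ) :
    ‖P.vec (z j)‖ ≤ P.height z :=
  Finset.single_le_sum (f := fun j => ‖P.vec (z j)‖) (fun _ _ => norm_nonneg _)
    (Finset.mem_univ j)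

lemma height_nonneg (P : PlaceSystem L G ι) {κ : Type*} [Fintype κ] (z : κ → Lˣ) :
    0 ≤ P.height z := Finset.sum_nonneg fun _ _ => norm_nonneg _

lemma exists_coloring_vec (P : PlaceSystem L G ι) {ρ : ℕ} (hG : RankLE G ρ) (k : ℕ) (R : ℝ) :
    ∃ col : Lˣ → Fin ((5 ^ ρ) ^ (k + 1)), ∀ z ∈ G, ∀ z' ∈ G, ‖P.vec z‖ ≤ R →
      ‖P.vec z'‖ ≤ R → col z = col z' → ‖P.vec z - P.vec z'‖ ≤ R / 2 ^ k := by
  obtain ⟨S, hS, h⟩ := hG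
  have hmem : ∀ z ∈ G, P.vec z ∈ P.spanVec S := fun z hz => by
    obtain ⟨n, hn, hzn⟩ := h z hz
    exact P.vec_mem_spanVec S hn hzn
  obtain ⟨col, hcol⟩ := exists_coloring (P.spanVec S) ((P.finrank_spanVec S).trans hS) k R
  exact ⟨fun z => col (P.vec z), fun z hz z' hz' h1 h2 hc =>
    hcol _ (hmem z hz) _ (hmem z' hz') h1 h2 hc⟩

lemma shortColoring_large (P : PlaceSystem L G ι) {ρ m : ℕ} (hG : RankLE G ρ) {κ : Type}
    [Fintype κ] [Nonempty κ] (hm : Fintype.card κ = m) {T : ℝ}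
    (hT : 8 * m * Real.log m.factorial + 1 ≤ T) :
    ShortColoring {z ∈ unitSolutions G κ | T ≤ P.height z ∧ P.height z ≤ 2 * T}
      (((5 ^ ρ) ^ (16 * m ^ 3 + 1)) ^ m) := by
  classical
  obtain ⟨col, hcol⟩ := P.exists_coloring_vec hG (16 * m ^ 3) (2 * T)
  obtain ⟨f, hf⟩ := exists_injective_fin
    (γ := κ → Fin ((5 ^ ρ) ^ (16 * m ^ 3 + 1))) (K := ((5 ^ ρ) ^ (16 * m ^ 3 + 1)) ^ m)
    (by rw [Fintype.card_fun, Fintype.card_fin, hm])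
  have hm1 : 1 ≤ m := hm ▸ Fintype.card_pos
  have hm1' : (1 : ℝ) ≤ m := by exact_mod_cast hm1
  have hlog : 0 ≤ Real.log m.factorial :=
    Real.log_nonneg (by exact_mod_cast Nat.one_le_iff_ne_zero.2 (Nat.factorial_ne_zero m))
  have hT1 : 1 ≤ T := by nlinarith [mul_nonneg (by positivity : (0 : ℝ) ≤ 8 * m) hlog]
  refine ⟨fun z => f fun j => col (z j), fun z₀ hz₀ => ?_⟩
  have hmemZ : ∀ z ∈ {z ∈ unitSolutions G κ | T ≤ P.height z ∧ P.height z ≤ 2 * T},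
      ∀ j, ‖P.vec (z j)‖ ≤ 2 * T := fun z hz j => (P.norm_vec_le_height z j).trans hz.2.2
  set Z : Set (κ → Lˣ) := {z | z ∈ {z ∈ unitSolutions G κ | T ≤ P.height z ∧ P.height z ≤ 2 * T} ∧
    ∀ j, col (z j) = col (z₀ j)} with hZ
  have h2 : (16 * m ^ 3 : ℝ) ≤ 2 ^ (16 * m ^ 3) := by exact_mod_cast Nat.lt_two_pow_self.le
  obtain ⟨a, ha, hrel⟩ := P.exists_relation_of_large Z (fun z hz => hz.1.1.1)
    (fun z hz => hz.1.1.2) (2 * T / 2 ^ (16 * m ^ 3))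
    (fun z hz z' hz' j => hcol _ (hz.1.1.1 j) _ (hz'.1.1.1 j) (hmemZ z hz.1 j) (hmemZ z' hz'.1 j)
      ((hz.2 j).trans (hz'.2 j).symm)) (fun z hz => by
      rw [hm]
      have hex : ∃ j, T / m ≤ ‖P.vec (z j)‖ := by
        by_contra hcon
        push Not at hcon
        have := Finset.sum_lt_sum_of_nonempty (s := Finset.univ) Finset.univ_nonempty
          fun j _ => hcon j
        rw [Finset.sum_const, Finset.card_univ, hm, nsmul_eq_mul,
          mul_div_cancel₀ _ (by positivity)] at this
        exact absurd hz.1.2.1 (not_le.2 this)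
      obtain ⟨j, hj⟩ := hex
      refine ⟨j, ?_⟩
      have e1 : (m : ℝ) ^ 2 * (2 * T / 2 ^ (16 * m ^ 3)) ≤ T / (8 * m) := by
        rw [mul_div_assoc', div_le_div_iff₀ (by positivity) (by positivity)]
        calc (m : ℝ) ^ 2 * (2 * T) * (8 * m) = T * (16 * m ^ 3) := by ring
          _ ≤ _ := by gcongr
      have e2 : Real.log m.factorial < T / (8 * m) := by
        rw [lt_div_iff₀ (by positivity)]; linarith
      have e3 : T / (8 * m) = T / m / 8 := by rw [mul_comm, div_div]
      have e4 : 0 < T / m := by positivity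
      linarith)
  obtain ⟨b, j, hj, hb⟩ := exists_shorter_equation
    (Z := (fun z : κ → Lˣ => fun j => (z j : L)) '' Z)
    ha (by rintro _ ⟨z, hz, rfl⟩; exact hz.1.1.2) (by rintro _ ⟨z, hz, rfl⟩; exact hrel z hz)
  exact ⟨b, j, hj, fun z hz hc => hb _ ⟨z, ⟨hz, fun j => congrFun (hf hc) j⟩, rfl⟩⟩

lemma exists_relation_of_proportional {κ : Type} [Fintype κ] [Nontrivial κ] (Z : Set (κ → Lˣ))
    (hsum : ∀ z ∈ Z, ∑ j, (z j : L) = 1) {r j : Option κ} (hrj : r ≠ j) (y : Lˣ)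
    (h : ∀ z ∈ Z, (j.elim 1 z : Lˣ) = y * r.elim 1 z) :
    ∃ a : κ → L, a ≠ 0 ∧ ∀ z ∈ Z, ∑ i, a i * (z i : L) = 0 := by
  classical
  let φ : Option κ → κ → L := fun o => o.elim 1 fun q => Pi.single q 1
  have hφ : ∀ o, ∀ z ∈ Z, ∑ i, φ o i * (z i : L) = ((o.elim 1 z : Lˣ) : L) := by
    rintro (_ | q) z hz
    · simpa [φ] using hsum z hz
    · simp [φ, Pi.single_apply]
  refine ⟨fun i => φ j i - y * φ r i, fun h0 => ?_, fun z hz => ?_⟩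
  · have hy := y.ne_zero
    rcases j with _ | q <;> rcases r with _ | p
    · exact hrj rfl
    · obtain ⟨i, hi⟩ := exists_ne p
      have := congrFun h0 i
      simp [φ, hi] at this
    · obtain ⟨i, hi⟩ := exists_ne q
      have := congrFun h0 i
      simp [φ, hi] at this
    · have hpq : q ≠ p := fun h => hrj (by rw [h])
      have := congrFun h0 q
      simp [φ, hpq] at this
  · simp_rw [sub_mul, mul_assoc]
    rw [Finset.sum_sub_distrib, ← Finset.mul_sum, hφ j z hz, hφ r z hz, h z hz]
    simp

lemma exists_shortColoring_small (ρ m : ℕ) (c : ℝ) :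
    ∃ K : ℕ, ∀ {L : Type*} [Field L] {G : Subgroup Lˣ} {ι : Type*} [Fintype ι]
      (P : PlaceSystem L G ι), RankLE G ρ → ∀ (κ : Type) [Fintype κ] [Nontrivial κ],
      Fintype.card κ = m →
      ShortColoring {z ∈ unitSolutions G κ | P.height z ≤ c} K := by
  classical
  set M := (m + 1).factorial with hM
  have hMpos : (0 : ℝ) < M := by exact_mod_cast Nat.factorial_pos _
  have hδ : 0 < Real.log (M + 1) - Real.log M := by
    rw [sub_pos]; exact Real.log_lt_log hMpos (by linarith)
  set B : ℝ := (1 + M * M.factorial : ℕ) * ((m + 1 : ℕ) : ℝ) ^ 2 with hB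
  obtain ⟨k, hk⟩ := exists_pow_lt_of_lt_one
    (show 0 < (Real.log (M + 1) - Real.log M) / (B * (|c| + 1)) by positivity)
    (show (1 / 2 : ℝ) < 1 by norm_num)
  have hsmall : (1 + M * M.factorial : ℕ) * (((m + 1 : ℕ) : ℝ) ^ 2 * (c / 2 ^ k)) <
      Real.log (M + 1) - Real.log M := by
    rw [lt_div_iff₀ (by positivity), one_div, inv_pow] at hk
    refine lt_of_le_of_lt ?_ hk
    have : c ≤ |c| + 1 := by linarith [le_abs_self c]
    calc _ = B * (c / 2 ^ k) := by rw [hB]; ring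
      _ ≤ B * ((|c| + 1) / 2 ^ k) := by gcongr
      _ = _ := by field_simp
  refine ⟨((5 ^ ρ) ^ (k + 1)) ^ m * (M * (2 * M.factorial)), ?_⟩
  intro L _ G ι _ P hG κ _ _ hm
  obtain ⟨col, hcol⟩ := P.exists_coloring_vec hG k c
  have hcardO : Fintype.card (Option κ) = m + 1 := by rw [Fintype.card_option, hm]
  let γ := (κ → Fin ((5 ^ ρ) ^ (k + 1))) ×
    (Equiv.Perm (Option κ) × Fin (2 * (Fintype.card (Option κ)).factorial.factorial))
  obtain ⟨f, hf⟩ := exists_injective_fin (γ := γ)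
    (K := ((5 ^ ρ) ^ (k + 1)) ^ m * (M * (2 * M.factorial)))
    (by simp only [γ, Fintype.card_prod, Fintype.card_fun, Fintype.card_fin, hm,
          Fintype.card_perm, hcardO]
        exact le_rfl)
  let ext : (κ → Lˣ) → Option κ → Lˣ := fun z o => o.elim 1 z
  let Z : (κ → Fin ((5 ^ ρ) ^ (k + 1))) → Set (κ → Lˣ) := fun w =>
    {z | z ∈ {z ∈ unitSolutions G κ | P.height z ≤ c} ∧ ∀ j, col (z j) = w j}
  have hprop : ∀ w, ∃ col' : (Option κ → Lˣ) →
      Equiv.Perm (Option κ) × Fin (2 * (Fintype.card (Option κ)).factorial.factorial),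
      ∀ z₀ ∈ ext '' Z w, ∃ r j, r ≠ j ∧ ∃ y : Lˣ, ∀ z ∈ ext '' Z w, col' z = col' z₀ →
        z j = y * z r := by
    intro w
    refine P.exists_coloring_proportional (ext '' Z w) ?_ (fun o => o.elim 1 fun _ => -1) ?_ ?_
      (c / 2 ^ k) ?_ ?_
    · rintro _ ⟨z, hz, rfl⟩ (_ | j)
      · exact one_mem G
      · exact hz.1.1.1 j
    · exact fun h => by simpa using congrFun h none
    · rintro _ ⟨z, hz, rfl⟩
      simp [ext, Fintype.sum_option, hz.1.1.2]
    · rintro _ ⟨z, hz, rfl⟩ _ ⟨z', hz', rfl⟩ (_ | j)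
      · have : 0 ≤ c := (P.height_nonneg z).trans hz.1.2
        simp only [ext, Option.elim, sub_self, norm_zero]
        positivity
      · exact hcol _ (hz.1.1.1 j) _ (hz'.1.1.1 j) ((P.norm_vec_le_height z j).trans hz.1.2)
          ((P.norm_vec_le_height z' j).trans hz'.1.2) ((hz.2 j).trans (hz'.2 j).symm)
    · rw [hcardO]
      exact hsmall
  choose col' hcol' using hprop
  refine ⟨fun z => f (fun j => col (z j), col' (fun j => col (z j)) (ext z)), fun z₀ hz₀ => ?_⟩
  set w := fun j => col (z₀ j) with hw
  obtain ⟨r, j, hrj, y, hy⟩ := hcol' w (ext z₀) ⟨z₀, ⟨hz₀, fun j => rfl⟩, rfl⟩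
  set Z' : Set (κ → Lˣ) := {z ∈ Z w | col' w (ext z) = col' w (ext z₀)} with hZ'
  obtain ⟨a, ha, hrel⟩ := exists_relation_of_proportional Z' (fun z hz => hz.1.1.1.2) hrj y
    (fun z hz => hy _ ⟨z, hz.1, rfl⟩ hz.2)
  obtain ⟨b, j, hj, hb⟩ := exists_shorter_equation
    (Z := (fun z : κ → Lˣ => fun j => (z j : L)) '' Z')
    ha (by rintro _ ⟨z, hz, rfl⟩; exact hz.1.1.1.2) (by rintro _ ⟨z, hz, rfl⟩; exact hrel z hz)
  refine ⟨b, j, hj, fun z hz hc => hb _ ⟨z, ⟨⟨hz, ?_⟩, ?_⟩, rfl⟩⟩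
  · have := (Prod.mk.inj (hf hc)).1
    exact fun j => congrFun this j
  · obtain ⟨h1, h2⟩ := Prod.mk.inj (hf hc)
    rw [h1] at h2
    exact h2

/-- Solutions of the unit equation of small height, or of height in a dyadic range, satisfy one of
boundedly many equations in fewer variables. -/
lemma exists_shortColoring (ρ m : ℕ) :
    ∃ K : ℕ, ∃ c : ℝ, 1 ≤ c ∧ 8 * m * Real.log m.factorial ≤ c ∧
      ∀ {L : Type*} [Field L] {G : Subgroup Lˣ} {ι : Type*}
      [Fintype ι] (P : PlaceSystem L G ι), RankLE G ρ → ∀ (κ : Type) [Fintype κ] [Nontrivial κ],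
      Fintype.card κ = m →
      ShortColoring {z ∈ unitSolutions G κ | P.height z ≤ c} K ∧
      ∀ T, c ≤ T →
        ShortColoring {z ∈ unitSolutions G κ | T ≤ P.height z ∧ P.height z ≤ 2 * T} K := by
  have hlog : 0 ≤ Real.log m.factorial :=
    Real.log_nonneg (by exact_mod_cast Nat.one_le_iff_ne_zero.2 (Nat.factorial_ne_zero m))
  obtain ⟨K, hK⟩ := exists_shortColoring_small ρ m (8 * m * Real.log m.factorial + 1)
  refine ⟨max K (((5 ^ ρ) ^ (16 * m ^ 3 + 1)) ^ m), 8 * m * Real.log m.factorial + 1,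
    by have : 0 ≤ 8 * m * Real.log m.factorial := by positivity
       linarith, by linarith, ?_⟩
  intro L _ G ι _ P hG κ _ _ hm
  exact ⟨(hK P hG κ hm).mono (le_max_left _ _),
    fun T hT => (P.shortColoring_large hG hm hT).mono (le_max_right _ _)⟩

end PlaceSystem

lemma integral_pow_mul_sub_pow (a b : ℕ) (z : ℝ) :
    ∫ s in (0 : ℝ)..z, s ^ a * (z - s) ^ b =
      z ^ (a + b + 1) * (a.factorial * b.factorial / (a + b + 1).factorial) := by
  induction b generalizing a with
  | zero =>
    simp only [pow_zero, mul_one, add_zero, integral_pow, Nat.factorial_succ, Nat.factorial_zero]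
    have : (a.factorial : ℝ) ≠ 0 := by positivity
    have h2 : (a : ℝ) + 1 ≠ 0 := by positivity
    push_cast
    field_simp
    ring
  | succ b ih =>
    have hderiv : ∀ s : ℝ, HasDerivAt (fun s => s ^ (a + 1) * (z - s) ^ (b + 1))
        ((a + 1) * (s ^ a * (z - s) ^ (b + 1)) - (b + 1) * (s ^ (a + 1) * (z - s) ^ b)) s := by
      intro s
      have h1 := hasDerivAt_pow (a + 1) s
      have h2 := ((hasDerivAt_id s).const_sub z).pow (b + 1)
      refine (h1.mul h2).congr_deriv ?_
      simp only [Pi.pow_apply, id, Nat.add_sub_cancel]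
      push_cast
      ring
    have hInt := intervalIntegral.integral_eq_sub_of_hasDerivAt (a := 0) (b := z)
      (fun s _ => hderiv s) (Continuous.intervalIntegrable (by fun_prop) _ _)
    rw [intervalIntegral.integral_sub (Continuous.intervalIntegrable (by fun_prop) _ _)
      (Continuous.intervalIntegrable (by fun_prop) _ _), intervalIntegral.integral_const_mul,
      intervalIntegral.integral_const_mul, ih (a + 1)] at hInt
    have h0 : (z : ℝ) ^ (a + 1) * (z - z) ^ (b + 1) - 0 ^ (a + 1) * (z - 0) ^ (b + 1) = 0 := by
      simp
    rw [h0] at hInt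
    have ha : (a : ℝ) + 1 ≠ 0 := by positivity
    have hf : ((a + (b + 1) + 1).factorial : ℝ) ≠ 0 := by positivity
    have e1 : a + 1 + b + 1 = a + (b + 1) + 1 := by ring
    rw [e1, Nat.factorial_succ a] at hInt
    rw [Nat.factorial_succ b]
    apply mul_left_cancel₀ ha
    rw [sub_eq_zero.1 hInt]
    push_cast
    ring

/-- The coefficients of the Padé approximants. -/
def padeCoeff (n k : ℕ) : ℕ := (n + k).choose k * (3 * n + 1).choose (n - k)

lemma padeCoeff_eq {n k : ℕ} (hk : k ≤ n) :
    (padeCoeff n k : ℝ) = ((3 * n + 1).factorial / (n.factorial) ^ 3) *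
      (n.choose k * ((n + k).factorial * n.factorial / (n + k + n + 1).factorial)) := by
  have h1 : ((n + k).choose k : ℝ) * (n.factorial * k.factorial) = (n + k).factorial := by
    have := Nat.add_choose_mul_factorial_mul_factorial n k
    rw [← mul_assoc]; exact_mod_cast this
  have h2 : ((3 * n + 1).choose (n - k) : ℝ) * ((n - k).factorial * (n + k + n + 1).factorial) =
      (3 * n + 1).factorial := by
    have := Nat.choose_mul_factorial_mul_factorial (show n - k ≤ 3 * n + 1 by omega)
    rw [show 3 * n + 1 - (n - k) = n + k + n + 1 by omega] at this
    rw [← mul_assoc]; exact_mod_cast this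
  have h3 : (n.choose k : ℝ) * (k.factorial * (n - k).factorial) = n.factorial := by
    have := Nat.choose_mul_factorial_mul_factorial hk
    rw [← mul_assoc]; exact_mod_cast this
  have p1 : (n.factorial : ℝ) ≠ 0 := by positivity
  have p2 : (k.factorial : ℝ) ≠ 0 := by positivity
  have p3 : ((n - k).factorial : ℝ) ≠ 0 := by positivity
  have p4 : ((n + k + n + 1).factorial : ℝ) ≠ 0 := by positivity
  have e1 := eq_div_of_mul_eq (mul_ne_zero p1 p2) h1
  have e2 := eq_div_of_mul_eq (mul_ne_zero p3 p4) h2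
  have e3 := eq_div_of_mul_eq (mul_ne_zero p2 p3) h3
  rw [padeCoeff]
  push_cast
  rw [e1, e2, e3]
  field_simp

open Polynomial in
/-- The Padé polynomial attached to a power in the identity `padeP_eval`. -/
noncomputable def padeQ (n : ℕ) : ℤ[X] :=
  ∑ k ∈ Finset.range (n + 1), monomial k ((-1) ^ k * (padeCoeff n k : ℤ))

open Polynomial in
/-- The Padé polynomial of low degree in the identity `padeP_eval`. -/
noncomputable def padeP (n : ℕ) : ℤ[X] :=
  ∑ k ∈ Finset.range (n + 1), monomial (n - k) ((-1) ^ k * (padeCoeff n k : ℤ))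

lemma integral_pade (n : ℕ) (w c : ℝ) :
    (3 * n + 1).factorial / (n.factorial : ℝ) ^ 3 *
      ∫ s in (0 : ℝ)..w, s ^ n * (w - s) ^ n * (c - s) ^ n =
    ∑ k ∈ Finset.range (n + 1), (-1) ^ k * (padeCoeff n k : ℝ) * w ^ (2 * n + 1 + k) *
      c ^ (n - k) := by
  have h : ∀ s : ℝ, s ^ n * (w - s) ^ n * (c - s) ^ n = ∑ k ∈ Finset.range (n + 1),
      ((-1) ^ k * n.choose k * c ^ (n - k)) * (s ^ (n + k) * (w - s) ^ n) := by
    intro s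
    rw [show c - s = -s + c by ring, add_pow, Finset.mul_sum]
    refine Finset.sum_congr rfl fun k _ => ?_
    rw [neg_pow]
    ring
  simp_rw [h]
  rw [intervalIntegral.integral_finsetSum fun k _ =>
    Continuous.intervalIntegrable (by fun_prop) _ _, Finset.mul_sum]
  refine Finset.sum_congr rfl fun k hk => ?_
  rw [intervalIntegral.integral_const_mul, integral_pow_mul_sub_pow,
    padeCoeff_eq (Nat.lt_succ_iff.1 (Finset.mem_range.1 hk)),
    show n + k + n + 1 = 2 * n + 1 + k by ring]
  ring

open Polynomial in
lemma pade_identity (n : ℕ) :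
    padeP n = X ^ (2 * n + 1) * padeQ n +
      (-1) ^ n * (1 - X) ^ (2 * n + 1) * (padeQ n).comp (1 - X) := by
  apply Polynomial.map_injective (Int.castRingHom ℝ) Int.cast_injective
  refine Polynomial.funext fun z => ?_
  have hQ : ∀ w : ℝ, w ^ (2 * n + 1) * ((padeQ n).map (Int.castRingHom ℝ)).eval w =
      (3 * n + 1).factorial / (n.factorial : ℝ) ^ 3 *
      ∫ s in (0 : ℝ)..w, s ^ n * (w - s) ^ n * (1 - s) ^ n := by
    intro w
    rw [integral_pade, padeQ, Polynomial.map_sum, eval_finsetSum, Finset.mul_sum]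
    refine Finset.sum_congr rfl fun k _ => ?_
    simp
    ring
  have hP : ((padeP n).map (Int.castRingHom ℝ)).eval z =
      (3 * n + 1).factorial / (n.factorial : ℝ) ^ 3 *
      ∫ s in (0 : ℝ)..1, s ^ n * (1 - s) ^ n * (z - s) ^ n := by
    rw [integral_pade, padeP, Polynomial.map_sum, eval_finsetSum]
    refine Finset.sum_congr rfl fun k _ => ?_
    simp
  have hsplit : ∫ s in (0 : ℝ)..1, s ^ n * (1 - s) ^ n * (z - s) ^ n =
      (∫ s in (0 : ℝ)..z, s ^ n * (z - s) ^ n * (1 - s) ^ n) +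
      (-1) ^ n * ∫ s in (0 : ℝ)..(1 - z), s ^ n * ((1 - z) - s) ^ n * (1 - s) ^ n := by
    rw [← intervalIntegral.integral_add_adjacent_intervals (b := z)
      (Continuous.intervalIntegrable (by fun_prop) _ _)
      (Continuous.intervalIntegrable (by fun_prop) _ _)]
    congr 1
    · congr 1; ext s; ring
    · have := intervalIntegral.integral_comp_sub_left (a := 0) (b := 1 - z)
        (fun s : ℝ => s ^ n * (1 - s) ^ n * (z - s) ^ n) 1
      rw [sub_sub_cancel, sub_zero] at this
      rw [← this, ← intervalIntegral.integral_const_mul]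
      congr 1
      ext s
      rw [show z - (1 - s) = (-1) * ((1 - z) - s) by ring, mul_pow]
      ring
  have h1 := hQ z
  have h2 := hQ (1 - z)
  rw [hP, hsplit, mul_add, ← h1]
  rw [mul_left_comm, ← h2]
  simp [Polynomial.map_comp, eval_comp]
  ring

open Polynomial in
/-- The companion of `padeQ` obtained by differentiating `pade_identity`. -/
noncomputable def padeQ' (n : ℕ) : ℤ[X] :=
  ((2 * n + 1 : ℕ) : ℤ[X]) * padeQ n + X * derivative (padeQ n)

lemma padeCoeff_le (n k : ℕ) (hk : k ≤ n) : padeCoeff n k ≤ 2 ^ (5 * n + 1) := by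
  calc padeCoeff n k ≤ 2 ^ (n + k) * 2 ^ (3 * n + 1) :=
        Nat.mul_le_mul (Nat.choose_le_two_pow _ _) (Nat.choose_le_two_pow _ _)
    _ = 2 ^ (n + k + (3 * n + 1)) := (pow_add _ _ _).symm
    _ ≤ 2 ^ (5 * n + 1) := Nat.pow_le_pow_right (by norm_num) (by omega)

lemma padeQ_coeff (n k : ℕ) :
    (padeQ n).coeff k = if k ≤ n then (-1) ^ k * (padeCoeff n k : ℤ) else 0 := by
  simp [padeQ, Polynomial.coeff_monomial]

lemma padeP_coeff (n k : ℕ) :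
    (padeP n).coeff k = if k ≤ n then (-1) ^ (n - k) * (padeCoeff n (n - k) : ℤ) else 0 := by
  simp only [padeP, Polynomial.finsetSum_coeff, Polynomial.coeff_monomial]
  split_ifs with h
  · rw [Finset.sum_eq_single (n - k)]
    · rw [if_pos (by omega)]
    · intro i hi hne
      have := Finset.mem_range.1 hi
      rw [if_neg (by omega)]
    · intro hi
      exact absurd (Finset.mem_range.2 (by omega)) hi
  · exact Finset.sum_eq_zero fun i _ => if_neg (by omega)

lemma abs_padeQ_coeff_le (n k : ℕ) : |(padeQ n).coeff k| ≤ 2 ^ (5 * n + 1) := by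
  rw [padeQ_coeff]
  split_ifs with h
  · rw [abs_mul, abs_pow, abs_neg, abs_one, one_pow, one_mul, Nat.abs_cast]
    exact_mod_cast padeCoeff_le n k h
  · simp

lemma abs_padeP_coeff_le (n k : ℕ) : |(padeP n).coeff k| ≤ 2 ^ (5 * n + 1) := by
  rw [padeP_coeff]
  split_ifs with h
  · rw [abs_mul, abs_pow, abs_neg, abs_one, one_pow, one_mul, Nat.abs_cast]
    exact_mod_cast padeCoeff_le n _ (Nat.sub_le _ _)
  · simp

lemma natDegree_padeQ_le (n : ℕ) : (padeQ n).natDegree ≤ n :=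
  Polynomial.natDegree_le_iff_coeff_eq_zero.2 fun k hk => by
    rw [padeQ_coeff, if_neg (by omega)]

lemma natDegree_padeP_le (n : ℕ) : (padeP n).natDegree ≤ n :=
  Polynomial.natDegree_le_iff_coeff_eq_zero.2 fun k hk => by
    rw [padeP_coeff, if_neg (by omega)]

lemma padeQ'_coeff (n k : ℕ) :
    (padeQ' n).coeff k = ((2 * n + 1 + k : ℕ) : ℤ) * (padeQ n).coeff k := by
  rw [padeQ', Polynomial.coeff_add, ← Polynomial.C_eq_natCast, Polynomial.coeff_C_mul]
  rcases k with _ | k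
  · simp
  · rw [Polynomial.coeff_X_mul, Polynomial.coeff_derivative]
    push_cast
    ring

lemma natDegree_padeQ'_le (n : ℕ) : (padeQ' n).natDegree ≤ n :=
  Polynomial.natDegree_le_iff_coeff_eq_zero.2 fun k hk => by
    rw [padeQ'_coeff, padeQ_coeff, if_neg (by omega), mul_zero]

lemma three_mul_add_one_le (n : ℕ) : 3 * n + 1 ≤ 2 ^ (3 * n) := Nat.lt_two_pow_self

lemma abs_padeQ'_coeff_le (n k : ℕ) : |(padeQ' n).coeff k| ≤ 2 ^ (8 * n + 1) := by
  rw [padeQ'_coeff]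
  by_cases h : k ≤ n
  · have h1 : ((2 * n + 1 + k : ℕ) : ℤ) ≤ 2 ^ (3 * n) := by
      have := three_mul_add_one_le n
      exact_mod_cast (show 2 * n + 1 + k ≤ 3 * n + 1 by omega).trans this
    rw [abs_mul, Nat.abs_cast]
    calc _ ≤ (2 : ℤ) ^ (3 * n) * 2 ^ (5 * n + 1) :=
          mul_le_mul h1 (abs_padeQ_coeff_le n k) (abs_nonneg _) (by positivity)
      _ = 2 ^ (8 * n + 1) := by rw [← pow_add]; congr 1; ring
  · rw [padeQ_coeff, if_neg h]
    simp

lemma abs_derivative_padeP_coeff_le (n k : ℕ) :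
    |(Polynomial.derivative (padeP n)).coeff k| ≤ 2 ^ (8 * n + 1) := by
  rw [Polynomial.coeff_derivative]
  by_cases h : k + 1 ≤ n
  · have h1 : ((k : ℤ) + 1) ≤ 2 ^ (3 * n) := by
      have := three_mul_add_one_le n
      exact_mod_cast (show k + 1 ≤ 3 * n + 1 by omega).trans this
    rw [abs_mul, abs_of_nonneg (by positivity : (0 : ℤ) ≤ (k : ℤ) + 1), mul_comm]
    calc _ ≤ (2 : ℤ) ^ (3 * n) * 2 ^ (5 * n + 1) :=
          mul_le_mul h1 (abs_padeP_coeff_le n _) (abs_nonneg _) (by positivity)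
      _ = 2 ^ (8 * n + 1) := by rw [← pow_add]; congr 1; ring
  · rw [padeP_coeff, if_neg h]
    simp

open Polynomial in
lemma X_mul_derivative_padeP (n : ℕ) :
    X * derivative (padeP n) = X ^ (2 * n + 1) * padeQ' n -
      (-1) ^ n * (1 - X) ^ (2 * n) * X * (padeQ' n).comp (1 - X) := by
  have h := congrArg derivative (pade_identity n)
  have hc : ((-1 : ℤ[X]) ^ n) = C ((-1) ^ n) := by simp
  rw [hc] at h ⊢
  simp only [derivative_add, derivative_mul, derivative_comp, derivative_pow, derivative_X,
    derivative_sub, derivative_one, derivative_C, Nat.add_sub_cancel] at h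
  rw [h, padeQ']
  simp only [add_comp, mul_comp, natCast_comp, X_comp, map_natCast]
  push_cast
  ring

open Polynomial in
/-- The two Padé systems are independent: their determinant is a nonzero constant. -/
lemma pade_wronskian (n : ℕ) : ∃ w : ℤ, w ≠ 0 ∧
    X * padeQ n * (padeQ' n).comp (1 - X) + (1 - X) * (padeQ n).comp (1 - X) * padeQ' n = C w := by
  set W := X * padeQ n * (padeQ' n).comp (1 - X) +
    (1 - X) * (padeQ n).comp (1 - X) * padeQ' n with hW
  set V := padeP n * padeQ' n - X * derivative (padeP n) * padeQ n with hV
  have hVW : V = (-1) ^ n * (1 - X) ^ (2 * n) * W := by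
    rw [hV, hW, X_mul_derivative_padeP, pade_identity, pow_succ (1 - X)]
    ring
  have hXP : (X * derivative (padeP n)).natDegree ≤ n := by
    refine natDegree_le_iff_coeff_eq_zero.2 fun k hk => ?_
    rcases k with _ | k
    · simp
    · rw [coeff_X_mul, coeff_derivative, padeP_coeff, if_neg (by omega), zero_mul]
  have hVdeg : V.natDegree ≤ 2 * n := by
    refine (natDegree_sub_le _ _).trans (max_le ?_ ?_)
    · have := natDegree_mul_le (p := padeP n) (q := padeQ' n)
      have := natDegree_padeP_le n
      have := natDegree_padeQ'_le n
      omega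
    · have := natDegree_mul_le (p := X * derivative (padeP n)) (q := padeQ n)
      have := natDegree_padeQ_le n
      omega
  have hV0 : V.eval 0 ≠ 0 := by
    rw [hV]
    simp only [eval_sub, eval_mul, eval_X, zero_mul, sub_zero, ← coeff_zero_eq_eval_zero]
    rw [padeQ'_coeff, padeQ_coeff, padeP_coeff, if_pos (Nat.zero_le _), if_pos (Nat.zero_le _)]
    have h1 : (padeCoeff n (n - 0) : ℤ) ≠ 0 := by
      simp only [padeCoeff, Nat.sub_zero]
      exact_mod_cast (Nat.mul_pos (Nat.choose_pos (by omega)) (Nat.choose_pos (by omega))).ne'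
    have h2 : (padeCoeff n 0 : ℤ) ≠ 0 := by
      simp only [padeCoeff, Nat.sub_zero]
      exact_mod_cast (Nat.mul_pos (Nat.choose_pos (by omega)) (Nat.choose_pos (by omega))).ne'
    have h3 : ((2 * n + 1 + 0 : ℕ) : ℤ) ≠ 0 := by positivity
    simp only [pow_zero, one_mul]
    exact mul_ne_zero (mul_ne_zero (by simp) h1) (mul_ne_zero h3 h2)
  have hWne : W ≠ 0 := by
    rintro h
    rw [hVW, h] at hV0
    simp at hV0
  have h1X : (1 - X : ℤ[X]).natDegree = 1 := by
    rw [← neg_sub, natDegree_neg, ← C_1, natDegree_X_sub_C]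
  have h1X0 : (1 - X : ℤ[X]) ≠ 0 := by
    intro h; rw [h] at h1X; simp at h1X
  have hdegW : W.natDegree = 0 := by
    have hs : ((-1 : ℤ[X]) ^ n) ≠ 0 := pow_ne_zero _ (by simp)
    have hn : ((-1 : ℤ[X]) ^ n).natDegree = 0 := by
      rw [natDegree_pow, natDegree_neg, natDegree_one, mul_zero]
    rw [hVW, natDegree_mul (mul_ne_zero hs (pow_ne_zero _ h1X0)) hWne,
      natDegree_mul hs (pow_ne_zero _ h1X0), hn, natDegree_pow, h1X] at hVdeg
    omega
  refine ⟨W.coeff 0, fun h0 => ?_, eq_C_of_natDegree_eq_zero hdegW⟩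
  rw [eq_C_of_natDegree_eq_zero hdegW, h0, C_0] at hWne
  exact hWne rfl

namespace PlaceSystem

variable {L : Type*} [Field L] {G : Subgroup Lˣ} {ι : Type*} [Fintype ι]

/-- The size of `α` at the place `v` is bounded by a constant `b` (felt at the archimedean places
only) and a local bound `M`. -/
def Bd (P : PlaceSystem L G ι) (v : ι) (α : L) (b M : ℝ) : Prop :=
  α ≠ 0 → P.lg v α ≤ P.wt v * b + M

lemma Bd.mono {P : PlaceSystem L G ι} {v : ι} {α : L} {b b' M M' : ℝ} (h : P.Bd v α b M)
    (hb : b ≤ b') (hM : M ≤ M') : P.Bd v α b' M' := fun h0 =>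
  (h h0).trans (add_le_add (mul_le_mul_of_nonneg_left hb (P.wt_nonneg v)) hM)

lemma Bd.mul {P : PlaceSystem L G ι} {v : ι} {α β : L} {b b' M M' : ℝ} (h : P.Bd v α b M)
    (h' : P.Bd v β b' M') : P.Bd v (α * β) (b + b') (M + M') := fun h0 => by
  have h1 := h (left_ne_zero_of_mul h0)
  have h2 := h' (right_ne_zero_of_mul h0)
  rw [P.lg_mul v _ _ (left_ne_zero_of_mul h0) (right_ne_zero_of_mul h0)]
  linarith

lemma Bd.neg {P : PlaceSystem L G ι} {v : ι} {α : L} {b M : ℝ} (h : P.Bd v α b M) :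
    P.Bd v (-α) b M := fun h0 => by
  have h1 := h (neg_ne_zero.1 h0)
  rwa [neg_eq_neg_one_mul, P.lg_mul v _ _ (by simp) (neg_ne_zero.1 h0), P.lg_neg_one, zero_add]

lemma Bd.add {P : PlaceSystem L G ι} {v : ι} {α β : L} {b M : ℝ} (h : P.Bd v α b M)
    (h' : P.Bd v β b M) : P.Bd v (α + β) (b + 1) M := fun h0 => by
  have hw := P.wt_nonneg v
  by_cases hα : α = 0
  · subst hα
    rw [zero_add] at h0 ⊢
    have := h' h0
    nlinarith
  by_cases hβ : β = 0
  · subst hβ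
    rw [add_zero] at h0 ⊢
    have := h h0
    nlinarith
  obtain ⟨i, -, hi⟩ := P.lg_sum v Bool Finset.univ (fun _ => 1) (fun i => cond i α β)
    (by rintro (_ | _) _ <;> simp [hα, hβ]) (by simpa using h0)
  simp only [Int.cast_one, one_mul, Fintype.sum_bool, cond_true, cond_false, abs_one] at hi
  have hlog : Real.log (1 + 1) ≤ 1 := by
    have := Real.log_le_sub_one_of_pos (show (0 : ℝ) < 1 + 1 by norm_num)
    linarith
  have h3 : P.wt v * Real.log (1 + 1) ≤ P.wt v * 1 := mul_le_mul_of_nonneg_left hlog hw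
  rcases i with _ | _
  · have := h' hβ
    simp only [cond_false] at hi
    linarith
  · have := h hα
    simp only [cond_true] at hi
    linarith

lemma bd_aeval (P : PlaceSystem L G ι) (v : ι) {x : L} (hx : x ≠ 0) {n : ℕ}
    (p : Polynomial ℤ) (hp : p.natDegree ≤ n) (hc : ∀ k, |p.coeff k| ≤ 2 ^ (8 * n + 1)) {μ : ℝ}
    (h0 : 0 ≤ μ) (hμ : P.lg v x ≤ μ) :
    P.Bd v (Polynomial.aeval x p) (9 * n + 1) (n * μ) := fun hne => by
  have hsum : Polynomial.aeval x p = ∑ k ∈ Finset.range (n + 1), (p.coeff k : L) * x ^ k := by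
    rw [Polynomial.aeval_eq_sum_range' (Nat.lt_succ_of_le hp)]
    simp
  rw [hsum] at hne ⊢
  obtain ⟨k, hk, h⟩ := P.lg_sum v ℕ (Finset.range (n + 1)) (fun k => p.coeff k) (fun k => x ^ k)
    (fun _ _ => pow_ne_zero _ hx) hne
  rw [P.lg_pow v x hx] at h
  refine h.trans (add_le_add (mul_le_mul_of_nonneg_left ?_ (P.wt_nonneg v)) ?_)
  · rcases eq_or_ne (∑ k ∈ Finset.range (n + 1), |(p.coeff k : ℝ)|) 0 with h00 | h00
    · rw [h00, Real.log_zero]; positivity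
    · have hle : ∑ k ∈ Finset.range (n + 1), |(p.coeff k : ℝ)| ≤ 2 ^ (9 * n + 1) := by
        calc _ ≤ ∑ _k ∈ Finset.range (n + 1), (2 : ℝ) ^ (8 * n + 1) :=
              Finset.sum_le_sum fun k _ => by exact_mod_cast hc k
          _ = (n + 1 : ℕ) * 2 ^ (8 * n + 1) := by simp
          _ ≤ 2 ^ n * 2 ^ (8 * n + 1) := by
              gcongr; exact_mod_cast Nat.lt_two_pow_self
          _ = _ := by rw [← pow_add]; congr 1; ring
      have hpos : 0 < ∑ k ∈ Finset.range (n + 1), |(p.coeff k : ℝ)| :=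
        lt_of_le_of_ne (Finset.sum_nonneg fun _ _ => abs_nonneg _) h00.symm
      refine (Real.log_le_log hpos hle).trans ?_
      rw [Real.log_pow]
      have hlog : Real.log 2 ≤ 1 := by
        have := Real.log_le_sub_one_of_pos (show (0 : ℝ) < 2 by norm_num)
        linarith
      push_cast
      have : (0 : ℝ) ≤ 9 * n + 1 := by positivity
      nlinarith
  · have hk' : (k : ℝ) ≤ n := by exact_mod_cast Nat.lt_succ_iff.1 (Finset.mem_range.1 hk)
    calc (k : ℝ) * P.lg v x ≤ k * μ := by gcongr
      _ ≤ n * μ := by gcongr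

lemma aeval_mem {u : L} (hu : u ∈ Subring.closure {x : L | ∃ u ∈ G, (u : L) = x})
    (p : Polynomial ℤ) :
    Polynomial.aeval u p ∈ Subring.closure {x : L | ∃ u ∈ G, (u : L) = x} := by
  rw [Polynomial.aeval_eq_sum_range]
  exact sum_mem fun k _ => zsmul_mem (pow_mem hu k) _

/-- The local form of the gap inequality, for a linear form with nonvanishing remainder. -/
lemma gap_of_ne_zero (P : PlaceSystem L G ι) {x y : Lˣ} {ξ η : Lˣ}
    (hξ : ξ ∈ G) (hη : η ∈ G) (n : ℕ)
    (hone : (x : L) ^ (2 * n + 1) * ξ + (y : L) ^ (2 * n + 1) * η = 1) (p q r : L)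
    (hq : q ∈ Subring.closure {x : L | ∃ u ∈ G, (u : L) = x})
    (hr : r ∈ Subring.closure {x : L | ∃ u ∈ G, (u : L) = x})
    (hpqr : p = (x : L) ^ (2 * n + 1) * q + (y : L) ^ (2 * n + 1) * r)
    (b : ℝ) (hb : ∀ v, ∀ α ∈ [p, q, r], P.Bd v α b ((n + 2) * max 0 (max (P.lg v x) (P.lg v y))))
    (hκ : (ξ : L) * r - η * q ≠ 0) :
    (n - 1) * ∑ v, max 0 (max (P.lg v x) (P.lg v y)) ≤
      ∑ v, max 0 (max (P.lg v ξ) (P.lg v η)) + (b + 1) := by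
  set κ := (ξ : L) * r - η * q with hκdef
  have hκmem : κ ∈ Subring.closure {x : L | ∃ u ∈ G, (u : L) = x} :=
    sub_mem (mul_mem (coe_mem hξ) hr) (mul_mem (coe_mem hη) hq)
  have hlgu : ∀ (u : Lˣ) v, P.Bd v (u : L) 0 (P.lg v u) := fun u v _ => by simp
  have hlg1 : ∀ v, P.Bd v (1 : L) 0 0 := fun v _ => by simp [P.lg_one]
  have key : ∀ v, P.lg v κ ≤ P.wt v * (b + 1) + max 0 (max (P.lg v ξ) (P.lg v η)) -
      (n - 1) * max 0 (max (P.lg v x) (P.lg v y)) := by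
    intro v
    set μ := max 0 (max (P.lg v x) (P.lg v y)) with hμ
    set τ := max 0 (max (P.lg v ξ) (P.lg v η)) with hτ
    have hτ0 : 0 ≤ τ := le_max_left _ _
    have hτξ : P.lg v ξ ≤ τ := (le_max_left _ _).trans (le_max_right _ _)
    have hτη : P.lg v η ≤ τ := (le_max_right _ _).trans (le_max_right _ _)
    have hp := hb v p (by simp)
    have hq' := hb v q (by simp)
    have hr' := hb v r (by simp)
    have comb : ∀ (α β γ δ : L), P.Bd v α 0 τ → P.Bd v β b ((n + 2) * μ) → P.Bd v γ 0 τ →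
        P.Bd v δ b ((n + 2) * μ) → P.Bd v (α * β - γ * δ) (b + 1) (τ + (n + 2) * μ) := by
      intro α β γ δ h1 h2 h3 h4
      have e1 := (h1.mul h2).mono (show 0 + b ≤ b by linarith) le_rfl
      have e2 := (h3.mul h4).mono (show 0 + b ≤ b by linarith) le_rfl
      rw [sub_eq_add_neg]
      exact e1.add e2.neg
    have hξ' := (hlgu ξ v).mono le_rfl hτξ
    have hη' := (hlgu η v).mono le_rfl hτη
    have h1' := (hlg1 v).mono le_rfl hτ0
    have hcase : P.lg v κ + (2 * n + 1 : ℕ) * μ ≤ P.wt v * (b + 1) + (τ + (n + 2) * μ) := by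
      rcases max_choice 0 (max (P.lg v x) (P.lg v y)) with hm | hm
      · rw [hμ, hm, mul_zero, add_zero]
        have := comb ξ r η q hξ' hr' hη' hq' hκ
        rwa [hμ, hm] at this
      · rcases max_choice (P.lg v x) (P.lg v y) with hm' | hm'
        · have hμx : μ = P.lg v x := hm.trans hm'
          have h : (1 : L) * r - η * p = (x : L) ^ (2 * n + 1) * κ := by
            rw [← hone, hpqr, hκdef]; ring
          have h0 : (x : L) ^ (2 * n + 1) * κ ≠ 0 := mul_ne_zero (pow_ne_zero _ x.ne_zero) hκ
          have := comb 1 r η p h1' hr' hη' hp (h ▸ h0)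
          rw [h, P.lg_mul v _ _ (pow_ne_zero _ x.ne_zero) hκ, P.lg_pow v _ x.ne_zero, ← hμx]
            at this
          linarith
        · have hμy : μ = P.lg v y := hm.trans hm'
          have h : (ξ : L) * p - 1 * q = (y : L) ^ (2 * n + 1) * κ := by
            rw [← hone, hpqr, hκdef]; ring
          have h0 : (y : L) ^ (2 * n + 1) * κ ≠ 0 := mul_ne_zero (pow_ne_zero _ y.ne_zero) hκ
          have := comb ξ p 1 q hξ' hp h1' hq' (h ▸ h0)
          rw [h, P.lg_mul v _ _ (pow_ne_zero _ y.ne_zero) hκ, P.lg_pow v _ y.ne_zero, ← hμy]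
            at this
          linarith
    push_cast at hcase
    linarith
  have h1 := P.sum_nonneg κ hκmem hκ
  have h2 := Finset.sum_le_sum fun v (_ : v ∈ Finset.univ) => key v
  rw [Finset.sum_sub_distrib, Finset.sum_add_distrib, ← Finset.sum_mul, P.wt_sum,
    ← Finset.mul_sum] at h2
  linarith

/-- The gap inequality for two solutions of the two-variable unit equation. -/
lemma gap_two [CharZero L] (P : PlaceSystem L G ι) {x y X Y : Lˣ} (hx : x ∈ G) (hy : y ∈ G)
    (hX : X ∈ G) (hY : Y ∈ G) (hxy : (x : L) + y = 1) (hXY : (X : L) + Y = 1) (n : ℕ) :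
    (n - 1) * ∑ v, max 0 (max (P.lg v x) (P.lg v y)) ≤
      ∑ v, max 0 (max (P.lg v ((X / x ^ (2 * n + 1) : Lˣ) : L))
        (P.lg v ((Y / y ^ (2 * n + 1) : Lˣ) : L))) + (9 * n + 2) := by
  set ξ : Lˣ := X / x ^ (2 * n + 1) with hξ
  set η : Lˣ := Y / y ^ (2 * n + 1) with hη
  have hξG : ξ ∈ G := G.div_mem hX (G.pow_mem hx _)
  have hηG : η ∈ G := G.div_mem hY (G.pow_mem hy _)
  have hone : (x : L) ^ (2 * n + 1) * ξ + (y : L) ^ (2 * n + 1) * η = 1 := by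
    rw [← hXY, hξ, hη]
    push_cast
    rw [mul_div_cancel₀ _ (pow_ne_zero _ x.ne_zero), mul_div_cancel₀ _ (pow_ne_zero _ y.ne_zero)]
  have hy1 : (y : L) = 1 - x := by rw [← hxy]; ring
  have comp : ∀ p : Polynomial ℤ, Polynomial.aeval (x : L) (p.comp (1 - Polynomial.X)) =
      Polynomial.aeval (y : L) p := fun p => by
    rw [Polynomial.aeval_comp, hy1]; simp
  have E0 : Polynomial.aeval (x : L) (padeP n) = (x : L) ^ (2 * n + 1) *
      Polynomial.aeval (x : L) (padeQ n) + (y : L) ^ (2 * n + 1) *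
      ((-1) ^ n * Polynomial.aeval (y : L) (padeQ n)) := by
    rw [pade_identity]
    simp only [map_add, map_mul, map_pow, Polynomial.aeval_X, map_neg, map_one, map_sub, comp]
    rw [← hy1]; ring
  have E1 : (x : L) * Polynomial.aeval (x : L) (Polynomial.derivative (padeP n)) * y =
      (x : L) ^ (2 * n + 1) * (Polynomial.aeval (x : L) (padeQ' n) * y) + (y : L) ^ (2 * n + 1) *
      (-((-1) ^ n * (x * Polynomial.aeval (y : L) (padeQ' n)))) := by
    have := congrArg (Polynomial.aeval (x : L)) (X_mul_derivative_padeP n)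
    simp only [map_mul, map_pow, Polynomial.aeval_X, map_neg, map_one, map_sub, comp] at this
    rw [this, ← hy1]; ring
  obtain ⟨w, hw, hW⟩ := pade_wronskian n
  have EW : (x : L) * Polynomial.aeval (x : L) (padeQ n) * Polynomial.aeval (y : L) (padeQ' n) +
      y * Polynomial.aeval (y : L) (padeQ n) * Polynomial.aeval (x : L) (padeQ' n) = w := by
    have := congrArg (Polynomial.aeval (x : L)) hW
    simp only [map_mul, map_add, Polynomial.aeval_X, map_one, map_sub, comp,
      Polynomial.aeval_C] at this
    rw [← hy1] at this
    simpa using this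
  have hweak : (2 : ℤ) ^ (5 * n + 1) ≤ 2 ^ (8 * n + 1) :=
    pow_le_pow_right₀ (by norm_num) (by omega)
  have hcoef := fun v => P.bd_aeval v (x := (x : L)) x.ne_zero (n := n)
    (μ := max 0 (max (P.lg v x) (P.lg v y)))
  have hcoefy := fun v => P.bd_aeval v (x := (y : L)) y.ne_zero (n := n)
    (μ := max 0 (max (P.lg v x) (P.lg v y)))
  have hμx : ∀ v, P.lg v x ≤ max 0 (max (P.lg v x) (P.lg v y)) := fun v =>
    (le_max_left _ _).trans (le_max_right _ _)
  have hμy : ∀ v, P.lg v y ≤ max 0 (max (P.lg v x) (P.lg v y)) := fun v =>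
    (le_max_right _ _).trans (le_max_right _ _)
  have hμ0 : ∀ v, 0 ≤ max 0 (max (P.lg v x) (P.lg v y)) := fun v => le_max_left _ _
  have hsgn : ∀ v, P.Bd v ((-1 : L) ^ n) 0 0 := fun v _ => by
    rw [P.lg_pow v _ (by simp), P.lg_neg_one]; simp
  have hbx : ∀ v, P.Bd v (x : L) 0 (max 0 (max (P.lg v x) (P.lg v y))) := fun v _ => by
    simp
  have hby : ∀ v, P.Bd v (y : L) 0 (max 0 (max (P.lg v x) (P.lg v y))) := fun v _ => by
    simp
  have hxR := coe_mem (L := L) hx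
  have hyR := coe_mem (L := L) hy
  have hsR : ((-1 : L) ^ n) ∈ Subring.closure {x : L | ∃ u ∈ G, (u : L) = x} :=
    pow_mem (neg_mem (one_mem _)) _
  rw [show (9 * n + 2 : ℝ) = (9 * n + 1) + 1 by ring]
  by_cases hκ : (ξ : L) * ((-1) ^ n * Polynomial.aeval (y : L) (padeQ n)) -
      η * Polynomial.aeval (x : L) (padeQ n) = 0
  · refine P.gap_of_ne_zero hξG hηG n hone _ _ _ ?_ ?_ E1 _ (fun v α hα => ?_) ?_
    · exact mul_mem (aeval_mem hxR _) hyR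
    · exact neg_mem (mul_mem hsR (mul_mem hxR (aeval_mem hyR _)))
    · simp only [List.mem_cons, List.not_mem_nil, or_false] at hα
      have hd : (Polynomial.derivative (padeP n)).natDegree ≤ n :=
        (Polynomial.natDegree_derivative_le _).trans
          ((Nat.sub_le _ _).trans (natDegree_padeP_le n))
      rcases hα with rfl | rfl | rfl
      · exact (((hbx v).mul (hcoef v _ hd (abs_derivative_padeP_coeff_le n) (hμ0 v)
          (hμx v))).mul (hby v)).mono (by linarith) (by linarith)
      · exact ((hcoef v _ (natDegree_padeQ'_le n) (abs_padeQ'_coeff_le n) (hμ0 v)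
          (hμx v)).mul (hby v)).mono (by linarith) (by linarith [hμ0 v])
      · exact ((hsgn v).mul ((hbx v).mul (hcoefy v _ (natDegree_padeQ'_le n)
          (abs_padeQ'_coeff_le n) (hμ0 v) (hμy v)))).neg.mono (by linarith) (by linarith [hμ0 v])
    · intro hκ'
      have hs2 : ((-1 : L) ^ n) * (-1) ^ n = 1 := by rw [← mul_pow]; simp
      have : (ξ : L) * w = 0 := by
        rw [← EW]
        linear_combination (-1) ^ n * y * (Polynomial.aeval (x : L) (padeQ' n)) * hκ -
          (-1) ^ n * (Polynomial.aeval (x : L) (padeQ n)) * hκ' +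
          (-(ξ : L) * x * Polynomial.aeval (x : L) (padeQ n) * Polynomial.aeval (y : L) (padeQ' n)
            - ξ * y * Polynomial.aeval (y : L) (padeQ n) * Polynomial.aeval (x : L) (padeQ' n)) *
            hs2
      rcases mul_eq_zero.1 this with h | h
      · exact ξ.ne_zero h
      · exact hw (by exact_mod_cast h)
  · refine P.gap_of_ne_zero hξG hηG n hone _ _ _ ?_ ?_ E0 _ (fun v α hα => ?_) hκ
    · exact aeval_mem hxR _
    · exact mul_mem hsR (aeval_mem hyR _)
    · simp only [List.mem_cons, List.not_mem_nil, or_false] at hα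
      rcases hα with rfl | rfl | rfl
      · exact (hcoef v _ (natDegree_padeP_le n) (fun k => (abs_padeP_coeff_le n k).trans hweak)
          (hμ0 v) (hμx v)).mono le_rfl (by nlinarith [hμ0 v])
      · exact (hcoef v _ (natDegree_padeQ_le n) (fun k => (abs_padeQ_coeff_le n k).trans hweak)
          (hμ0 v) (hμx v)).mono le_rfl (by nlinarith [hμ0 v])
      · exact ((hsgn v).mul (hcoefy v _ (natDegree_padeQ_le n)
          (fun k => (abs_padeQ_coeff_le n k).trans hweak)
          (hμ0 v) (hμy v))).mono (by linarith) (by nlinarith [hμ0 v])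

end PlaceSystem

namespace PlaceSystem

variable {L : Type*} [Field L] {G : Subgroup Lˣ} {ι : Type*} [Fintype ι]

/-- Two solutions of the two-variable unit equation whose logarithmic vectors point in nearly the
same direction have comparable heights. -/
lemma height_le_of_close [CharZero L] (P : PlaceSystem L G ι) {x y X Y : Lˣ} (hx : x ∈ G)
    (hy : y ∈ G) (hX : X ∈ G) (hY : Y ∈ G) (hxy : (x : L) + y = 1) (hXY : (X : L) + Y = 1)
    {h H : ℝ} (hh : h = ‖P.vec x‖ + ‖P.vec y‖) (h144 : 144 < h)
    (hHpos : 0 < H)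
    (hcx : ‖h⁻¹ • P.vec x - H⁻¹ • P.vec X‖ ≤ 1 / 64)
    (hcy : ‖h⁻¹ • P.vec y - H⁻¹ • P.vec Y‖ ≤ 1 / 64) : H ≤ 32 * h := by
  have hpos : 0 < h := by linarith
  set n := ⌊H / h / 2⌋₊ with hn
  have hn1 : (n : ℝ) ≤ H / h / 2 := Nat.floor_le (by positivity)
  have hn2 : H / h / 2 < n + 1 := Nat.lt_floor_add_one _
  have hn1' : 2 * n * h ≤ H := by
    rw [div_div, le_div_iff₀ (by positivity)] at hn1; linarith
  have hn2' : H < (2 * n + 2) * h := by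
    rw [div_div, div_lt_iff₀ (by positivity)] at hn2; linarith
  have gap := P.gap_two hx hy hX hY hxy hXY n
  have lower : h / 4 ≤ ∑ v, max 0 (max (P.lg v x) (P.lg v y)) := by
    have h1 : ‖P.vec x‖ / 2 ≤ ∑ v, max 0 (max (P.lg v x) (P.lg v y)) := by
      rw [← P.sum_max_zero hx]
      exact Finset.sum_le_sum fun v _ => max_le_max le_rfl (le_max_left _ _)
    have h2 : ‖P.vec y‖ / 2 ≤ ∑ v, max 0 (max (P.lg v x) (P.lg v y)) := by
      rw [← P.sum_max_zero hy]
      exact Finset.sum_le_sum fun v _ => max_le_max le_rfl (le_max_right _ _)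
    linarith
  have upper1 : ∑ v, max 0 (max (P.lg v ((X / x ^ (2 * n + 1) : Lˣ) : L))
        (P.lg v ((Y / y ^ (2 * n + 1) : Lˣ) : L))) ≤
      ‖P.vec (X / x ^ (2 * n + 1))‖ + ‖P.vec (Y / y ^ (2 * n + 1))‖ := by
    rw [norm_vec, norm_vec, ← Finset.sum_add_distrib]
    refine Finset.sum_le_sum fun v _ => max_le (by positivity) (max_le ?_ ?_)
    · have := le_abs_self (P.lg v ((X / x ^ (2 * n + 1) : Lˣ) : L))
      linarith [abs_nonneg (P.lg v ((Y / y ^ (2 * n + 1) : Lˣ) : L))]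
    · have := le_abs_self (P.lg v ((Y / y ^ (2 * n + 1) : Lˣ) : L))
      linarith [abs_nonneg (P.lg v ((X / x ^ (2 * n + 1) : Lˣ) : L))]
  have close : ∀ u U : Lˣ, ‖h⁻¹ • P.vec u - H⁻¹ • P.vec U‖ ≤ 1 / 64 →
      ‖P.vec (U / u ^ (2 * n + 1))‖ ≤ H / 64 + ‖P.vec u‖ := by
    intro u U hc
    have e : P.vec (U / u ^ (2 * n + 1)) = -(H • (h⁻¹ • P.vec u - H⁻¹ • P.vec U)) +
        (H / h - (2 * n + 1)) • P.vec u := by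
      rw [vec_div, vec_pow, smul_sub, smul_smul, smul_smul, mul_inv_cancel₀ hHpos.ne', one_smul,
        sub_smul, div_eq_mul_inv]
      push_cast
      abel
    rw [e]
    refine (norm_add_le _ _).trans (add_le_add ?_ ?_)
    · rw [norm_neg, norm_smul, Real.norm_of_nonneg hHpos.le]
      nlinarith
    · rw [norm_smul, Real.norm_eq_abs]
      have : |H / h - (2 * n + 1)| ≤ 1 := by
        rw [abs_le]; constructor <;> linarith
      exact mul_le_of_le_one_left (norm_nonneg _) this
  have hX' := close x X hcx
  have hY' := close y Y hcy
  by_contra hlt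
  push Not at hlt
  have hn15 : (15 : ℝ) < n + 0 := by
    have : 32 * h < (2 * n + 2) * h := hlt.trans hn2'
    have := lt_of_mul_lt_mul_right this hpos.le
    linarith
  have hlow : (n - 1 : ℝ) * (h / 4) ≤
      (n - 1) * ∑ v, max 0 (max (P.lg v x) (P.lg v y)) :=
    mul_le_mul_of_nonneg_left lower (by linarith)
  have : (n - 1 : ℝ) * (h / 4) ≤ H / 32 + h + (9 * n + 2) := by linarith
  nlinarith

lemma height_eq_of_univ (P : PlaceSystem L G ι) {κ : Type*} [Fintype κ] [DecidableEq κ] {i j : κ}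
    (hij : i ≠ j) (hu : (Finset.univ : Finset κ) = {i, j}) (z : κ → Lˣ) :
    P.height z = ‖P.vec (z i)‖ + ‖P.vec (z j)‖ := by
  rw [height, hu, Finset.sum_pair hij]

/-- A short-coloured set of solutions of the two-variable unit equation has at most one element
of each colour. -/
lemma _root_.ShortColoring.card_le {κ : Type*} [Fintype κ] {K : ℕ} {i j : κ}
    (hij : i ≠ j) [DecidableEq κ] (hu : (Finset.univ : Finset κ) = {i, j}) {Z : Set (κ → Lˣ)}
    (hZ : Z ⊆ unitSolutions G κ) (h : ShortColoring Z K) (F : Finset (κ → Lˣ))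
    (hF : ∀ z ∈ F, z ∈ Z) : F.card ≤ K := by
  obtain ⟨col, hcol⟩ := h
  have hsum : ∀ f : κ → L, ∑ k, f k = f i + f j := fun f => by rw [hu, Finset.sum_pair hij]
  have hinj : Set.InjOn col F := by
    intro z hz z' hz' hc
    obtain ⟨b, k, hk, hb⟩ := hcol z (hF z hz)
    have h1 := hb z (hF z hz) rfl
    have h2 := hb z' (hF z' hz') hc.symm
    have h3 := (hZ (hF z hz)).2
    have h4 := (hZ (hF z' hz')).2
    rw [hsum] at h1 h2 h3 h4
    have hk' : k ∈ ({i, j} : Finset κ) := hu ▸ Finset.mem_univ k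
    have hall : ∀ l : κ, l = i ∨ l = j := fun l => by
      have : l ∈ ({i, j} : Finset κ) := hu ▸ Finset.mem_univ l
      simpa using this
    have hres : (z i : L) = z' i ∧ (z j : L) = z' j := by
      rw [Finset.mem_insert, Finset.mem_singleton] at hk'
      rcases hk' with rfl | rfl
      · rw [hk] at h1 h2
        have hb0 : b j ≠ 0 := by rintro h0; rw [h0] at h1; simp at h1
        have : (z j : L) = z' j := mul_left_cancel₀ hb0 (by linear_combination h1 - h2)
        exact ⟨by linear_combination h3 - h4 - this, this⟩
      · rw [hk] at h1 h2
        have hb0 : b i ≠ 0 := by rintro h0; rw [h0] at h1; simp at h1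
        have : (z i : L) = z' i := mul_left_cancel₀ hb0 (by linear_combination h1 - h2)
        exact ⟨this, by linear_combination h3 - h4 - this⟩
    funext l
    rcases hall l with rfl | rfl
    · exact Units.ext hres.1
    · exact Units.ext hres.2
  have := Finset.card_le_card_of_injOn (t := (Finset.univ : Finset (Fin K))) col
    (fun _ _ => Finset.mem_coe.2 (Finset.mem_univ _)) hinj
  simpa using this

lemma card_le_of_dyadic (P : PlaceSystem L G ι) {κ : Type*} [Fintype κ] {K : ℕ} {c : ℝ}
    (hc : 1 ≤ c)
    (hK : ∀ T, c ≤ T → ∀ F : Finset (κ → Lˣ), (∀ z ∈ F, z ∈ unitSolutions G κ ∧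
      T ≤ P.height z ∧ P.height z ≤ 2 * T) → F.card ≤ K) (s : ℕ) {T : ℝ} (hT : c ≤ T)
    (F : Finset (κ → Lˣ)) (hF : ∀ z ∈ F, z ∈ unitSolutions G κ ∧ T ≤ P.height z ∧
      P.height z ≤ 2 ^ (s + 1) * T) : F.card ≤ (s + 1) * K := by
  classical
  induction s generalizing T F with
  | zero => simpa using hK T hT F (by simpa using hF)
  | succ s ih =>
    rw [← Finset.card_filter_add_card_filter_not (s := F) (fun z => P.height z ≤ 2 * T)]
    have h1 := hK T hT {z ∈ F | P.height z ≤ 2 * T} (fun z hz => by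
      obtain ⟨hz, hz'⟩ := Finset.mem_filter.1 hz
      exact ⟨(hF z hz).1, (hF z hz).2.1, hz'⟩)
    have h2 := ih (T := 2 * T) (by linarith) {z ∈ F | ¬ P.height z ≤ 2 * T} (fun z hz => by
      obtain ⟨hz, hz'⟩ := Finset.mem_filter.1 hz
      refine ⟨(hF z hz).1, (not_le.1 hz').le, (hF z hz).2.2.trans (le_of_eq ?_)⟩
      ring)
    nlinarith

/-- The two-variable unit equation has boundedly many solutions in a group of rank `ρ`. -/
lemma exists_card_two_le (ρ : ℕ) :
    ∃ K : ℕ, ∀ {L : Type*} [Field L] [CharZero L] {G : Subgroup Lˣ} {ι : Type*}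
      [Fintype ι] (_ : PlaceSystem L G ι), RankLE G ρ → ∀ (κ : Type) [Fintype κ],
      Fintype.card κ = 2 → ∀ F : Finset (κ → Lˣ), (∀ z ∈ F, z ∈ unitSolutions G κ) →
      F.card ≤ K := by
  classical
  obtain ⟨K, c, hc1, -, hK⟩ := exists_shortColoring ρ 2
  set Q := (5 ^ ρ) ^ (6 + 1) with hQ
  refine ⟨K + (8 * K + Q * Q * (5 * K)), ?_⟩
  intro L _ _ G ι _ P hG κ _ hκ F hF
  have hnt : Nontrivial κ := Fintype.one_lt_card_iff_nontrivial.1 (by omega)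
  obtain ⟨hsmall, hlarge⟩ := hK P hG κ hκ
  obtain ⟨i, j, hij, hu⟩ := Finset.card_eq_two.1 (Finset.card_univ.trans hκ)
  have hdy := P.card_le_of_dyadic hc1 (fun T hT F' hF' =>
    (hlarge T hT).card_le (G := G) hij hu (fun z hz => hz.1) F' hF')
  rw [← Finset.card_filter_add_card_filter_not (s := F) (fun z => P.height z ≤ c)]
  refine add_le_add (hsmall.card_le (G := G) hij hu (fun z hz => hz.1) _ fun z hz =>
    ⟨hF z (Finset.mem_filter.1 hz).1, (Finset.mem_filter.1 hz).2⟩) ?_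
  set F₁ := {z ∈ F | ¬ P.height z ≤ c} with hF₁
  rw [← Finset.card_filter_add_card_filter_not (s := F₁) (fun z => P.height z ≤ 2 ^ 8 * c)]
  refine add_le_add (hdy 7 le_rfl _ fun z hz => ?_) ?_
  · obtain ⟨hz, hz2⟩ := Finset.mem_filter.1 hz
    obtain ⟨hz, hz1⟩ := Finset.mem_filter.1 hz
    exact ⟨hF z hz, (not_le.1 hz1).le, hz2⟩
  set F₂ := {z ∈ F₁ | ¬ P.height z ≤ 2 ^ 8 * c} with hF₂
  have hF₂' : ∀ z ∈ F₂, z ∈ unitSolutions G κ ∧ 256 * c < P.height z := fun z hz => by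
    obtain ⟨hz, hz2⟩ := Finset.mem_filter.1 hz
    refine ⟨hF z (Finset.mem_filter.1 hz).1, ?_⟩
    rw [not_le] at hz2
    linarith
  obtain ⟨S, hS, hSG⟩ := hG
  have hmem : ∀ z ∈ G, P.vec z ∈ P.spanVec S := fun z hz => by
    obtain ⟨n, hn, hzn⟩ := hSG z hz
    exact P.vec_mem_spanVec S hn hzn
  obtain ⟨col, hcol⟩ := exists_coloring (P.spanVec S) ((P.finrank_spanVec S).trans hS) 6 1
  let cl : (κ → Lˣ) → Fin Q × Fin Q := fun z =>
    (col ((P.height z)⁻¹ • P.vec (z i)), col ((P.height z)⁻¹ • P.vec (z j)))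
  have hcl := Finset.card_le_mul_card_image_of_maps_to (s := F₂) (t := Finset.univ) (f := cl)
    (fun z _ => Finset.mem_univ _) (5 * K) ?_
  · simp only [Finset.card_univ, Fintype.card_prod, Fintype.card_fin] at hcl
    linarith
  rintro q -
  rcases ({z ∈ F₂ | cl z = q} : Finset _).eq_empty_or_nonempty with he | hne
  · rw [he]; simp
  obtain ⟨u, huF, humin⟩ := Finset.exists_min_image _ P.height hne
  obtain ⟨huF₂, hcu⟩ := Finset.mem_filter.1 huF
  obtain ⟨husol, huh⟩ := hF₂' u huF₂
  refine hdy 4 (T := P.height u) (by linarith) _ fun z hz => ?_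
  obtain ⟨hzF₂, hcz⟩ := Finset.mem_filter.1 hz
  obtain ⟨hzsol, hzh⟩ := hF₂' z hzF₂
  refine ⟨hzsol, humin z hz, ?_⟩
  have hsum : ∀ f : κ → L, ∑ k, f k = f i + f j := fun f => by rw [hu, Finset.sum_pair hij]
  have hus := husol.2
  have hzs := hzsol.2
  rw [hsum] at hus hzs
  have hle1 : ∀ w : κ → Lˣ, 0 < P.height w → ∀ k, ‖(P.height w)⁻¹ • P.vec (w k)‖ ≤ 1 := by
    intro w hw k
    rw [norm_smul, norm_inv, Real.norm_of_nonneg hw.le, inv_mul_le_iff₀ hw, mul_one]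
    exact P.norm_vec_le_height w k
  have hupos : 0 < P.height u := by linarith
  have hzpos : 0 < P.height z := by linarith
  obtain ⟨hc1', hc2'⟩ := Prod.mk.inj (hcu.trans hcz.symm)
  have close : ∀ k, col ((P.height u)⁻¹ • P.vec (u k)) = col ((P.height z)⁻¹ • P.vec (z k)) →
      ‖(P.height u)⁻¹ • P.vec (u k) - (P.height z)⁻¹ • P.vec (z k)‖ ≤ 1 / 64 := by
    intro k hk
    have := hcol _ ((P.spanVec S).smul_mem _ (hmem _ (husol.1 k))) _
      ((P.spanVec S).smul_mem _ (hmem _ (hzsol.1 k))) (hle1 u hupos k) (hle1 z hzpos k) hk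
    norm_num at this ⊢
    exact this
  have := P.height_le_of_close (husol.1 i) (husol.1 j) (hzsol.1 i) (hzsol.1 j) hus hzs
    (P.height_eq_of_univ hij hu u) (by linarith) hzpos
    (close i hc1') (close j hc2')
  norm_num
  linarith

end PlaceSystem

universe u

/-- Every finitely generated group of units of `L` admits a place system. -/
def HasPlaceSystems (L : Type u) [Field L] : Prop :=
  ∀ B : Finset Lˣ, ∃ (ι : Type u) (_ : Fintype ι),
    Nonempty (PlaceSystem L (Subgroup.closure (B : Set Lˣ)) ι)

/-- A finite family of nondegenerate solutions of `∑ j ∈ s, b j * z j = 1` with `z j ∈ A j`,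
each determined by its coordinates in `s`. -/
structure NondegFamily {L κ : Type*} [Field L] (s : Finset κ) (b : κ → L) (A : κ → Finset Lˣ)
    (F : Finset (κ → Lˣ)) : Prop where
  mem : ∀ z ∈ F, ∀ j ∈ s, z j ∈ A j
  sum : ∀ z ∈ F, ∑ j ∈ s, b j * (z j : L) = 1
  nondeg : ∀ z ∈ F, ∀ t ⊆ s, t.Nonempty → ∑ j ∈ t, b j * (z j : L) ≠ 0
  inj : ∀ z ∈ F, ∀ z' ∈ F, (∀ j ∈ s, z j = z' j) → z = z'

/-- Uniform bound, of the expected order of magnitude, for nondegenerate families in `m` variables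
from a group of rank `ρ`. -/
def NondegBound (ρ m C : ℕ) : Prop :=
  ∀ (L : Type u) [Field L] [CharZero L], HasPlaceSystems L → ∀ G : Subgroup Lˣ, RankLE G ρ →
    ∀ (κ : Type) (s : Finset κ), s.card = m → ∀ (b : κ → L) (A : κ → Finset Lˣ) (N : ℕ),
    (∀ j ∈ s, ∀ a ∈ A j, a ∈ G) → (∀ j ∈ s, (A j).card ≤ N) → ∀ F, NondegFamily s b A F →
    F.card ≤ C * N ^ ((m - 1) / 2)

/-- The variant of `NondegBound` where all coefficients are `1`. -/
def NondegBoundUniv (ρ m C : ℕ) : Prop :=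
  ∀ (L : Type u) [Field L] [CharZero L], HasPlaceSystems L → ∀ G : Subgroup Lˣ, RankLE G ρ →
    ∀ (κ : Type) [Fintype κ], Fintype.card κ = m → ∀ (A : κ → Finset Lˣ) (N : ℕ),
    (∀ j, ∀ a ∈ A j, a ∈ G) → (∀ j, (A j).card ≤ N) →
    ∀ F, NondegFamily Finset.univ (fun _ => (1 : L)) A F → F.card ≤ C * N ^ ((m - 1) / 2)

lemma NondegBound.mono {ρ m C C' : ℕ} (h : NondegBound.{u} ρ m C) (hC : C ≤ C') :
    NondegBound.{u} ρ m C' := by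
  intro L _ _ hL G hG κ s hs b A N hA hN F hF
  exact (h L hL G hG κ s hs b A N hA hN F hF).trans (Nat.mul_le_mul_right _ hC)

lemma NondegFamily.subset {L κ : Type*} [Field L] {s : Finset κ} {b : κ → L}
    {A A' : κ → Finset Lˣ} {F F' : Finset (κ → Lˣ)} (h : NondegFamily s b A F) (hF : F' ⊆ F)
    (hA : ∀ z ∈ F', ∀ j ∈ s, z j ∈ A' j) : NondegFamily s b A' F' :=
  ⟨hA, fun z hz => h.sum z (hF hz), fun z hz => h.nondeg z (hF hz),
    fun z hz z' hz' => h.inj z (hF hz) z' (hF hz')⟩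

lemma NondegBoundUniv.nondegBound {ρ m C : ℕ} (h : NondegBoundUniv.{u} (ρ + m) m C) :
    NondegBound.{u} ρ m C := by
  classical
  intro L _ _ hL G hG κ s hs b A N hA hN F hF
  rcases F.eq_empty_or_nonempty with rfl | ⟨z₀, hz₀⟩
  · simp
  have hb : ∀ j ∈ s, b j ≠ 0 := fun j hj h0 => by
    have := hF.nondeg z₀ hz₀ {j} (by simpa using hj) (by simp)
    simp [h0] at this
  let w : κ → Lˣ := fun j => if h : b j ≠ 0 then Units.mk0 (b j) h else 1
  have hw : ∀ j ∈ s, (w j : L) = b j := fun j hj => by simp [w, hb j hj]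
  let φ : (κ → Lˣ) → (s → Lˣ) := fun z j => w j * z j
  have hφ : Set.InjOn φ F := fun z hz z' hz' hzz => hF.inj z hz z' hz' fun j hj => by
    have := congrFun hzz ⟨j, hj⟩
    simpa [φ] using this
  have hsum : ∀ (z : κ → Lˣ) (t : Finset s), ∑ j ∈ t, (1 : L) * (φ z j : L) =
      ∑ j ∈ t.map (Function.Embedding.subtype _), b j * (z j : L) := by
    intro z t
    rw [Finset.sum_map]
    refine Finset.sum_congr rfl fun j _ => ?_
    simp [φ, hw j j.2]
  rw [← Finset.card_image_of_injOn hφ]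
  refine h L hL (G ⊔ Subgroup.closure ((s.image w : Finset Lˣ) : Set Lˣ))
    ((hG.sup_closure _).mono le_rfl
      (Nat.add_le_add_left (Finset.card_image_le.trans hs.le) _)) s (by simpa using hs)
    (fun j => (A j).image fun a => w j * a) N ?_ ?_ _ ⟨?_, ?_, ?_, ?_⟩
  · rintro j a ha
    obtain ⟨a, haA, rfl⟩ := Finset.mem_image.1 ha
    exact Subgroup.mul_mem _
      (le_sup_right (a := G) (Subgroup.subset_closure (by simpa using ⟨j, j.2, rfl⟩)))
      (le_sup_left (a := G) (hA j j.2 a haA))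
  · exact fun j => Finset.card_image_le.trans (hN j j.2)
  · rintro z hz j -
    obtain ⟨z, hzF, rfl⟩ := Finset.mem_image.1 hz
    exact Finset.mem_image_of_mem _ (hF.mem z hzF j j.2)
  · rintro z hz
    obtain ⟨z, hzF, rfl⟩ := Finset.mem_image.1 hz
    rw [hsum, ← hF.sum z hzF]
    congr 1
    ext j
    simp
  · rintro z hz t - ht
    obtain ⟨z, hzF, rfl⟩ := Finset.mem_image.1 hz
    rw [hsum]
    refine hF.nondeg z hzF _ (fun j hj => ?_) (by simpa using ht)
    obtain ⟨j, -, rfl⟩ := Finset.mem_map.1 hj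
    exact j.2
  · exact fun z _ z' _ h => funext fun j => h j (Finset.mem_univ j)

section Split

variable {L κ : Type*} [Field L] [DecidableEq κ] {s : Finset κ} {b : κ → L}
  {A : κ → Finset Lˣ} {F : Finset (κ → Lˣ)}

/-- Keep the coordinates in `I` and replace the others by `1`. -/
def maskOutside (I : Finset κ) (z : κ → Lˣ) : κ → Lˣ := fun j => if j ∈ I then z j else 1

lemma maskOutside_apply {I : Finset κ} {z : κ → Lˣ} {j : κ} (hj : j ∈ I) :
    maskOutside I z j = z j := if_pos hj

lemma maskOutside_eq_iff {I : Finset κ} {z z' : κ → Lˣ} :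
    maskOutside I z = maskOutside I z' ↔ ∀ j ∈ I, z j = z' j := by
  refine ⟨fun h j hj => ?_, fun h => funext fun j => ?_⟩
  · have := congrFun h j
    rwa [maskOutside_apply hj, maskOutside_apply hj] at this
  · simp only [maskOutside]
    split_ifs with hj
    exacts [h j hj, rfl]

lemma nondegFamily_image [DecidableEq (κ → Lˣ)] {I : Finset κ}
    (hmem : ∀ z ∈ F, ∀ j ∈ I, z j ∈ A j) (hsum : ∀ z ∈ F, ∑ j ∈ I, b j * (z j : L) = 1)
    (hnd : ∀ z ∈ F, ∀ t ⊆ I, t.Nonempty → ∑ j ∈ t, b j * (z j : L) ≠ 0) :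
    NondegFamily I b A (F.image (maskOutside I)) := by
  have hs : ∀ z : κ → Lˣ, ∀ t ⊆ I, ∑ j ∈ t, b j * (maskOutside I z j : L) =
      ∑ j ∈ t, b j * (z j : L) := fun z t ht =>
    Finset.sum_congr rfl fun j hj => by rw [maskOutside_apply (ht hj)]
  refine ⟨?_, ?_, ?_, ?_⟩ <;> simp only [Finset.mem_image]
  · rintro _ ⟨z, hz, rfl⟩ j hj
    rw [maskOutside_apply hj]
    exact hmem z hz j hj
  · rintro _ ⟨z, hz, rfl⟩
    rw [hs z I subset_rfl]
    exact hsum z hz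
  · rintro _ ⟨z, hz, rfl⟩ t ht hne
    rw [hs z t ht]
    exact hnd z hz t ht hne
  · rintro _ ⟨z, hz, rfl⟩ _ ⟨z', hz', rfl⟩ h
    refine maskOutside_eq_iff.2 fun j hj => ?_
    have := h j hj
    rwa [maskOutside_apply hj, maskOutside_apply hj] at this

lemma NondegFamily.fiber (hF : NondegFamily s b A F) {I : Finset κ} (hI : I ⊂ s)
    {y : κ → Lˣ} (hy : y ∈ F) {F' : Finset (κ → Lˣ)} (hF' : F' ⊆ F)
    (hF'y : ∀ z ∈ F', maskOutside I z = maskOutside I y) :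
    NondegFamily (s \ I) (fun j => (∑ j ∈ s \ I, b j * (y j : L))⁻¹ * b j) A F' := by
  have he : ∑ j ∈ s \ I, b j * (y j : L) ≠ 0 :=
    hF.nondeg y hy _ Finset.sdiff_subset (Finset.sdiff_nonempty.2 hI.2)
  refine ⟨fun z hz j hj => hF.mem z (hF' hz) j (Finset.mem_sdiff.1 hj).1, fun z hz => ?_,
    fun z hz t ht hne => ?_, fun z hz z' hz' h => ?_⟩
  · simp only [mul_assoc]
    rw [← Finset.mul_sum]
    have h1 := Finset.sum_sdiff (f := fun j => b j * (z j : L)) hI.1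
    have h2 := Finset.sum_sdiff (f := fun j => b j * (y j : L)) hI.1
    have h3 : ∑ j ∈ I, b j * (z j : L) = ∑ j ∈ I, b j * (y j : L) :=
      Finset.sum_congr rfl fun j hj => by rw [maskOutside_eq_iff.1 (hF'y z hz) j hj]
    rw [hF.sum z (hF' hz), h3, ← hF.sum y hy, ← h2] at h1
    rw [add_right_cancel h1, inv_mul_cancel₀ he]
  · simp only [mul_assoc]
    rw [← Finset.mul_sum]
    exact mul_ne_zero (inv_ne_zero he)
      (hF.nondeg z (hF' hz) t (ht.trans Finset.sdiff_subset) hne)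
  · refine hF.inj z (hF' hz) z' (hF' hz') fun j hj => ?_
    by_cases hjI : j ∈ I
    · exact maskOutside_eq_iff.1 ((hF'y z hz).trans (hF'y z' hz').symm) j hjI
    · exact h j (Finset.mem_sdiff.2 ⟨hj, hjI⟩)

end Split

/-- Fixing one coordinate reduces the number of variables by one. -/
lemma NondegBound.card_le_mul {ρ m C : ℕ} (h : NondegBound.{u} ρ (m - 1) C) (hm : 2 ≤ m)
    {L : Type u} [Field L] [CharZero L] (hL : HasPlaceSystems L) {G : Subgroup Lˣ}
    (hG : RankLE G ρ) {κ : Type} {s : Finset κ} (hs : s.card = m) {b : κ → L}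
    {A : κ → Finset Lˣ} {N : ℕ} (hA : ∀ j ∈ s, ∀ a ∈ A j, a ∈ G)
    (hN : ∀ j ∈ s, (A j).card ≤ N) {F : Finset (κ → Lˣ)} (hF : NondegFamily s b A F) {i : κ}
    (hi : i ∈ s) : F.card ≤ (A i).card * (C * N ^ ((m - 2) / 2)) := by
  classical
  have hI : {i} ⊂ s := by
    refine Finset.ssubset_iff_subset_ne.2 ⟨by simpa using hi, fun h => ?_⟩
    rw [← h] at hs
    simp at hs
    omega
  rw [mul_comm]
  refine Finset.card_le_mul_card_image_of_maps_to (f := fun z => z i) (fun z hz => hF.mem z hz i hi)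
    _ fun a _ => ?_
  rcases ({z ∈ F | z i = a} : Finset _).eq_empty_or_nonempty with he | ⟨y, hy⟩
  · rw [he]; simp
  obtain ⟨hyF, hya⟩ := Finset.mem_filter.1 hy
  have := h L hL G hG κ (s \ {i}) (by rw [Finset.card_sdiff_of_subset hI.1, hs]; simp)
    _ A N (fun j hj => hA j (Finset.mem_sdiff.1 hj).1) (fun j hj => hN j (Finset.mem_sdiff.1 hj).1)
    {z ∈ F | z i = a} (hF.fiber hI hyF (Finset.filter_subset _ _) fun z hz =>
      maskOutside_eq_iff.2 fun j hj => by
        rw [Finset.mem_singleton.1 hj, hya, (Finset.mem_filter.1 hz).2])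
  rwa [Nat.sub_sub] at this

/-- A nondegenerate family in an even number of variables, all of whose members satisfy a further
equation with a vanishing coefficient. -/
lemma card_le_of_shorter_equation {ρ m C : ℕ} (hm : 4 ≤ m) (hev : Even m)
    (hC : ∀ a, 1 ≤ a → a < m → NondegBound.{u} ρ a C)
    {L : Type u} [Field L] [CharZero L] (hL : HasPlaceSystems L) {G : Subgroup Lˣ}
    (hG : RankLE G ρ) {κ : Type} {s : Finset κ} (hs : s.card = m) {b : κ → L}
    {A : κ → Finset Lˣ} {N : ℕ} (hA : ∀ j ∈ s, ∀ a ∈ A j, a ∈ G)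
    (hN : ∀ j ∈ s, (A j).card ≤ N) {F : Finset (κ → Lˣ)} (hF : NondegFamily s b A F)
    {c : κ → L} (hc : ∀ z ∈ F, ∑ j ∈ s, c j * (z j : L) = 1) {j₀ : κ} (hj₀ : j₀ ∈ s)
    (hcj₀ : c j₀ = 0) {i i' : κ} (hi : i ∈ s) (hi' : i' ∈ s) (hii : i ≠ i') {M : ℕ}
    (hM : (A i).card ≤ M) (hM' : (A i').card ≤ M) :
    F.card ≤ C * C * M * N ^ ((m - 4) / 2) * 2 ^ m := by
  classical
  rcases F.eq_empty_or_nonempty with rfl | ⟨z₀, hz₀⟩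
  · simp
  have hM1 : 1 ≤ M := (Finset.card_pos.2 ⟨_, hF.mem z₀ hz₀ i hi⟩).trans_le hM
  have hmin : ∀ z ∈ F, ∃ I ⊂ s, I.Nonempty ∧ ∑ j ∈ I, c j * (z j : L) = 1 ∧
      ∀ t ⊆ I, t.Nonempty → ∑ j ∈ t, c j * (z j : L) ≠ 0 := by
    intro z hz
    obtain ⟨I, hI, hmin⟩ := Finset.exists_min_image
      {I ∈ s.powerset | ∑ j ∈ I, c j * (z j : L) = 1} Finset.card
      ⟨s, Finset.mem_filter.2 ⟨Finset.mem_powerset_self s, hc z hz⟩⟩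
    obtain ⟨hIs, hI1⟩ := Finset.mem_filter.1 hI
    rw [Finset.mem_powerset] at hIs
    have hnd : ∀ t ⊆ I, t.Nonempty → ∑ j ∈ t, c j * (z j : L) ≠ 0 := by
      intro t ht hne h0
      have h1 := Finset.sum_sdiff (f := fun j => c j * (z j : L)) ht
      rw [h0, add_zero, hI1] at h1
      have := hmin (I \ t) (Finset.mem_filter.2
        ⟨Finset.mem_powerset.2 (Finset.sdiff_subset.trans hIs), h1⟩)
      have := Finset.card_lt_card (Finset.sdiff_ssubset ht hne)
      omega
    refine ⟨I, Finset.ssubset_iff_subset_ne.2 ⟨hIs, ?_⟩, ?_, hI1, hnd⟩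
    · rintro rfl
      exact hnd {j₀} (by simpa using hj₀) (by simp) (by simp [hcj₀])
    · rw [Finset.nonempty_iff_ne_empty]
      rintro rfl
      simp at hI1
  choose! If hIs hIne hI1 hInd using hmin
  have hpow : s.powerset.card = 2 ^ m := by rw [Finset.card_powerset, hs]
  rw [← hpow]
  refine Finset.card_le_mul_card_image_of_maps_to (f := If)
    (fun z hz => Finset.mem_powerset.2 (hIs z hz).1) _ fun I _ => ?_
  rcases ({z ∈ F | If z = I} : Finset _).eq_empty_or_nonempty with he | ⟨y, hy⟩
  · rw [he]; simp
  have hF₁ : ∀ z ∈ ({z ∈ F | If z = I} : Finset _), z ∈ F ∧ If z = I := fun z hz =>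
    Finset.mem_filter.1 hz
  set F₁ : Finset (κ → Lˣ) := {z ∈ F | If z = I} with hF₁def
  have hI : I ⊂ s := (hF₁ y hy).2 ▸ hIs y (hF₁ y hy).1
  have hIne : I.Nonempty := (hF₁ y hy).2 ▸ hIne y (hF₁ y hy).1
  have himg : NondegFamily I c A (F₁.image (maskOutside I)) :=
    nondegFamily_image (fun z hz j hj => hF.mem z (hF₁ z hz).1 j (hI.1 hj))
      (fun z hz => by have := hI1 z (hF₁ z hz).1; rwa [(hF₁ z hz).2] at this)
      (fun z hz => by have := hInd z (hF₁ z hz).1; rwa [(hF₁ z hz).2] at this)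
  have hAI : ∀ j ∈ I, ∀ a ∈ A j, a ∈ G := fun j hj => hA j (hI.1 hj)
  have hNI : ∀ j ∈ I, (A j).card ≤ N := fun j hj => hN j (hI.1 hj)
  have hAI' : ∀ j ∈ s \ I, ∀ a ∈ A j, a ∈ G := fun j hj => hA j (Finset.mem_sdiff.1 hj).1
  have hNI' : ∀ j ∈ s \ I, (A j).card ≤ N := fun j hj => hN j (Finset.mem_sdiff.1 hj).1
  have split : ∀ X Y : ℕ, (F₁.image (maskOutside I)).card ≤ X →
      (∀ F' e, NondegFamily (s \ I) e A F' → F'.card ≤ Y) → F₁.card ≤ Y * X := by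
    intro X Y hX hY
    refine (Finset.card_le_mul_card_image (f := maskOutside I) F₁ Y fun w hw => ?_).trans
      (Nat.mul_le_mul_left _ hX)
    obtain ⟨y, hy, rfl⟩ := Finset.mem_image.1 hw
    exact hY _ _ (hF.fiber hI (hF₁ y hy).1
      (fun z hz => (hF₁ z (Finset.mem_filter.1 hz).1).1) fun z hz => (Finset.mem_filter.1 hz).2)
  have hcard : I.card + (s \ I).card = m := by
    rw [Finset.card_sdiff_of_subset hI.1, hs]
    have := Finset.card_le_card hI.1
    omega
  have ha1 : 1 ≤ I.card := Finset.card_pos.2 hIne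
  have ha1' : 1 ≤ (s \ I).card := Finset.card_pos.2 (Finset.sdiff_nonempty.2 hI.2)
  have bI := hC I.card ha1 (by omega) L hL G hG κ I rfl c A N hAI hNI _ himg
  have bI' := fun F' e hF' => hC (s \ I).card ha1' (by omega) L hL G hG κ (s \ I) rfl e A N hAI'
    hNI' F' hF'
  have sI : ∀ k ∈ I, 3 ≤ I.card → (A k).card ≤ M → (F₁.image (maskOutside I)).card ≤
      M * (C * N ^ ((I.card - 2) / 2)) := fun k hk h3 hkM =>
    ((hC (I.card - 1) (by omega) (by omega)).card_le_mul (by omega) hL hG rfl hAI hNI himg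
      hk).trans (Nat.mul_le_mul_right _ hkM)
  have sI' : ∀ k ∈ s \ I, 3 ≤ (s \ I).card → (A k).card ≤ M → ∀ F' e,
      NondegFamily (s \ I) e A F' → F'.card ≤ M * (C * N ^ (((s \ I).card - 2) / 2)) :=
    fun k hk h3 hkM F' e hF' =>
    ((hC ((s \ I).card - 1) (by omega) (by omega)).card_le_mul (by omega) hL hG rfl hAI' hNI' hF'
      hk).trans (Nat.mul_le_mul_right _ hkM)
  rcases Nat.even_or_odd I.card with hIe | hIo
  · have hIe' : Even (s \ I).card := by
      rw [← hcard] at hev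
      exact (Nat.even_add.1 hev).1 hIe
    obtain ⟨p, hp⟩ := hIe
    obtain ⟨q, hq⟩ := hIe'
    refine (split _ _ bI bI').trans ?_
    rw [show (m - 4) / 2 = (p - 1) + (q - 1) by omega, show (I.card - 1) / 2 = p - 1 by omega,
      show ((s \ I).card - 1) / 2 = q - 1 by omega, pow_add]
    calc _ = C * C * 1 * (N ^ (p - 1) * N ^ (q - 1)) := by ring
      _ ≤ _ := by gcongr
  · have hIo' : Odd (s \ I).card := by
      rw [← hcard] at hev
      exact (Nat.even_add'.1 hev).1 hIo
    obtain ⟨p, hp⟩ := hIo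
    obtain ⟨q, hq⟩ := hIo'
    have hex : (∃ k ∈ I, 3 ≤ I.card ∧ (A k).card ≤ M) ∨
        (∃ k ∈ s \ I, 3 ≤ (s \ I).card ∧ (A k).card ≤ M) := by
      by_cases h1 : i ∈ I
      · by_cases h3 : 3 ≤ I.card
        · exact Or.inl ⟨i, h1, h3, hM⟩
        · refine Or.inr ⟨i', Finset.mem_sdiff.2 ⟨hi', fun h => hii ?_⟩, by omega, hM'⟩
          exact Finset.card_le_one.1 (by omega) i h1 i' h
      · by_cases h3 : 3 ≤ (s \ I).card
        · exact Or.inr ⟨i, Finset.mem_sdiff.2 ⟨hi, h1⟩, h3, hM⟩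
        · have : i' ∈ I := by
            by_contra h
            exact hii (Finset.card_le_one.1 (show (s \ I).card ≤ 1 by omega) i
              (Finset.mem_sdiff.2 ⟨hi, h1⟩) i' (Finset.mem_sdiff.2 ⟨hi', h⟩))
          exact Or.inl ⟨i', this, by omega, hM'⟩
    rcases hex with ⟨k, hk, h3, hkM⟩ | ⟨k, hk, h3, hkM⟩
    · refine (split _ _ (sI k hk h3 hkM) bI').trans (le_of_eq ?_)
      rw [show (m - 4) / 2 = (p - 1) + q by omega, show (I.card - 2) / 2 = p - 1 by omega,
        show ((s \ I).card - 1) / 2 = q by omega, pow_add]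
      ring
    · refine (split _ _ bI (sI' k hk h3 hkM)).trans (le_of_eq ?_)
      rw [show (m - 4) / 2 = p + (q - 1) by omega, show (I.card - 1) / 2 = p by omega,
        show ((s \ I).card - 2) / 2 = q - 1 by omega, pow_add]
      ring

namespace PlaceSystem

variable {L : Type*} [Field L] {G : Subgroup Lˣ} {ι : Type*} [Fintype ι]

/-- In a solution of the unit equation, no coordinate is much larger than the others together. -/
lemma norm_vec_le_sum (P : PlaceSystem L G ι) {κ : Type} [Fintype κ] [DecidableEq κ]
    {z : κ → Lˣ} (hz : z ∈ unitSolutions G κ) (i : κ) :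
    ‖P.vec (z i)‖ ≤ 2 * Real.log (Fintype.card κ) +
      ∑ j ∈ Finset.univ.erase i, ‖P.vec (z j)‖ := by
  have hlog : 0 ≤ Real.log (Fintype.card κ) :=
    Real.log_nonneg (by exact_mod_cast Fintype.card_pos_iff.2 ⟨i⟩)
  have key : ∀ v, max 0 (P.lg v (z i)) ≤ P.wt v * Real.log (Fintype.card κ) +
      ∑ j ∈ Finset.univ.erase i, max 0 (P.lg v (z j)) := by
    intro v
    have hnn : 0 ≤ P.wt v * Real.log (Fintype.card κ) := mul_nonneg (P.wt_nonneg v) hlog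
    have hs : 0 ≤ ∑ j ∈ Finset.univ.erase i, max 0 (P.lg v (z j)) :=
      Finset.sum_nonneg fun _ _ => le_max_left _ _
    refine max_le (by linarith) ?_
    have he : ∑ j, ((if j = i then (1 : ℤ) else -1 : ℤ) : L) *
        (if j = i then (1 : L) else z j) = z i := by
      rw [← Finset.add_sum_erase _ _ (Finset.mem_univ i)]
      have h1 := hz.2
      rw [← Finset.add_sum_erase _ _ (Finset.mem_univ i)] at h1
      have h2 : ∑ j ∈ Finset.univ.erase i, ((if j = i then (1 : ℤ) else -1 : ℤ) : L) *
          (if j = i then (1 : L) else z j) = -∑ j ∈ Finset.univ.erase i, (z j : L) := by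
        rw [← Finset.sum_neg_distrib]
        refine Finset.sum_congr rfl fun j hj => ?_
        rw [if_neg (Finset.ne_of_mem_erase hj), if_neg (Finset.ne_of_mem_erase hj)]
        simp
      rw [h2, if_pos rfl, if_pos rfl]
      push_cast
      linear_combination -h1
    obtain ⟨j, -, hj⟩ := P.lg_sum v κ Finset.univ (fun j => if j = i then (1 : ℤ) else -1)
      (fun j => if j = i then (1 : L) else z j)
      (fun j _ => by split_ifs; exacts [one_ne_zero, (z j).ne_zero])
      (by rw [he]; exact (z i).ne_zero)
    have hN : ∑ j : κ, |(((if j = i then (1 : ℤ) else -1) : ℤ) : ℝ)| = Fintype.card κ := by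
      rw [Finset.sum_congr rfl (g := fun _ => (1 : ℝ)) fun j _ => by split_ifs <;> simp]
      simp
    rw [he, hN] at hj
    refine hj.trans (add_le_add le_rfl ?_)
    by_cases hji : j = i
    · rw [if_pos hji, P.lg_one]
      exact hs
    · rw [if_neg hji]
      exact (le_max_right _ _).trans (Finset.single_le_sum
        (f := fun j => max 0 (P.lg v (z j))) (fun _ _ => le_max_left _ _)
        (Finset.mem_erase.2 ⟨hji, Finset.mem_univ j⟩))
  have h := Finset.sum_le_sum fun v (_ : v ∈ Finset.univ) => key v
  rw [P.sum_max_zero (hz.1 i), Finset.sum_add_distrib, ← Finset.sum_mul, P.wt_sum, one_mul,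
    Finset.sum_comm] at h
  simp only [P.sum_max_zero (hz.1 _)] at h
  rw [← Finset.sum_div] at h
  linarith

/-- A solution of large height has two large coordinates. -/
lemma exists_two_large (P : PlaceSystem L G ι) {κ : Type} [Fintype κ] [Nontrivial κ]
    {m : ℕ} (hm : Fintype.card κ = m) {z : κ → Lˣ} (hz : z ∈ unitSolutions G κ) {T : ℝ}
    (hT : 8 * m * Real.log m.factorial ≤ T) (hzT : T ≤ P.height z) :
    ∃ i i', i ≠ i' ∧ T / (2 * m ^ 2) ≤ ‖P.vec (z i)‖ ∧ T / (2 * m ^ 2) ≤ ‖P.vec (z i')‖ := by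
  classical
  have hm2 : 2 ≤ m := hm ▸ Fintype.one_lt_card
  have hmR : (2 : ℝ) ≤ m := by exact_mod_cast hm2
  have hlog : 0 ≤ Real.log m := Real.log_nonneg (by linarith)
  have hlogle : Real.log m ≤ Real.log m.factorial :=
    Real.log_le_log (by linarith) (by exact_mod_cast Nat.self_le_factorial m)
  have hm0 : (0 : ℝ) ≤ m := by linarith
  have hT4 : 4 * m * Real.log m ≤ T := by
    nlinarith [mul_nonneg hm0 hlog, mul_le_mul_of_nonneg_left hlogle hm0]
  have hT0 : 0 ≤ T := by
    have : 0 ≤ 4 * m * Real.log m := by positivity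
    linarith
  obtain ⟨i, -, hi⟩ := Finset.exists_le_of_sum_le (s := Finset.univ) (f := fun _ : κ => T / m)
    (g := fun j => ‖P.vec (z j)‖) Finset.univ_nonempty (by
      rw [Finset.sum_const, Finset.card_univ, hm, nsmul_eq_mul, mul_div_cancel₀ _ (by linarith)]
      exact hzT)
  have hsum := P.norm_vec_le_sum hz i
  rw [hm] at hsum
  have hmm : T / (2 * m ^ 2) * m = T / m / 2 := by field_simp
  obtain ⟨i', hi', hi'T⟩ := Finset.exists_le_of_sum_le (s := Finset.univ.erase i)
    (f := fun _ : κ => T / (2 * m ^ 2)) (g := fun j => ‖P.vec (z j)‖) (by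
      rw [← Finset.card_pos, Finset.card_erase_of_mem (Finset.mem_univ _), Finset.card_univ]
      omega) (by
      rw [Finset.sum_const, Finset.card_erase_of_mem (Finset.mem_univ _), Finset.card_univ, hm,
        nsmul_eq_mul]
      have h1 : ((m - 1 : ℕ) : ℝ) * (T / (2 * m ^ 2)) ≤ T / m / 2 := by
        rw [← hmm, mul_comm]
        gcongr
        exact_mod_cast Nat.sub_le _ _
      have h2 : 2 * Real.log m ≤ T / m / 2 := by
        rw [div_div, le_div_iff₀ (by positivity)]
        linarith
      linarith)
  refine ⟨i, i', (Finset.ne_of_mem_erase hi').symm, le_trans ?_ hi, hi'T⟩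
  gcongr
  nlinarith

end PlaceSystem

/-- A number belongs to boundedly many of a sequence of overlapping dyadic ranges. -/
lemma card_dyadic_le {c : ℝ} (hc : 0 < c) {m : ℕ} (hm : 1 ≤ m) (x : ℝ) (n : ℕ) :
    ({t ∈ Finset.range n | 2 ^ t * c / (2 * m ^ 2) ≤ x ∧ x ≤ 2 * (2 ^ t * c)}).card ≤
      2 * m + 3 := by
  rcases ({t ∈ Finset.range n | 2 ^ t * c / (2 * m ^ 2) ≤ x ∧ x ≤ 2 * (2 ^ t * c)} :
    Finset ℕ).eq_empty_or_nonempty with he | hne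
  · rw [he]; simp
  obtain ⟨t₀, ht₀, hmin⟩ := Finset.exists_min_image _ id hne
  have hsub : ({t ∈ Finset.range n | 2 ^ t * c / (2 * m ^ 2) ≤ x ∧ x ≤ 2 * (2 ^ t * c)} :
      Finset ℕ) ⊆ Finset.Icc t₀ (t₀ + (2 * m + 2)) := by
    intro t ht
    refine Finset.mem_Icc.2 ⟨hmin t ht, ?_⟩
    obtain ⟨-, h1, -⟩ := Finset.mem_filter.1 ht
    obtain ⟨-, -, h2⟩ := Finset.mem_filter.1 ht₀
    have hmR : (1 : ℝ) ≤ m := by exact_mod_cast hm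
    have h3 : 2 ^ t * c ≤ 2 * (2 ^ t₀ * c) * (2 * m ^ 2) := by
      rw [← div_le_iff₀ (by positivity)]; exact h1.trans h2
    have hm2 : (m : ℝ) ≤ 2 ^ m := by exact_mod_cast Nat.lt_two_pow_self.le
    have h4 : (2 : ℝ) ^ t * c ≤ 2 ^ (t₀ + (2 * m + 2)) * c := by
      calc _ ≤ 2 * (2 ^ t₀ * c) * (2 * m ^ 2) := h3
        _ ≤ 2 * (2 ^ t₀ * c) * (2 * (2 ^ m) ^ 2) := by gcongr
        _ = _ := by rw [pow_add, pow_add, pow_mul']; ring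
    have h5 := le_of_mul_le_mul_right h4 hc
    exact (pow_le_pow_iff_right₀ (by norm_num : (1 : ℝ) < 2)).1 h5
  refine (Finset.card_le_card hsub).trans ?_
  rw [Nat.card_Icc]
  omega

lemma card_le_of_shortColoring {ρ m C : ℕ} (hm : 4 ≤ m) (hev : Even m)
    (hC : ∀ a, 1 ≤ a → a < m → NondegBound.{u} ρ a C)
    {L : Type u} [Field L] [CharZero L] (hL : HasPlaceSystems L) {G : Subgroup Lˣ}
    (hG : RankLE G ρ) {κ : Type} [Fintype κ] (hκ : Fintype.card κ = m)
    {A : κ → Finset Lˣ} {N : ℕ} (hA : ∀ j, ∀ a ∈ A j, a ∈ G)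
    (hN : ∀ j, (A j).card ≤ N) {F : Finset (κ → Lˣ)}
    (hF : NondegFamily Finset.univ (fun _ => (1 : L)) A F) {Z : Set (κ → Lˣ)} {K : ℕ}
    (hZ : ShortColoring Z K) (hFZ : ∀ z ∈ F, z ∈ Z) {i i' : κ} (hii : i ≠ i') {M : ℕ}
    (hM : (A i).card ≤ M) (hM' : (A i').card ≤ M) :
    F.card ≤ C * C * M * N ^ ((m - 4) / 2) * 2 ^ m * K := by
  classical
  obtain ⟨col, hcol⟩ := hZ
  have := Finset.card_le_mul_card_image_of_maps_to (s := F) (t := Finset.univ) (f := col)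
    (fun z _ => Finset.mem_univ _) (C * C * M * N ^ ((m - 4) / 2) * 2 ^ m) ?_
  · simpa using this
  rintro q -
  rcases ({z ∈ F | col z = q} : Finset _).eq_empty_or_nonempty with he | ⟨y, hy⟩
  · rw [he]; simp
  obtain ⟨hyF, rfl⟩ := Finset.mem_filter.1 hy
  obtain ⟨b, j, hj, hb⟩ := hcol y (hFZ y hyF)
  exact card_le_of_shorter_equation hm hev hC hL hG (Finset.card_univ.trans hκ)
    (fun j _ => hA j) (fun j _ => hN j)
    (hF.subset (Finset.filter_subset _ _) fun z hz => hF.mem z (Finset.mem_filter.1 hz).1)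
    (fun z hz => hb z (hFZ z (Finset.mem_filter.1 hz).1) (Finset.mem_filter.1 hz).2)
    (Finset.mem_univ j) hj (Finset.mem_univ i) (Finset.mem_univ i') hii hM hM'

/-- The dyadic step of the induction, for an even number of variables. -/
lemma card_le_of_dyadic_range {ρ m C : ℕ} (hm : 4 ≤ m) (hev : Even m)
    (hC : ∀ a, 1 ≤ a → a < m → NondegBound.{u} ρ a C)
    {L : Type u} [Field L] [CharZero L] (hL : HasPlaceSystems L) {G : Subgroup Lˣ}
    (hG : RankLE G ρ) {ι : Type*} [Fintype ι] (P : PlaceSystem L G ι) {κ : Type} [Fintype κ]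
    (hκ : Fintype.card κ = m)
    {A : κ → Finset Lˣ} {N : ℕ} (hA : ∀ j, ∀ a ∈ A j, a ∈ G)
    (hN : ∀ j, (A j).card ≤ N) {F : Finset (κ → Lˣ)}
    (hF : NondegFamily Finset.univ (fun _ => (1 : L)) A F) {T : ℝ} {K : ℕ}
    (hT : 8 * m * Real.log m.factorial ≤ T)
    (hZ : ShortColoring {z ∈ unitSolutions G κ | T ≤ P.height z ∧ P.height z ≤ 2 * T} K)
    (hFZ : ∀ z ∈ F, z ∈ unitSolutions G κ ∧ T ≤ P.height z ∧ P.height z ≤ 2 * T) :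
    F.card ≤ C * C * N ^ ((m - 4) / 2) * 2 ^ m * K * (2 * m) *
      ∑ j, ({a ∈ A j | T / (2 * m ^ 2) ≤ ‖P.vec a‖ ∧ ‖P.vec a‖ ≤ 2 * T}).card := by
  classical
  have hnt : Nontrivial κ := Fintype.one_lt_card_iff_nontrivial.1 (by omega)
  set D := C * C * N ^ ((m - 4) / 2) * 2 ^ m * K with hD
  set At : κ → Finset Lˣ := fun j =>
    {a ∈ A j | T / (2 * m ^ 2) ≤ ‖P.vec a‖ ∧ ‖P.vec a‖ ≤ 2 * T} with hAt
  have hAtA : ∀ j, At j ⊆ A j := fun j => Finset.filter_subset _ _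
  let Fp : κ × κ → Finset (κ → Lˣ) := fun p => {z ∈ F | p.1 ≠ p.2 ∧ z p.1 ∈ At p.1 ∧ z p.2 ∈ At p.2}
  have hcover : F ⊆ Finset.univ.biUnion Fp := by
    intro z hz
    obtain ⟨i, i', hii, hi, hi'⟩ := P.exists_two_large hκ (hFZ z hz).1 hT (hFZ z hz).2.1
    have hup : ∀ k, ‖P.vec (z k)‖ ≤ 2 * T := fun k =>
      (P.norm_vec_le_height z k).trans (hFZ z hz).2.2
    have hzA := fun k => hF.mem z hz k (Finset.mem_univ k)
    exact Finset.mem_biUnion.2 ⟨(i, i'), Finset.mem_univ _, Finset.mem_filter.2 ⟨hz, hii,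
      Finset.mem_filter.2 ⟨hzA i, hi, hup i⟩, Finset.mem_filter.2 ⟨hzA i', hi', hup i'⟩⟩⟩
  have hpair : ∀ p : κ × κ, (Fp p).card ≤ D * ((At p.1).card + (At p.2).card) := by
    rintro ⟨i, i'⟩
    rcases (Fp (i, i')).eq_empty_or_nonempty with he | ⟨y, hy⟩
    · rw [he]; simp
    have hii : i ≠ i' := (Finset.mem_filter.1 hy).2.1
    have := card_le_of_shortColoring hm hev hC hL hG hκ (K := K) (N := N) (F := Fp (i, i'))
      (A := fun k => if k = i ∨ k = i' then At k else A k) (M := (At i).card + (At i').card)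
      (fun j a ha => hA j a (by split_ifs at ha; exacts [hAtA j ha, ha]))
      (fun j => by
        split_ifs
        exacts [(Finset.card_le_card (hAtA j)).trans (hN j), hN j])
      (hF.subset (Finset.filter_subset _ _) fun z hz j _ => by
        obtain ⟨hz, -, h1, h2⟩ := Finset.mem_filter.1 hz
        split_ifs with h
        · rcases h with rfl | rfl
          exacts [h1, h2]
        · exact hF.mem z hz j (Finset.mem_univ j))
      hZ (fun z hz => hFZ z (Finset.mem_filter.1 hz).1) hii (by simp) (by simp)
    refine this.trans (le_of_eq ?_)
    rw [hD]
    ring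
  calc F.card ≤ (Finset.univ.biUnion Fp).card := Finset.card_le_card hcover
    _ ≤ ∑ p, (Fp p).card := Finset.card_biUnion_le
    _ ≤ ∑ p : κ × κ, D * ((At p.1).card + (At p.2).card) := Finset.sum_le_sum fun p _ => hpair p
    _ = D * (2 * m) * ∑ j, (At j).card := by
      rw [← Finset.mul_sum, Fintype.sum_prod_type]
      simp only [Finset.sum_add_distrib, Finset.sum_const, Finset.card_univ, hκ, smul_eq_mul,
        ← Finset.mul_sum]
      ring

lemma exists_nondegBoundUniv_even {ρ m C : ℕ} (hm : 4 ≤ m) (hev : Even m)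
    (hC : ∀ a, 1 ≤ a → a < m → NondegBound.{u} ρ a C) : ∃ C', NondegBoundUniv.{u} ρ m C' := by
  classical
  obtain ⟨K, c, hc1, hcm, hK⟩ := PlaceSystem.exists_shortColoring.{u, u} ρ m
  refine ⟨C * C * 2 ^ m * K * (1 + 2 * m * (m * (2 * m + 3))), ?_⟩
  intro L _ _ hL G hG κ _ hκ A N hA hN F hF
  have hnt : Nontrivial κ := Fintype.one_lt_card_iff_nontrivial.1 (by omega)
  obtain ⟨ι, _, ⟨P⟩⟩ := hL (Finset.univ.biUnion A)
  set G' := Subgroup.closure ((Finset.univ.biUnion A : Finset Lˣ) : Set Lˣ) with hG'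
  have hAG' : ∀ j, ∀ a ∈ A j, a ∈ G' := fun j a ha =>
    Subgroup.subset_closure (by simpa using ⟨j, ha⟩)
  have hG'G : RankLE G' ρ := hG.mono ((Subgroup.closure_le _).2 fun a ha => by
    obtain ⟨j, hj⟩ : ∃ j, a ∈ A j := by simpa using ha
    exact hA j a hj) le_rfl
  obtain ⟨hsmall, hlarge⟩ := hK P hG'G κ hκ
  have hsol : ∀ z ∈ F, z ∈ unitSolutions G' κ := fun z hz =>
    ⟨fun j => hAG' j _ (hF.mem z hz j (Finset.mem_univ j)), by simpa using hF.sum z hz⟩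
  set E := N ^ ((m - 4) / 2) with hE
  have hsub : ∀ (p : (κ → Lˣ) → Prop) [DecidablePred p],
      NondegFamily Finset.univ (fun _ => (1 : L)) A {z ∈ F | p z} := fun p =>
    hF.subset (Finset.filter_subset _ _) fun z hz =>
    hF.mem z (Finset.mem_filter.1 hz).1
  have h1 : ({z ∈ F | P.height z ≤ c} : Finset _).card ≤ C * C * N * E * 2 ^ m * K := by
    obtain ⟨i, i', hii⟩ := exists_pair_ne κ
    exact card_le_of_shortColoring hm hev hC hL hG'G hκ hAG' hN (hsub _) hsmall
      (fun z hz => ⟨hsol z (Finset.mem_filter.1 hz).1, (Finset.mem_filter.1 hz).2⟩) hii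
      (hN i) (hN i')
  obtain ⟨n, hn⟩ : ∃ n : ℕ, ∀ z ∈ F, P.height z < 2 ^ n * c := by
    obtain ⟨n, hn⟩ := pow_unbounded_of_one_lt (∑ z ∈ F, P.height z) (by norm_num : (1 : ℝ) < 2)
    refine ⟨n, fun z hz => ?_⟩
    have := Finset.single_le_sum (f := P.height) (fun z _ => P.height_nonneg z) hz
    have h2 : (0 : ℝ) < 2 ^ n := by positivity
    nlinarith
  have hcov : ({z ∈ F | ¬ P.height z ≤ c} : Finset _) ⊆ (Finset.range n).biUnion fun t =>
      {z ∈ F | 2 ^ t * c ≤ P.height z ∧ P.height z ≤ 2 * (2 ^ t * c)} := by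
    intro z hz
    obtain ⟨hz, hzc⟩ := Finset.mem_filter.1 hz
    rw [not_le] at hzc
    obtain ⟨t, ht1, ht2⟩ := exists_nat_pow_near (x := P.height z / c) (y := 2)
      ((one_le_div (by linarith)).2 hzc.le) (by norm_num)
    rw [le_div_iff₀ (by linarith)] at ht1
    rw [div_lt_iff₀ (by linarith), pow_succ] at ht2
    refine Finset.mem_biUnion.2 ⟨t, Finset.mem_range.2 ?_, Finset.mem_filter.2 ⟨hz, ht1, by
      linarith⟩⟩
    have h3 := lt_of_mul_lt_mul_right (ht1.trans_lt (hn z hz)) (by linarith)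
    exact (pow_lt_pow_iff_right₀ (by norm_num : (1 : ℝ) < 2)).1 h3
  have h2 : ({z ∈ F | ¬ P.height z ≤ c} : Finset _).card ≤
      C * C * E * 2 ^ m * K * (2 * m) * (m * (N * (2 * m + 3))) := by
    calc _ ≤ _ := (Finset.card_le_card hcov).trans Finset.card_biUnion_le
      _ ≤ ∑ t ∈ Finset.range n, C * C * E * 2 ^ m * K * (2 * m) *
          ∑ j, ({a ∈ A j | 2 ^ t * c / (2 * m ^ 2) ≤ ‖P.vec a‖ ∧
            ‖P.vec a‖ ≤ 2 * (2 ^ t * c)}).card := by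
        refine Finset.sum_le_sum fun t _ => ?_
        have hct : c ≤ 2 ^ t * c :=
          le_mul_of_one_le_left (by linarith) (one_le_pow₀ (by norm_num))
        exact card_le_of_dyadic_range hm hev hC hL hG'G P hκ hAG' hN (hsub _) (hcm.trans hct)
          (hlarge _ hct) fun z hz =>
          ⟨hsol z (Finset.mem_filter.1 hz).1, (Finset.mem_filter.1 hz).2⟩
      _ = C * C * E * 2 ^ m * K * (2 * m) * ∑ j, ∑ a ∈ A j, ({t ∈ Finset.range n |
          2 ^ t * c / (2 * m ^ 2) ≤ ‖P.vec a‖ ∧ ‖P.vec a‖ ≤ 2 * (2 ^ t * c)}).card := by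
        rw [← Finset.mul_sum, Finset.sum_comm]
        congr 1
        refine Finset.sum_congr rfl fun j _ => ?_
        simp only [Finset.card_filter]
        rw [Finset.sum_comm]
      _ ≤ C * C * E * 2 ^ m * K * (2 * m) * ∑ _j : κ, N * (2 * m + 3) := by
        gcongr with j _
        calc _ ≤ ∑ _a ∈ A j, (2 * m + 3) := Finset.sum_le_sum fun a _ =>
              card_dyadic_le (by linarith) (by omega) _ n
          _ ≤ N * (2 * m + 3) := by
            rw [Finset.sum_const, smul_eq_mul]
            exact Nat.mul_le_mul_right _ (hN j)
      _ = _ := by simp [hκ]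
  rw [← Finset.card_filter_add_card_filter_not (s := F) (fun z => P.height z ≤ c)]
  refine (add_le_add h1 h2).trans (le_of_eq ?_)
  rw [show (m - 1) / 2 = (m - 4) / 2 + 1 by obtain ⟨k, hk⟩ := hev; omega, pow_succ]
  ring

/-- Nondegenerate solutions of a linear equation in `m` variables: the main counting bound. -/
theorem exists_nondegBound (m : ℕ) (hm : 1 ≤ m) : ∀ ρ, ∃ C, NondegBound.{u} ρ m C := by
  classical
  induction m using Nat.strong_induction_on with
  | _ m ih =>
  intro ρ
  by_cases h1 : m = 1
  · subst h1
    refine ⟨1, NondegBoundUniv.nondegBound ?_⟩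
    intro L _ _ hL G hG κ _ hκ A N hA hN F hF
    obtain ⟨i, hi⟩ := Fintype.card_eq_one_iff.1 hκ
    have : Unique κ := ⟨⟨i⟩, hi⟩
    simp only [Nat.sub_self, Nat.zero_div, pow_zero, mul_one]
    refine Finset.card_le_one.2 fun z hz z' hz' => ?_
    have e1 := hF.sum z hz
    have e2 := hF.sum z' hz'
    rw [Fintype.sum_unique, one_mul] at e1 e2
    funext j
    rw [Subsingleton.elim j default]
    exact Units.ext (e1.trans e2.symm)
  by_cases h2 : m = 2
  · subst h2
    obtain ⟨K, hK⟩ := PlaceSystem.exists_card_two_le.{u, u} (ρ + 2)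
    refine ⟨K, NondegBoundUniv.nondegBound ?_⟩
    intro L _ _ hL G hG κ _ hκ A N hA hN F hF
    obtain ⟨ι, _, ⟨P⟩⟩ := hL (Finset.univ.biUnion A)
    have := hK P (hG.mono ((Subgroup.closure_le _).2 fun a ha => by
      obtain ⟨j, hj⟩ : ∃ j, a ∈ A j := by simpa using ha
      exact hA j a hj) le_rfl) κ hκ F fun z hz => ⟨fun j => Subgroup.subset_closure (by
        simpa using ⟨j, hF.mem z hz j (Finset.mem_univ j)⟩), by simpa using hF.sum z hz⟩
    simpa using this
  rcases Nat.even_or_odd m with hev | hodd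
  · have : ∀ a, ∃ C, 1 ≤ a → a < m → NondegBound.{u} (ρ + m) a C := fun a => by
      by_cases ha : 1 ≤ a ∧ a < m
      · obtain ⟨C, hC⟩ := ih a ha.2 ha.1 (ρ + m)
        exact ⟨C, fun _ _ => hC⟩
      · exact ⟨0, fun h h' => absurd ⟨h, h'⟩ ha⟩
    choose C hC using this
    obtain ⟨C', hC'⟩ := exists_nondegBoundUniv_even (ρ := ρ + m) (C := ∑ a ∈ Finset.range m, C a)
      (by obtain ⟨k, hk⟩ := hev; omega) hev fun a h1 h2 => (hC a h1 h2).mono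
        (Finset.single_le_sum (f := C) (fun _ _ => Nat.zero_le _) (Finset.mem_range.2 h2))
    exact ⟨C', hC'.nondegBound⟩
  · obtain ⟨C, hC⟩ := ih (m - 1) (by omega) (by omega) ρ
    refine ⟨C, ?_⟩
    intro L _ _ hL G hG κ s hs b A N hA hN F hF
    obtain ⟨i, hi⟩ := Finset.card_pos.1 (hs.symm ▸ hm)
    refine (hC.card_le_mul (by omega) hL hG hs hA hN hF hi).trans ?_
    obtain ⟨k, hk⟩ := hodd
    rw [show (m - 1) / 2 = (m - 2) / 2 + 1 by omega, pow_succ]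
    calc _ ≤ N * (C * N ^ ((m - 2) / 2)) := Nat.mul_le_mul_right _ (hN i hi)
      _ = _ := by ring

section NumberField

open NumberField

lemma AbsoluteValue.map_intCast_le {L : Type*} [Field L] (w : AbsoluteValue L ℝ) (n : ℤ) :
    w n ≤ |(n : ℝ)| := by
  have hnat : ∀ k : ℕ, w k ≤ k := by
    intro k
    induction k with
    | zero => simp
    | succ k ih =>
      push_cast
      exact (w.add_le _ _).trans (by simpa using ih)
  obtain ⟨k, rfl | rfl⟩ := n.eq_nat_or_neg
  · simpa using hnat k
  · simpa using hnat k

lemma AbsoluteValue.exists_log_sum_le {L σ : Type*} [Field L] (w : AbsoluteValue L ℝ)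
    (s : Finset σ) (n : σ → ℤ) (a : σ → L) (ha : ∀ i ∈ s, a i ≠ 0)
    (h0 : ∑ i ∈ s, (n i : L) * a i ≠ 0) :
    ∃ i ∈ s, Real.log (w (∑ i ∈ s, (n i : L) * a i)) ≤
      Real.log (∑ i ∈ s, |(n i : ℝ)|) + Real.log (w (a i)) := by
  have hne : s.Nonempty := Finset.nonempty_of_sum_ne_zero h0
  obtain ⟨i, hi, hmax⟩ := Finset.exists_max_image s (fun i => w (a i)) hne
  have hwi : 0 < w (a i) := w.pos (ha i hi)
  have hle : w (∑ i ∈ s, (n i : L) * a i) ≤ (∑ i ∈ s, |(n i : ℝ)|) * w (a i) := by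
    rw [Finset.sum_mul]
    refine (w.sum_le _ _).trans (Finset.sum_le_sum fun j hj => ?_)
    rw [w.map_mul]
    exact mul_le_mul (w.map_intCast_le _) (hmax j hj) (w.nonneg _) (abs_nonneg _)
  have hpos := w.pos h0
  have hs : (∑ i ∈ s, |(n i : ℝ)|) ≠ 0 := fun h => by
    rw [h, zero_mul] at hle
    linarith
  refine ⟨i, hi, ?_⟩
  rw [← Real.log_mul hs hwi.ne']
  exact Real.log_le_log hpos hle

lemma AbsoluteValue.exists_log_sum_le_of_isNonarchimedean {L σ : Type*} [Field L]
    {w : AbsoluteValue L ℝ} (hw : IsNonarchimedean w)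
    (s : Finset σ) (n : σ → ℤ) (a : σ → L) (h0 : ∑ i ∈ s, (n i : L) * a i ≠ 0) :
    ∃ i ∈ s, Real.log (w (∑ i ∈ s, (n i : L) * a i)) ≤ Real.log (w (a i)) := by
  have hne : s.Nonempty := Finset.nonempty_of_sum_ne_zero h0
  obtain ⟨i, hi, hmax⟩ := hw.finset_image_add_of_nonempty (fun i => (n i : L) * a i) hne
  refine ⟨i, hi, Real.log_le_log (w.pos h0) (hmax.trans ?_)⟩
  rw [w.map_mul]
  exact mul_le_of_le_one_left (w.nonneg _) hw.apply_intCast_le_one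

lemma AbsoluteValue.exists_log_frob_le {L σ : Type*} [Field L] (w : AbsoluteValue L ℝ)
    (s : Finset σ) (t : σ → L) (p : ℕ) (β : L) (hp : p ≠ 0) (hwp : w p = p)
    (ht : ∀ i ∈ s, t i ≠ 0) (hβ : ∑ i ∈ s, t i ^ p = p * β) (hβ0 : β ≠ 0) :
    ∃ i ∈ s, Real.log (w β) ≤
      (Real.log s.card - Real.log p) + p * Real.log (w (t i)) := by
  have hp0 : (p : L) ≠ 0 := fun h => by
    rw [h, w.map_zero] at hwp
    exact hp (by exact_mod_cast hwp.symm)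
  obtain ⟨i, hi, h⟩ := w.exists_log_sum_le s (fun _ => 1) (fun i => t i ^ p)
    (fun i hi => pow_ne_zero _ (ht i hi)) (by simpa [hβ] using ⟨hp0, hβ0⟩)
  refine ⟨i, hi, ?_⟩
  simp only [Int.cast_one, one_mul, hβ, map_mul, hwp, map_pow, Real.log_pow, abs_one,
    Finset.sum_const, nsmul_eq_mul, mul_one] at h
  rw [Real.log_mul (by exact_mod_cast hp) (w.pos hβ0).ne'] at h
  linarith

lemma AbsoluteValue.exists_log_frob_le_of_isNonarchimedean {L σ : Type*} [Field L] [CharZero L]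
    {w : AbsoluteValue L ℝ} (hw : IsNonarchimedean w)
    (s : Finset σ) (t : σ → L) (p : ℕ) (β : L) (hp : p.Prime) (ht : ∀ i ∈ s, t i ≠ 0)
    (h0 : ∑ i ∈ s, t i = 0) (hβ : ∑ i ∈ s, t i ^ p = p * β) (hβ0 : β ≠ 0) :
    ∃ i ∈ s, Real.log (w β) ≤ p * Real.log (w (t i)) := by
  have hp0 : (p : L) ≠ 0 := by exact_mod_cast hp.ne_zero
  have hne : s.Nonempty :=
    Finset.nonempty_of_sum_ne_zero (f := fun i => t i ^ p) (by
      rw [hβ]; exact mul_ne_zero hp0 hβ0)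
  obtain ⟨i, hi, hmax⟩ := Finset.exists_max_image s (fun i => w (t i)) hne
  have hti := ht i hi
  have hwi : 0 < w (t i) := w.pos hti
  let O : Subring L :=
    { carrier := {x | w x ≤ 1}
      mul_mem' := fun {a b} ha hb => by
        simp only [Set.mem_ofPred_eq, map_mul] at *
        exact mul_le_one₀ ha (w.nonneg _) hb
      one_mem' := by simp
      add_mem' := fun {a b} ha hb => (hw a b).trans (max_le ha hb)
      zero_mem' := by simp
      neg_mem' := fun {a} ha => by simpa using ha }
  have hmem : ∀ j ∈ s, t j / t i ∈ O := fun j hj => by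
    change w (t j / t i) ≤ 1
    rw [map_div₀]
    exact div_le_one_of_le₀ (hmax j hj) hwi.le
  obtain ⟨r, hr⟩ := exists_sum_pow_prime_eq hp s.attach
    (fun j => (⟨t j / t i, hmem j j.2⟩ : O))
  have hr' := congrArg Subtype.val hr
  simp only [Subring.coe_pow, AddSubmonoidClass.coe_finsetSum, Subring.coe_add, Subring.coe_mul,
    Subring.coe_natCast, Finset.sum_attach s fun j => t j / t i,
    Finset.sum_attach s fun j => t j ^ p, ← Finset.sum_div, h0, zero_div,
    zero_pow hp.ne_zero, div_pow, hβ] at hr'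
  have hβr : β = -(r : L) * t i ^ p := by
    have h1 : (p : L) * (β / t i ^ p + r) = 0 := by rw [hr']; ring
    have h2 : β / t i ^ p = -r := by
      linear_combination (mul_eq_zero.1 h1).resolve_left hp0
    rw [← h2, div_mul_cancel₀ _ (pow_ne_zero _ hti)]
  refine ⟨i, hi, ?_⟩
  rw [← Real.log_pow, ← map_pow]
  refine Real.log_le_log (w.pos hβ0) ?_
  rw [hβr, map_mul, map_neg_eq_map]
  exact mul_le_of_le_one_left (w.nonneg _) r.2

variable {L : Type u} [Field L] [NumberField L]

lemma finitePlace_eq_one_of_mem_closure {B : Finset Lˣ} {w : FinitePlace L}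
    (hw : ∀ b ∈ B, w (b : L) = 1) {x : Lˣ} (hx : x ∈ Subgroup.closure (B : Set Lˣ)) :
    w (x : L) = 1 := by
  induction hx using Subgroup.closure_induction with
  | mem x hx => exact hw x hx
  | one => simp
  | mul x y _ _ hx hy => simp [hx, hy]
  | inv x _ hx => simp [hx]

lemma finitePlace_le_one_of_mem_closure {B : Finset Lˣ} {w : FinitePlace L}
    (hw : ∀ b ∈ B, w (b : L) = 1) {α : L}
    (hα : α ∈ Subring.closure {x : L | ∃ u ∈ Subgroup.closure (B : Set Lˣ), (u : L) = x}) :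
    w α ≤ 1 := by
  induction hα using Subring.closure_induction with
  | mem x hx =>
    obtain ⟨u, hu, rfl⟩ := hx
    exact (finitePlace_eq_one_of_mem_closure hw hu).le
  | zero => simp
  | one => simp
  | add x y _ _ hx hy => exact (FinitePlace.add_le w x y).trans (max_le hx hy)
  | neg x _ hx => simpa using hx
  | mul x y _ _ hx hy =>
    rw [map_mul]
    exact mul_le_one₀ hx (apply_nonneg w y) hy

lemma log_prod_formula {x : L} (hx : x ≠ 0) {T : Finset (FinitePlace L)}
    (hT : ∀ w : FinitePlace L, w x ≠ 1 → w ∈ T) :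
    ∑ w : InfinitePlace L, w.mult * Real.log (w x) + ∑ w ∈ T, Real.log (w x) = 0 := by
  have h := prod_abs_eq_one hx
  rw [finprod_eq_prod_of_mulSupport_subset (s := T) _ (fun w hw => hT w hw)] at h
  have h1 : ∀ w ∈ (Finset.univ : Finset (InfinitePlace L)), w x ^ w.mult ≠ 0 := fun w _ =>
    pow_ne_zero _ (w.pos_iff.2 hx).ne'
  have h2 : ∀ w ∈ T, w x ≠ 0 := fun w _ => (FinitePlace.pos_iff.2 hx).ne'
  have h3 := congrArg Real.log h
  rw [Real.log_mul (Finset.prod_ne_zero_iff.2 h1) (Finset.prod_ne_zero_iff.2 h2),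
    Real.log_prod h1, Real.log_prod h2, Real.log_one] at h3
  simpa [Real.log_pow] using h3

variable (L) in
/-- In a number field, every finitely generated group of units admits a place system. -/
theorem hasPlaceSystems_of_numberField : HasPlaceSystems L := by
  classical
  intro B
  let T : Finset (FinitePlace L) :=
    B.biUnion fun b => (FinitePlace.hasFiniteMulSupport b.ne_zero).toFinset
  have hT : ∀ w ∉ T, ∀ b ∈ B, w (b : L) = 1 := by
    intro w hw b hb
    by_contra h
    exact hw (Finset.mem_biUnion.2 ⟨b, hb, (Set.Finite.mem_toFinset _).2 h⟩)
  obtain ⟨D, hD⟩ : ∃ D : ℝ, D = (Module.finrank ℚ L : ℕ) := ⟨_, rfl⟩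
  have hD0 : 0 < D := by
    rw [hD]
    exact_mod_cast Module.finrank_pos
  let lg : InfinitePlace L ⊕ T → L → ℝ := Sum.elim
    (fun w x => w.mult / D * Real.log (w x)) (fun w x => 1 / D * Real.log (w.1 x))
  have hlg : ∀ x, ∑ v, lg v x = 1 / D * (∑ w : InfinitePlace L, w.mult * Real.log (w x) +
      ∑ w ∈ T, Real.log (w x)) := by
    intro x
    rw [Fintype.sum_sum_type, mul_add, Finset.mul_sum, Finset.mul_sum, ← Finset.sum_coe_sort T]
    congr 1
    refine Finset.sum_congr rfl fun w _ => ?_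
    simp only [lg, Sum.elim_inl]
    ring
  have hna : ∀ w : FinitePlace L, IsNonarchimedean w.val := fun w x y => FinitePlace.add_le w x y
  refine ⟨InfinitePlace L ⊕ T, inferInstance, ⟨{
    lg := lg
    wt := Sum.elim (fun w => w.mult / D) (fun _ => 0)
    wt_nonneg := ?_
    wt_sum := ?_
    lg_mul := ?_
    lg_sum := ?_
    lg_frob := ?_
    sum_unit := ?_
    sum_nonneg := ?_ }⟩⟩
  · rintro (w | w)
    · exact div_nonneg (Nat.cast_nonneg _) hD0.le
    · exact le_rfl
  · rw [Fintype.sum_sum_type]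
    simp only [Sum.elim_inl, Sum.elim_inr, Finset.sum_const_zero, add_zero]
    rw [← Finset.sum_div, ← Nat.cast_sum, InfinitePlace.sum_mult_eq, ← hD, div_self hD0.ne']
  · rintro (w | w) x y hx hy
    · simp only [lg, Sum.elim_inl, map_mul]
      rw [Real.log_mul (w.pos_iff.2 hx).ne' (w.pos_iff.2 hy).ne', mul_add]
    · simp only [lg, Sum.elim_inr, map_mul]
      rw [Real.log_mul (FinitePlace.pos_iff.2 hx).ne' (FinitePlace.pos_iff.2 hy).ne', mul_add]
  · rintro (w | w) σ s n a ha h0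
    · obtain ⟨i, hi, h⟩ := w.val.exists_log_sum_le s n a ha h0
      refine ⟨i, hi, ?_⟩
      simp only [lg, Sum.elim_inl]
      rw [← mul_add]
      exact mul_le_mul_of_nonneg_left h (div_nonneg (Nat.cast_nonneg _) hD0.le)
    · obtain ⟨i, hi, h⟩ := AbsoluteValue.exists_log_sum_le_of_isNonarchimedean (hna w.1) s n a h0
      refine ⟨i, hi, ?_⟩
      simp only [lg, Sum.elim_inr, zero_mul, zero_add]
      exact mul_le_mul_of_nonneg_left h (by positivity)
  · rintro (w | w) σ s t p β hp ht h0 hβ hβ0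
    · obtain ⟨i, hi, h⟩ := w.val.exists_log_frob_le s t p β hp.ne_zero
        (by
          change w (p : L) = p
          rw [← InfinitePlace.norm_embedding_eq, map_natCast]
          simp) ht hβ hβ0
      refine ⟨i, hi, ?_⟩
      simp only [lg, Sum.elim_inl]
      rw [mul_left_comm, ← mul_add]
      exact mul_le_mul_of_nonneg_left h (div_nonneg (Nat.cast_nonneg _) hD0.le)
    · obtain ⟨i, hi, h⟩ := AbsoluteValue.exists_log_frob_le_of_isNonarchimedean (hna w.1)
        s t p β hp ht h0 hβ hβ0
      refine ⟨i, hi, ?_⟩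
      simp only [lg, Sum.elim_inr, zero_mul, zero_add]
      rw [mul_left_comm]
      exact mul_le_mul_of_nonneg_left h (by positivity)
  · intro u hu
    rw [hlg, log_prod_formula u.ne_zero, mul_zero]
    intro w hw
    by_contra h
    exact hw (finitePlace_eq_one_of_mem_closure (hT w h) hu)
  · intro α hα hα0
    rw [hlg]
    refine mul_nonneg (by positivity) ?_
    have hfin := log_prod_formula hα0
      (T := T ∪ (FinitePlace.hasFiniteMulSupport hα0).toFinset \ T) (fun w hw => by
        by_cases h : w ∈ T
        · exact Finset.mem_union_left _ h
        · exact Finset.mem_union_right _ (Finset.mem_sdiff.2 ⟨(Set.Finite.mem_toFinset _).2 hw, h⟩))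
    rw [Finset.sum_union Finset.disjoint_sdiff] at hfin
    have : ∑ w ∈ (FinitePlace.hasFiniteMulSupport hα0).toFinset \ T, Real.log (w α) ≤ 0 :=
      Finset.sum_nonpos fun w hw => Real.log_nonpos (apply_nonneg w α)
        (finitePlace_le_one_of_mem_closure (hT w (Finset.mem_sdiff.1 hw).2) hα)
    linarith

end NumberField

lemma exists_minimal_subsum {L κ : Type*} [Field L] [DecidableEq κ] {s : Finset κ} {f : κ → L}
    (h : ∑ j ∈ s, f j = 1) : ∃ I ⊆ s, I.Nonempty ∧ ∑ j ∈ I, f j = 1 ∧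
      ∀ t ⊆ I, t.Nonempty → ∑ j ∈ t, f j ≠ 0 := by
  classical
  obtain ⟨I, hI, hmin⟩ := Finset.exists_min_image {I ∈ s.powerset | ∑ j ∈ I, f j = 1} Finset.card
    ⟨s, Finset.mem_filter.2 ⟨Finset.mem_powerset_self s, h⟩⟩
  obtain ⟨hIs, hI1⟩ := Finset.mem_filter.1 hI
  rw [Finset.mem_powerset] at hIs
  refine ⟨I, hIs, Finset.nonempty_of_sum_ne_zero (by rw [hI1]; exact one_ne_zero), hI1,
    fun t ht hne h0 => ?_⟩
  have h1 := Finset.sum_sdiff (f := f) ht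
  rw [h0, add_zero, hI1] at h1
  have := hmin (I \ t) (Finset.mem_filter.2
    ⟨Finset.mem_powerset.2 (Finset.sdiff_subset.trans hIs), h1⟩)
  rw [Finset.card_sdiff_of_subset ht] at this
  have := Finset.card_pos.2 hne
  have := Finset.card_le_card ht
  omega

/-- A finite family of solutions of `∑ j ∈ s, b j * z j = d` with `z j ∈ A`, each determined by
its coordinates in `s`. -/
structure SolutionFamily {L κ : Type*} [Field L] (s : Finset κ) (b : κ → L) (A : Finset Lˣ)
    (d : L) (F : Finset (κ → Lˣ)) : Prop where
  mem : ∀ z ∈ F, ∀ j ∈ s, z j ∈ A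
  sum : ∀ z ∈ F, ∑ j ∈ s, b j * (z j : L) = d
  inj : ∀ z ∈ F, ∀ z' ∈ F, (∀ j ∈ s, z j = z' j) → z = z'

/-- Fixing the coordinates in `I` leaves a solution family in the remaining ones. -/
lemma SolutionFamily.fiber {L κ : Type*} [Field L] [DecidableEq κ] {s : Finset κ} {b : κ → L}
    {A : Finset Lˣ} {d : L} {F : Finset (κ → Lˣ)} (hF : SolutionFamily s b A d F) {I : Finset κ}
    (hI : I ⊆ s) (y : κ → Lˣ) {F' : Finset (κ → Lˣ)} (hF' : F' ⊆ F)
    (hF'y : ∀ z ∈ F', ∀ j ∈ I, z j = y j) :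
    SolutionFamily (s \ I) b A (d - ∑ j ∈ I, b j * (y j : L)) F' := by
  refine ⟨fun z hz j hj => hF.mem z (hF' hz) j (Finset.mem_sdiff.1 hj).1, fun z hz => ?_,
    fun z hz z' hz' h => ?_⟩
  · have h : ∑ j ∈ I, b j * (y j : L) = ∑ j ∈ I, b j * (z j : L) :=
      Finset.sum_congr rfl fun j hj => by rw [hF'y z hz j hj]
    rw [← hF.sum z (hF' hz), ← Finset.sum_sdiff hI, h, add_sub_cancel_right]
  · refine hF.inj z (hF' hz) z' (hF' hz') fun j hj => ?_
    by_cases hjI : j ∈ I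
    · rw [hF'y z hz j hjI, hF'y z' hz' j hjI]
    · exact h j (Finset.mem_sdiff.2 ⟨hj, hjI⟩)

/-- Uniform bound for the number of solutions of a linear equation in `k` variables from a finite
subset of a group of rank `ρ`. -/
def LinearBound (ρ k C : ℕ) : Prop :=
  ∀ (L : Type u) [Field L] [CharZero L], HasPlaceSystems L → ∀ G : Subgroup Lˣ, RankLE G ρ →
    ∀ (κ : Type) (s : Finset κ), s.card = k → ∀ (b : κ → L), (∀ j ∈ s, b j ≠ 0) →
    ∀ A : Finset Lˣ, (∀ a ∈ A, a ∈ G) → ∀ (d : L) (F : Finset (κ → Lˣ)),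
    SolutionFamily s b A d F →
    (d = 0 → F.card ≤ C * A.card ^ (k / 2)) ∧ (d ≠ 0 → F.card ≤ C * A.card ^ ((k - 1) / 2))

lemma LinearBound.mono {ρ k C C' : ℕ} (h : LinearBound.{u} ρ k C) (hC : C ≤ C') :
    LinearBound.{u} ρ k C' := by
  intro L _ _ hL G hG κ s hs b hb A hA d F hF
  obtain ⟨h1, h2⟩ := h L hL G hG κ s hs b hb A hA d F hF
  exact ⟨fun h => (h1 h).trans (Nat.mul_le_mul_right _ hC),
    fun h => (h2 h).trans (Nat.mul_le_mul_right _ hC)⟩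

section LinearBound

variable {L : Type u} [Field L] [CharZero L] {G : Subgroup Lˣ} {ρ k C : ℕ} {κ : Type}
  {s : Finset κ} {b : κ → L} {A : Finset Lˣ} {d : L} {F : Finset (κ → Lˣ)}

lemma SolutionFamily.card_le_of_eq_zero (hC : LinearBound.{u} ρ (k - 1) C)
    (hL : HasPlaceSystems L) (hG : RankLE G ρ) (hs : s.card = k) (hk : 1 ≤ k)
    (hb : ∀ j ∈ s, b j ≠ 0) (hA : ∀ a ∈ A, a ∈ G) (hF : SolutionFamily s b A 0 F) :
    F.card ≤ C * A.card ^ (k / 2) := by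
  classical
  rcases hk.eq_or_lt with rfl | hk2
  · obtain ⟨i, rfl⟩ := Finset.card_eq_one.1 hs
    have : F = ∅ := Finset.eq_empty_of_forall_notMem fun z hz => by
      have := hF.sum z hz
      simp [hb] at this
    simp [this]
  obtain ⟨i, hi⟩ := Finset.card_pos.1 (hs.symm ▸ hk)
  rw [show k / 2 = (k - 1 - 1) / 2 + 1 by omega, pow_succ, ← mul_assoc]
  refine Finset.card_le_mul_card_image_of_maps_to (f := fun z => z i) (fun z hz => hF.mem z hz i hi)
    _ fun a _ => ?_
  have h := hC L hL G hG κ (s \ {i}) (by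
      rw [Finset.card_sdiff_of_subset (by simpa using hi), hs]; simp)
    b (fun j hj => hb j (Finset.mem_sdiff.1 hj).1) A hA _ {z ∈ F | z i = a}
    (hF.fiber (I := {i}) (by simpa using hi) (fun _ => a) (Finset.filter_subset _ _)
      fun z hz j hj => by rw [Finset.mem_singleton.1 hj, (Finset.mem_filter.1 hz).2])
  exact h.2 (by simp [hb i hi])

lemma SolutionFamily.card_le_of_ne_zero {C' : ℕ} (hC : ∀ a < k, LinearBound.{u} ρ a C)
    (hC' : ∀ m, 1 ≤ m → m ≤ k → NondegBound.{u} ρ m C')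
    (hL : HasPlaceSystems L) (hG : RankLE G ρ) (hs : s.card = k) (hd : d ≠ 0)
    (hb : ∀ j ∈ s, b j ≠ 0) (hA : ∀ a ∈ A, a ∈ G) (hF : SolutionFamily s b A d F) :
    F.card ≤ 2 ^ k * (C * C') * A.card ^ ((k - 1) / 2) := by
  classical
  rcases F.eq_empty_or_nonempty with rfl | ⟨z₀, hz₀⟩
  · simp
  have hsum : ∀ z ∈ F, ∑ j ∈ s, (d⁻¹ * b j) * (z j : L) = 1 := fun z hz => by
    simp only [mul_assoc]
    rw [← Finset.mul_sum, hF.sum z hz, inv_mul_cancel₀ hd]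
  have hcov : F ⊆ s.powerset.biUnion fun I => {z ∈ F | I.Nonempty ∧
      ∑ j ∈ I, (d⁻¹ * b j) * (z j : L) = 1 ∧
      ∀ t ⊆ I, t.Nonempty → ∑ j ∈ t, (d⁻¹ * b j) * (z j : L) ≠ 0} := by
    intro z hz
    obtain ⟨I, hI, h⟩ := exists_minimal_subsum (hsum z hz)
    exact Finset.mem_biUnion.2 ⟨I, Finset.mem_powerset.2 hI, Finset.mem_filter.2 ⟨hz, h⟩⟩
  refine (Finset.card_le_card hcov).trans (Finset.card_biUnion_le.trans ?_)
  rw [← hs, mul_assoc, ← Finset.card_powerset, ← smul_eq_mul]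
  refine Finset.sum_le_card_nsmul _ _ _ fun I hI => ?_
  rw [Finset.mem_powerset] at hI
  set F' := {z ∈ F | I.Nonempty ∧ ∑ j ∈ I, (d⁻¹ * b j) * (z j : L) = 1 ∧
      ∀ t ⊆ I, t.Nonempty → ∑ j ∈ t, (d⁻¹ * b j) * (z j : L) ≠ 0} with hF'
  have hF'F : F' ⊆ F := Finset.filter_subset _ _
  rcases F'.eq_empty_or_nonempty with he | ⟨z₁, hz₁⟩
  · simp [he]
  have hIne : I.Nonempty := (Finset.mem_filter.1 hz₁).2.1
  obtain ⟨i, hi⟩ := hIne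
  have hI1 : 1 ≤ I.card := Finset.card_pos.2 ⟨i, hi⟩
  have hIk : I.card ≤ s.card := Finset.card_le_card hI
  have hA1 : 1 ≤ A.card := Finset.card_pos.2 ⟨_, hF.mem z₀ hz₀ i (hI hi)⟩
  have him := hC' I.card hI1 (hIk.trans hs.le) L hL G hG κ I rfl (fun j => d⁻¹ * b j)
    (fun _ => A) A.card (fun _ _ => hA) (fun _ _ => le_rfl) (F'.image (maskOutside I))
    (nondegFamily_image (fun z hz j hj => hF.mem z (hF'F hz) j (hI hj))
      (fun z hz => (Finset.mem_filter.1 hz).2.2.1) (fun z hz => (Finset.mem_filter.1 hz).2.2.2))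
  have hfib : ∀ y ∈ F'.image (maskOutside I), ({z ∈ F' | maskOutside I z = y} : Finset _).card ≤
      C * A.card ^ ((s.card - I.card) / 2) := by
    intro y hy
    obtain ⟨y, hyF, rfl⟩ := Finset.mem_image.1 hy
    have hyI : ∑ j ∈ I, b j * (y j : L) = d := by
      have := (Finset.mem_filter.1 hyF).2.2.1
      simp only [mul_assoc] at this
      rw [← Finset.mul_sum] at this
      field_simp at this
      exact this
    have h := hC (s.card - I.card) (by omega) L hL G hG κ (s \ I)
      (Finset.card_sdiff_of_subset hI) b (fun j hj => hb j (Finset.mem_sdiff.1 hj).1) A hA _ _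
      (hF.fiber (F' := {z ∈ F' | maskOutside I z = maskOutside I y}) hI y
        ((Finset.filter_subset _ _).trans hF'F)
        fun z hz => maskOutside_eq_iff.1 (Finset.mem_filter.1 hz).2)
    exact h.1 (by rw [hyI, sub_self])
  calc F'.card ≤ C * A.card ^ ((s.card - I.card) / 2) * (F'.image (maskOutside I)).card :=
        Finset.card_le_mul_card_image _ _ hfib
    _ ≤ C * A.card ^ ((s.card - I.card) / 2) * (C' * A.card ^ ((I.card - 1) / 2)) :=
        Nat.mul_le_mul_left _ him
    _ = C * C' * A.card ^ ((s.card - I.card) / 2 + (I.card - 1) / 2) := by ring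
    _ ≤ C * C' * A.card ^ ((s.card - 1) / 2) :=
        Nat.mul_le_mul_left _ (Nat.pow_le_pow_right hA1 (by omega))

end LinearBound

theorem exists_linearBound (ρ k : ℕ) : ∃ C, LinearBound.{u} ρ k C := by
  induction k using Nat.strong_induction_on with
  | _ k ih =>
  rcases Nat.eq_zero_or_pos k with rfl | hk
  · refine ⟨1, ?_⟩
    intro L _ _ hL G hG κ s hs b hb A hA d F hF
    rw [Finset.card_eq_zero] at hs
    subst hs
    have : F.card ≤ 1 := Finset.card_le_one.2 fun z hz z' hz' => hF.inj z hz z' hz' (by simp)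
    exact ⟨fun _ => by simpa using this, fun _ => by simpa using this⟩
  have h1 : ∀ a, ∃ C, a < k → LinearBound.{u} ρ a C := fun a => by
    by_cases ha : a < k
    · obtain ⟨C, hC⟩ := ih a ha
      exact ⟨C, fun _ => hC⟩
    · exact ⟨0, fun h => absurd h ha⟩
  have h2 : ∀ m, ∃ C, 1 ≤ m → NondegBound.{u} ρ m C := fun m => by
    by_cases hm : 1 ≤ m
    · obtain ⟨C, hC⟩ := exists_nondegBound m hm ρ
      exact ⟨C, fun _ => hC⟩
    · exact ⟨0, fun h => absurd h hm⟩
  choose C hC using h1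
  choose C' hC' using h2
  have hlin : ∀ a < k, LinearBound.{u} ρ a (∑ a ∈ Finset.range k, C a) := fun a ha =>
    (hC a ha).mono (Finset.single_le_sum (f := C) (fun _ _ => Nat.zero_le _)
      (Finset.mem_range.2 ha))
  have hnd : ∀ m, 1 ≤ m → m ≤ k → NondegBound.{u} ρ m (∑ a ∈ Finset.range (k + 1), C' a) :=
    fun m hm hmk => (hC' m hm).mono (Finset.single_le_sum (f := C') (fun _ _ => Nat.zero_le _)
      (Finset.mem_range.2 (Nat.lt_succ_of_le hmk)))
  set D := ∑ a ∈ Finset.range k, C a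
  set D' := ∑ a ∈ Finset.range (k + 1), C' a
  refine ⟨D + 2 ^ k * (D * D'), ?_⟩
  intro L _ _ hL G hG κ s hs b hb A hA d F hF
  refine ⟨fun hd => ?_, fun hd => ?_⟩
  · subst hd
    exact (hF.card_le_of_eq_zero (hlin (k - 1) (by omega)) hL hG hs hk hb hA).trans
      (Nat.mul_le_mul_right _ (Nat.le_add_right _ _))
  · exact (hF.card_le_of_ne_zero hlin hnd hL hG hs hd hb hA).trans
      (Nat.mul_le_mul_right _ (Nat.le_add_left _ _))

section MatrixCount

variable {L : Type u} [Field L]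

/-- The vector `c` with support `J` spans the space of vectors supported in `J` which are
orthogonal to all rows of `Y`. -/
structure SpansKernel {R κ : Type*} [Fintype κ] (Y : R → κ → Lˣ) (J : Finset κ) (c : κ → L) :
    Prop where
  support : ∀ j, c j ≠ 0 ↔ j ∈ J
  orthogonal : ∀ i, ∑ j, c j * (Y i j : L) = 0
  spans : ∀ c' : κ → L, (∀ j ∉ J, c' j = 0) → (∀ i, ∑ j, c' j * (Y i j : L) = 0) →
    ∃ μ : L, c' = μ • c

/-- Few rows suffice to determine the kernel vector. -/
lemma SpansKernel.exists_rows {R κ : Type} [Finite R] [Fintype κ] {Y : R → κ → Lˣ}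
    {J : Finset κ} {c : κ → L} (h : SpansKernel Y J c) (hJ : J.Nonempty) :
    ∃ T : Finset R, T.card + 1 ≤ J.card ∧ ∀ c' : κ → L, (∀ j ∉ J, c' j = 0) →
      (∀ i ∈ T, ∑ j, c' j * (Y i j : L) = 0) → ∃ μ : L, c' = μ • c := by
  classical
  have := Fintype.ofFinite R
  let v : R → J → L := fun i j => Y i j
  let φ : (κ → L) → (J → L) →ₗ[L] L := fun c' =>
    ∑ j : J, c' j • LinearMap.proj j
  have hφ : ∀ c' : κ → L, (∀ j ∉ J, c' j = 0) → ∀ i,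
      φ c' (v i) = ∑ j, c' j * (Y i j : L) := by
    intro c' hc' i
    rw [← Finset.sum_subset (Finset.subset_univ J) fun j _ hj => by rw [hc' j hj, zero_mul],
      ← Finset.sum_coe_sort J]
    simp [φ, v]
  have hc0 : ∀ j ∉ J, c j = 0 := fun j hj => not_not.1 fun h0 => hj ((h.support j).1 h0)
  obtain ⟨σ, a, ha, hspan, hli⟩ := exists_linearIndependent' L v
  have := Fintype.ofInjective a ha
  refine ⟨Finset.univ.image a, ?_, fun c' hc' hT => h.spans c' hc' fun i => ?_⟩
  · rw [Finset.card_image_of_injective _ ha, Finset.card_univ, ← finrank_span_eq_card hli, hspan,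
      ← Fintype.card_coe J, ← Module.finrank_fintype_fun_eq_card L]
    refine Submodule.finrank_lt fun htop => ?_
    have hle : Submodule.span L (Set.range v) ≤ LinearMap.ker (φ c) := by
      rw [Submodule.span_le]
      rintro _ ⟨i, rfl⟩
      exact (hφ c hc0 i).trans (h.orthogonal i)
    obtain ⟨j₀, hj₀⟩ := hJ
    have h1 : φ c (Pi.single ⟨j₀, hj₀⟩ 1) = 0 := hle (htop ▸ Submodule.mem_top)
    refine (h.support j₀).2 hj₀ ?_
    rw [← h1]
    simp [φ, Pi.single_apply]
  · have hle : Submodule.span L (Set.range (v ∘ a)) ≤ LinearMap.ker (φ c') := by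
      rw [Submodule.span_le]
      rintro _ ⟨x, rfl⟩
      exact (hφ c' hc' _).trans (hT _ (Finset.mem_image_of_mem a (Finset.mem_univ x)))
    rw [hspan] at hle
    rw [← hφ c' hc' i]
    exact hle (Submodule.subset_span ⟨i, rfl⟩)

variable [CharZero L] {G : Subgroup Lˣ} {ρ C : ℕ} {A : Finset Lˣ}

/-- The number of vectors over `A` satisfying a linear equation with support `J`. -/
lemma card_linear_solutions {κ : Type} [Fintype κ] [DecidableEq κ] [DecidableEq L] {J : Finset κ}
    (hC : LinearBound.{u} ρ J.card C)
    (hL : HasPlaceSystems L) (hG : RankLE G ρ) (hA : ∀ a ∈ A, a ∈ G) {c : κ → L}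
    (hc : ∀ j, c j ≠ 0 ↔ j ∈ J) (d : L) :
    (d = 0 → ({y ∈ Fintype.piFinset fun _ : κ => A | ∑ j, c j * (y j : L) = d}).card ≤
      C * A.card ^ (J.card / 2) * A.card ^ (Fintype.card κ - J.card)) ∧
    (d ≠ 0 → ({y ∈ Fintype.piFinset fun _ : κ => A | ∑ j, c j * (y j : L) = d}).card ≤
      C * A.card ^ ((J.card - 1) / 2) * A.card ^ (Fintype.card κ - J.card)) := by
  classical
  set F := {y ∈ Fintype.piFinset fun _ : κ => A | ∑ j, c j * (y j : L) = d} with hF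
  have himg : (F.image (maskOutside Jᶜ)).card ≤ A.card ^ (Fintype.card κ - J.card) := by
    have hsub : F.image (maskOutside Jᶜ) ⊆
        Fintype.piFinset fun j => if j ∈ Jᶜ then A else {1} := by
      intro y hy
      obtain ⟨z, hz, rfl⟩ := Finset.mem_image.1 hy
      refine Fintype.mem_piFinset.2 fun j => ?_
      by_cases hj : j ∈ Jᶜ
      · rw [maskOutside_apply hj, if_pos hj]
        exact Fintype.mem_piFinset.1 (Finset.mem_filter.1 hz).1 j
      · rw [if_neg hj]
        simp [maskOutside, hj]
    refine (Finset.card_le_card hsub).trans ?_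
    rw [Fintype.card_piFinset, ← Finset.card_compl]
    simp_rw [apply_ite Finset.card, Finset.card_singleton]
    rw [Finset.prod_ite_mem, Finset.univ_inter, Finset.prod_const]
  have key : ∀ y, SolutionFamily J c A d {z ∈ F | maskOutside Jᶜ z = y} := by
    intro y
    refine ⟨fun z hz j _ => ?_, fun z hz => ?_, fun z hz z' hz' h => funext fun j => ?_⟩
    · exact Fintype.mem_piFinset.1 (Finset.mem_filter.1 (Finset.mem_filter.1 hz).1).1 j
    · rw [← (Finset.mem_filter.1 (Finset.mem_filter.1 hz).1).2]
      refine Finset.sum_subset (Finset.subset_univ J) fun j _ hj => ?_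
      rw [not_not.1 fun h0 => hj ((hc j).1 h0), zero_mul]
    · by_cases hj : j ∈ J
      · exact h j hj
      · exact maskOutside_eq_iff.1 ((Finset.mem_filter.1 hz).2.trans
          (Finset.mem_filter.1 hz').2.symm) j (Finset.mem_compl.2 hj)
  have hbound := fun y => hC L hL G hG κ J rfl c (fun j hj => (hc j).2 hj) A hA d _ (key y)
  exact ⟨fun hd => (Finset.card_le_mul_card_image _ _ fun y _ => (hbound y).1 hd).trans
      (Nat.mul_le_mul_left _ himg),
    fun hd => (Finset.card_le_mul_card_image _ _ fun y _ => (hbound y).2 hd).trans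
      (Nat.mul_le_mul_left _ himg)⟩

/-- The number of matrices over `A` with rows indexed by `R` whose kernel is spanned, among the
vectors supported in `J`, by a vector of support `J`. -/
lemma card_spansKernel_le {R κ : Type} [Fintype R] [Fintype κ] {J : Finset κ} (hJ : J.Nonempty)
    (hC : LinearBound.{u} ρ J.card C) (hC1 : 1 ≤ C)
    (hL : HasPlaceSystems L) (hG : RankLE G ρ) (hA : ∀ a ∈ A, a ∈ G)
    (W : Finset (R → κ → Lˣ))
    (hW : ∀ Y ∈ W, ∀ i j, Y i j ∈ A) (hWJ : ∀ Y ∈ W, ∃ c, SpansKernel Y J c) :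
    W.card ≤ 2 ^ Fintype.card R * C ^ Fintype.card R *
      A.card ^ (Fintype.card R * Fintype.card κ -
        (Fintype.card R + 1 - J.card) * ((J.card + 1) / 2)) := by
  classical
  rcases W.eq_empty_or_nonempty with rfl | ⟨Y₀, hY₀⟩
  · simp
  set r := Fintype.card R with hr
  set n := Fintype.card κ with hn
  set k := J.card with hk
  have hk1 : 1 ≤ k := Finset.card_pos.2 hJ
  have hkn : k ≤ n := Finset.card_le_univ J
  choose! c hc using hWJ
  choose! T hT using fun Y hY => (hc Y hY).exists_rows hJ
  have hcov : W ⊆ Finset.univ.biUnion fun S : Finset R => {Y ∈ W | T Y = S} := fun Y hY =>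
    Finset.mem_biUnion.2 ⟨T Y, Finset.mem_univ _, Finset.mem_filter.2 ⟨hY, rfl⟩⟩
  refine (Finset.card_le_card hcov).trans (Finset.card_biUnion_le.trans ?_)
  rw [hr, ← Fintype.card_finset, mul_assoc, ← smul_eq_mul, ← Finset.card_univ]
  refine Finset.sum_le_card_nsmul _ _ _ fun S _ => ?_
  set V := {Y ∈ W | T Y = S} with hV
  rcases V.eq_empty_or_nonempty with he | ⟨Y₁, hY₁⟩
  · simp [he]
  have hS : S.card + 1 ≤ k := by
    obtain ⟨h1, h2⟩ := Finset.mem_filter.1 hY₁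
    exact h2 ▸ (hT Y₁ h1).1
  have hSr : S.card ≤ r := Finset.card_le_univ S
  rcases Nat.eq_zero_or_pos r with hr0 | hr0
  · have hR : IsEmpty R := Fintype.card_eq_zero_iff.1 hr0
    have h1 : V.card ≤ 1 := Finset.card_le_one.2 fun Y _ Y' _ => Subsingleton.elim _ _
    simpa [Finset.card_univ, ← hr, hr0] using h1
  obtain ⟨i₀⟩ : Nonempty R := Fintype.card_pos_iff.1 hr0
  obtain ⟨j₀, hj₀⟩ := hJ
  have hA1 : 1 ≤ A.card := Finset.card_pos.2 ⟨_, hW Y₀ hY₀ i₀ j₀⟩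
  let mask : (R → κ → Lˣ) → R → κ → Lˣ := fun Y i => if i ∈ S then Y i else 1
  have himg : (V.image mask).card ≤ (A.card ^ n) ^ S.card := by
    have hsub : V.image mask ⊆ Fintype.piFinset fun i =>
        if i ∈ S then Fintype.piFinset fun _ : κ => A else {1} := by
      intro y hy
      obtain ⟨Y, hY, rfl⟩ := Finset.mem_image.1 hy
      refine Fintype.mem_piFinset.2 fun i => ?_
      by_cases hi : i ∈ S
      · simp only [mask, if_pos hi]
        exact Fintype.mem_piFinset.2 (hW Y (Finset.mem_filter.1 hY).1 i)
      · simp [mask, if_neg hi]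
    refine (Finset.card_le_card hsub).trans ?_
    rw [Fintype.card_piFinset]
    simp_rw [apply_ite Finset.card, Finset.card_singleton]
    rw [Finset.prod_ite_mem, Finset.univ_inter, Finset.prod_const, Fintype.card_piFinset,
      Finset.prod_const, Finset.card_univ]
  have hfib : ∀ y ∈ V.image mask, ({Y ∈ V | mask Y = y} : Finset _).card ≤
      (C * A.card ^ (k / 2) * A.card ^ (n - k)) ^ (r - S.card) := by
    intro y hy
    obtain ⟨Y', hY', rfl⟩ := Finset.mem_image.1 hy
    obtain ⟨hY'W, hY'S⟩ := Finset.mem_filter.1 hY'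
    set H := {y ∈ Fintype.piFinset fun _ : κ => A | ∑ j, c Y' j * (y j : L) = 0} with hH
    have hsub : ({Y ∈ V | mask Y = mask Y'} : Finset _) ⊆
        Fintype.piFinset fun i => if i ∈ Sᶜ then H else {Y' i} := by
      intro Y hY
      obtain ⟨hYV, hYm⟩ := Finset.mem_filter.1 hY
      obtain ⟨hYW, hYS⟩ := Finset.mem_filter.1 hYV
      have hagree : ∀ i ∈ S, Y i = Y' i := fun i hi => by
        have := congrFun hYm i
        simpa [mask, hi] using this
      obtain ⟨μ, hμ⟩ := (hT Y hYW).2 (c Y')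
        (fun j hj => not_not.1 fun h0 => hj (((hc Y' hY'W).support j).1 h0)) (fun i hi => by
          rw [hagree i (hYS ▸ hi)]
          exact (hc Y' hY'W).orthogonal i)
      refine Fintype.mem_piFinset.2 fun i => ?_
      by_cases hi : i ∈ Sᶜ
      · rw [if_pos hi]
        refine Finset.mem_filter.2 ⟨Fintype.mem_piFinset.2 (hW Y hYW i), ?_⟩
        simp only [hμ, Pi.smul_apply, smul_eq_mul, mul_assoc]
        rw [← Finset.mul_sum, (hc Y hYW).orthogonal i, mul_zero]
      · rw [if_neg hi, Finset.mem_singleton]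
        exact hagree i (by simpa using hi)
    refine (Finset.card_le_card hsub).trans ?_
    rw [Fintype.card_piFinset]
    simp_rw [apply_ite Finset.card, Finset.card_singleton]
    rw [Finset.prod_ite_mem, Finset.univ_inter, Finset.prod_const, Finset.card_compl]
    exact Nat.pow_le_pow_left
      ((card_linear_solutions hC hL hG hA (hc Y' hY'W).support 0).1 rfl) _
  have hexp : (k / 2 + (n - k)) * (r - S.card) + n * S.card ≤
      r * n - (r + 1 - k) * ((k + 1) / 2) := by
    obtain ⟨x, hx⟩ : ∃ x, n = x + (k + 1) / 2 := ⟨n - (k + 1) / 2, by omega⟩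
    obtain ⟨q, hq⟩ : ∃ q, r = q + S.card := ⟨r - S.card, by omega⟩
    rw [show k / 2 + (n - k) = x by omega, show r - S.card = q by omega]
    have h1 : (r + 1 - k) * ((k + 1) / 2) ≤ q * ((k + 1) / 2) :=
      Nat.mul_le_mul_right _ (by omega)
    have h2 : r * n = x * q + n * S.card + q * ((k + 1) / 2) := by
      rw [hq, hx]
      ring
    omega
  calc V.card ≤ (C * A.card ^ (k / 2) * A.card ^ (n - k)) ^ (r - S.card) *
        (V.image mask).card := Finset.card_le_mul_card_image _ _ hfib
    _ ≤ (C * A.card ^ (k / 2) * A.card ^ (n - k)) ^ (r - S.card) * (A.card ^ n) ^ S.card :=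
        Nat.mul_le_mul_left _ himg
    _ = C ^ (r - S.card) * A.card ^ ((k / 2 + (n - k)) * (r - S.card) + n * S.card) := by
        rw [mul_assoc, ← pow_add, mul_pow, ← pow_mul, ← pow_mul, mul_assoc, ← pow_add]
    _ ≤ _ := Nat.mul_le_mul (Nat.pow_le_pow_right hC1 (Nat.sub_le _ _))
        (Nat.pow_le_pow_right hA1 hexp)

end MatrixCount

section Determinant

variable {L : Type u} [Field L]

lemma exists_spansKernel {R κ : Type*} [Fintype κ] {Y : R → κ → Lˣ} {v : κ → L} (hv : v ≠ 0)
    (hvY : ∀ i, ∑ j, v j * (Y i j : L) = 0) :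
    ∃ (J : Finset κ) (c : κ → L), J.Nonempty ∧ SpansKernel Y J c := by
  classical
  let supp : (κ → L) → Finset κ := fun w => {j | w j ≠ 0}
  obtain ⟨c, ⟨hc0, hcY⟩, hmin⟩ := exists_minimalFor_of_wellFoundedLT
    (fun w : κ → L => w ≠ 0 ∧ ∀ i, ∑ j, w j * (Y i j : L) = 0) (fun w => (supp w).card)
    ⟨v, hv, hvY⟩
  obtain ⟨j₀, hj₀⟩ := Function.ne_iff.1 hc0
  refine ⟨supp c, c, ⟨j₀, by simpa [supp] using hj₀⟩, fun j => by simp [supp], hcY,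
    fun c' hc' hc'Y => ⟨c' j₀ / c j₀, ?_⟩⟩
  by_contra hne
  have hlt : (supp (c' - (c' j₀ / c j₀) • c)).card < (supp c).card := by
    refine Finset.card_lt_card (Finset.ssubset_iff_of_subset (fun j hj => ?_) |>.2
      ⟨j₀, by simpa [supp] using hj₀, ?_⟩)
    · by_contra hjc
      have h1 : c j = 0 := by simpa [supp] using hjc
      have h2 := hc' j hjc
      simp [supp, h1, h2] at hj
    · have : c j₀ ≠ 0 := hj₀
      simp [supp, this]
  refine hlt.not_ge (hmin ⟨sub_ne_zero.2 hne, fun i => ?_⟩ hlt.le)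
  simp only [Pi.sub_apply, Pi.smul_apply, smul_eq_mul, sub_mul, mul_assoc]
  rw [Finset.sum_sub_distrib, ← Finset.mul_sum, hcY i, hc'Y i, mul_zero, sub_zero]

/-- The signed maximal minors of a matrix with one row less than columns. -/
def maximalMinors {m : ℕ} (Y : Fin m → Fin (m + 1) → Lˣ) (j : Fin (m + 1)) : L :=
  (-1) ^ (j : ℕ) * Matrix.det (Matrix.of fun i l => (Y i (j.succAbove l) : L))

lemma det_eq_sum_maximalMinors {m : ℕ} (x : Fin (m + 1) → Lˣ) (Y : Fin m → Fin (m + 1) → Lˣ)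
    (X : Fin (m + 1) → Fin (m + 1) → Lˣ) (h0 : X 0 = x) (hY : ∀ i, X i.succ = Y i) :
    Matrix.det (Matrix.of fun i j => (X i j : L)) = ∑ j, maximalMinors Y j * (x j : L) := by
  rw [Matrix.det_succ_row_zero]
  refine Finset.sum_congr rfl fun j _ => ?_
  have : (Matrix.of fun i j => (X i j : L)).submatrix Fin.succ j.succAbove =
      Matrix.of fun i l => (Y i (j.succAbove l) : L) := by
    ext i l
    simp [hY]
  rw [this, maximalMinors, ← h0, Matrix.of_apply]
  ring

lemma spansKernel_maximalMinors {m : ℕ} {X : Fin (m + 1) → Fin (m + 1) → Lˣ}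
    (hX : Matrix.det (Matrix.of fun i j => (X i j : L)) ≠ 0) {J : Finset (Fin (m + 1))}
    (hJ : ∀ j, maximalMinors (fun i => X i.succ) j ≠ 0 ↔ j ∈ J) :
    SpansKernel (fun i : Fin m => X i.succ) J (maximalMinors fun i => X i.succ) := by
  have horth : ∀ i : Fin m,
      ∑ j, maximalMinors (fun i => X i.succ) j * (X i.succ j : L) = 0 := by
    intro i
    rw [← det_eq_sum_maximalMinors (X i.succ) (fun i => X i.succ)
      (Fin.cons (X i.succ) fun i => X i.succ) rfl fun _ => rfl]
    exact Matrix.det_zero_of_row_eq (i := 0) (j := i.succ) (Fin.succ_ne_zero i).symm (by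
      ext j; simp)
  refine ⟨hJ, horth, fun c' _ hc' => ?_⟩
  have hdet := det_eq_sum_maximalMinors (X 0) (fun i => X i.succ) X rfl fun _ => rfl
  set d := Matrix.det (Matrix.of fun i j => (X i j : L)) with hd
  set μ := (∑ j, c' j * (X 0 j : L)) / d with hμ
  refine ⟨μ, sub_eq_zero.1 (Matrix.eq_zero_of_mulVec_eq_zero hX (funext fun i => ?_))⟩
  have hi : ((Matrix.of fun i j => (X i j : L)).mulVec
      (c' - μ • maximalMinors fun i => X i.succ)) i = ∑ j, c' j * (X i j : L) -
      μ * ∑ j, maximalMinors (fun i => X i.succ) j * (X i j : L) := by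
    rw [Finset.mul_sum, ← Finset.sum_sub_distrib, Matrix.mulVec, dotProduct]
    refine Finset.sum_congr rfl fun j _ => ?_
    simp only [Matrix.of_apply, Pi.sub_apply, Pi.smul_apply, smul_eq_mul]
    ring
  rw [hi]
  refine Fin.cases ?_ (fun i => ?_) i
  · rw [← hdet, hμ, div_mul_cancel₀ _ hX]
    simp
  · rw [horth i, hc' i]
    simp

end Determinant

section DeterminantCount

variable {L : Type u} [Field L] [CharZero L] {G : Subgroup Lˣ} {ρ C n : ℕ} {A : Finset Lˣ}

lemma card_le_of_det_eq_zero (hC : ∀ k ≤ n, LinearBound.{u} ρ k C) (hC1 : 1 ≤ C) (hn : 2 ≤ n)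
    (hL : HasPlaceSystems L) (hG : RankLE G ρ) (hA : ∀ a ∈ A, a ∈ G)
    {F : Finset (Fin n → Fin n → Lˣ)} (hF : ∀ X ∈ F, ∀ i j, X i j ∈ A)
    (hdet : ∀ X ∈ F, Matrix.det (Matrix.of fun i j => (X i j : L)) = 0) :
    F.card ≤ 2 ^ n * (2 ^ n * C ^ n) * A.card ^ (n ^ 2 - (n + 1) / 2) := by
  classical
  rcases F.eq_empty_or_nonempty with rfl | ⟨X₀, hX₀⟩
  · simp
  have hA1 : 1 ≤ A.card := Finset.card_pos.2 ⟨_, hF X₀ hX₀ ⟨0, by omega⟩ ⟨0, by omega⟩⟩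
  have hcov : F ⊆ Finset.univ.biUnion fun J : Finset (Fin n) =>
      {X ∈ F | J.Nonempty ∧ ∃ c, SpansKernel X J c} := by
    intro X hX
    obtain ⟨v, hv, hvX⟩ := Matrix.exists_mulVec_eq_zero_iff.2 (hdet X hX)
    obtain ⟨J, c, hJ, hc⟩ := exists_spansKernel (Y := X) hv fun i => by
      rw [← show _ = (0 : L) from congrFun hvX i]
      exact Finset.sum_congr rfl fun j _ => mul_comm _ _
    exact Finset.mem_biUnion.2 ⟨J, Finset.mem_univ _, Finset.mem_filter.2 ⟨hX, hJ, c, hc⟩⟩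
  refine (Finset.card_le_card hcov).trans (Finset.card_biUnion_le.trans ?_)
  have h2 : (2 : ℕ) ^ n = (Finset.univ : Finset (Finset (Fin n))).card := by
    rw [Finset.card_univ, Fintype.card_finset, Fintype.card_fin]
  refine (Finset.sum_le_card_nsmul _ _ (2 ^ n * C ^ n * A.card ^ (n ^ 2 - (n + 1) / 2))
    fun J _ => ?_).trans (by rw [smul_eq_mul, ← h2, mul_assoc, mul_assoc, mul_assoc])
  rcases ({X ∈ F | J.Nonempty ∧ ∃ c, SpansKernel X J c} : Finset _).eq_empty_or_nonempty with
    he | ⟨X₁, hX₁⟩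
  · simp [he]
  have hJ : J.Nonempty := (Finset.mem_filter.1 hX₁).2.1
  have hJ1 : 1 ≤ J.card := Finset.card_pos.2 hJ
  have hJn : J.card ≤ n := by simpa using Finset.card_le_univ J
  have := card_spansKernel_le hJ (hC _ hJn) hC1 hL hG hA
    {X ∈ F | J.Nonempty ∧ ∃ c, SpansKernel X J c}
    (fun X hX => hF X (Finset.mem_filter.1 hX).1) (fun X hX => (Finset.mem_filter.1 hX).2.2)
  rw [Fintype.card_fin] at this
  refine this.trans (Nat.mul_le_mul_left _ (Nat.pow_le_pow_right hA1 ?_))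
  rw [sq]
  have h3 : (n + 1 - J.card) + (J.card + 1) / 2 ≤ (n + 1 - J.card) * ((J.card + 1) / 2) + 1 := by
    obtain ⟨x, hx⟩ : ∃ x, n + 1 - J.card = x + 1 := ⟨n - J.card, by omega⟩
    obtain ⟨y, hy⟩ : ∃ y, (J.card + 1) / 2 = y + 1 := ⟨(J.card + 1) / 2 - 1, by omega⟩
    rw [hx, hy]
    nlinarith [Nat.zero_le (x * y)]
  omega

lemma card_le_of_det_ne_zero (hC : ∀ k ≤ n, LinearBound.{u} ρ k C) (hC1 : 1 ≤ C) (hn : 2 ≤ n)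
    (hL : HasPlaceSystems L) (hG : RankLE G ρ) (hA : ∀ a ∈ A, a ∈ G) {d : L} (hd : d ≠ 0)
    {F : Finset (Fin n → Fin n → Lˣ)} (hF : ∀ X ∈ F, ∀ i j, X i j ∈ A)
    (hdet : ∀ X ∈ F, Matrix.det (Matrix.of fun i j => (X i j : L)) = d) :
    F.card ≤ 2 ^ n * (2 ^ n * C ^ n) * A.card ^ (n ^ 2 - (n + 2) / 2) := by
  classical
  obtain ⟨m, rfl⟩ : ∃ m, n = m + 1 := ⟨n - 1, by omega⟩
  rcases F.eq_empty_or_nonempty with rfl | ⟨X₀, hX₀⟩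
  · simp
  have hA1 : 1 ≤ A.card := Finset.card_pos.2 ⟨_, hF X₀ hX₀ 0 0⟩
  let tail : (Fin (m + 1) → Fin (m + 1) → Lˣ) → Fin m → Fin (m + 1) → Lˣ := fun X i => X i.succ
  have hcov : F ⊆ Finset.univ.biUnion fun J : Finset (Fin (m + 1)) =>
      {X ∈ F | ∀ j, maximalMinors (tail X) j ≠ 0 ↔ j ∈ J} := fun X hX =>
    Finset.mem_biUnion.2 ⟨Finset.univ.filter fun j => maximalMinors (tail X) j ≠ 0,
      Finset.mem_univ _, Finset.mem_filter.2 ⟨hX, fun j => by simp⟩⟩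
  refine (Finset.card_le_card hcov).trans (Finset.card_biUnion_le.trans ?_)
  have h2 : (2 : ℕ) ^ (m + 1) = (Finset.univ : Finset (Finset (Fin (m + 1)))).card := by
    rw [Finset.card_univ, Fintype.card_finset, Fintype.card_fin]
  refine (Finset.sum_le_card_nsmul _ _
    (2 ^ (m + 1) * C ^ (m + 1) * A.card ^ ((m + 1) ^ 2 - (m + 1 + 2) / 2))
    fun J _ => ?_).trans (by rw [smul_eq_mul, ← h2, mul_assoc, mul_assoc, mul_assoc])
  set V := {X ∈ F | ∀ j, maximalMinors (tail X) j ≠ 0 ↔ j ∈ J} with hV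
  have hVF : ∀ X ∈ V, X ∈ F := fun X hX => (Finset.mem_filter.1 hX).1
  have hVdet : ∀ X ∈ V, ∑ j, maximalMinors (tail X) j * (X 0 j : L) = d := fun X hX => by
    rw [← hdet X (hVF X hX)]
    exact (det_eq_sum_maximalMinors _ _ X rfl fun _ => rfl).symm
  rcases V.eq_empty_or_nonempty with he | ⟨X₁, hX₁⟩
  · simp [he]
  have hJ : J.Nonempty := by
    obtain ⟨j, -, hj⟩ := Finset.exists_ne_zero_of_sum_ne_zero ((hVdet X₁ hX₁).symm ▸ hd)
    exact ⟨j, ((Finset.mem_filter.1 hX₁).2 j).1 (left_ne_zero_of_mul hj)⟩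
  have hJ1 : 1 ≤ J.card := Finset.card_pos.2 hJ
  have hJn : J.card ≤ m + 1 := by simpa using Finset.card_le_univ J
  have himg := card_spansKernel_le hJ (hC _ hJn) hC1 hL hG hA (V.image tail)
    (fun Y hY i j => by
      obtain ⟨X, hX, rfl⟩ := Finset.mem_image.1 hY
      exact hF X (hVF X hX) _ _)
    (fun Y hY => by
      obtain ⟨X, hX, rfl⟩ := Finset.mem_image.1 hY
      exact ⟨_, spansKernel_maximalMinors (by rw [hdet X (hVF X hX)]; exact hd)
        (Finset.mem_filter.1 hX).2⟩)
  have hfib : ∀ Y ∈ V.image tail, ({X ∈ V | tail X = Y} : Finset _).card ≤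
      C * A.card ^ ((J.card - 1) / 2) * A.card ^ (m + 1 - J.card) := by
    intro Y hY
    obtain ⟨X', hX', rfl⟩ := Finset.mem_image.1 hY
    have hinj : Set.InjOn (fun X : Fin (m + 1) → Fin (m + 1) → Lˣ => X 0)
        ({X ∈ V | tail X = tail X'} : Finset _) := fun X hX Y hY h => funext fun i => by
      have h1 := (Finset.mem_filter.1 hX).2.trans (Finset.mem_filter.1 hY).2.symm
      exact Fin.cases h (fun i => congrFun h1 i) i
    rw [← Finset.card_image_of_injOn hinj]
    have h := (card_linear_solutions (hC _ hJn) hL hG hA (Finset.mem_filter.1 hX').2 d).2 hd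
    rw [Fintype.card_fin] at h
    refine (Finset.card_le_card fun x hx => ?_).trans h
    obtain ⟨X, hX, rfl⟩ := Finset.mem_image.1 hx
    obtain ⟨hXV, hXt⟩ := Finset.mem_filter.1 hX
    refine Finset.mem_filter.2 ⟨Fintype.mem_piFinset.2 (hF X (hVF X hXV) 0), ?_⟩
    rw [← hXt]
    exact hVdet X hXV
  rw [Fintype.card_fin, Fintype.card_fin] at himg
  calc V.card ≤ C * A.card ^ ((J.card - 1) / 2) * A.card ^ (m + 1 - J.card) *
        (V.image tail).card := Finset.card_le_mul_card_image _ _ hfib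
    _ ≤ C * A.card ^ ((J.card - 1) / 2) * A.card ^ (m + 1 - J.card) *
        (2 ^ m * C ^ m * A.card ^ (m * (m + 1) - (m + 1 - J.card) * ((J.card + 1) / 2))) :=
        Nat.mul_le_mul_left _ himg
    _ = 2 ^ m * C ^ (m + 1) * A.card ^ ((J.card - 1) / 2 + (m + 1 - J.card) +
        (m * (m + 1) - (m + 1 - J.card) * ((J.card + 1) / 2))) := by ring
    _ ≤ _ := by
      refine Nat.mul_le_mul (Nat.mul_le_mul_right _
        (Nat.pow_le_pow_right (by norm_num) (Nat.le_succ m))) (Nat.pow_le_pow_right hA1 ?_)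
      rw [show (m + 1) ^ 2 = m * (m + 1) + (m + 1) by ring]
      have h3 : (m + 1 - J.card) * ((J.card + 1) / 2) ≤ m * (m + 1) :=
        Nat.mul_le_mul (by omega) (by omega)
      rcases hJn.eq_or_lt with hJn | hJn
      · rw [hJn, Nat.sub_self, Nat.zero_mul]
        omega
      have h4 : (m + 1 - J.card) + (J.card + 1) / 2 ≤
          (m + 1 - J.card) * ((J.card + 1) / 2) + 1 := by
        obtain ⟨x, hx⟩ : ∃ x, m + 1 - J.card = x + 1 := ⟨m - J.card, by omega⟩
        obtain ⟨y, hy⟩ : ∃ y, (J.card + 1) / 2 = y + 1 := ⟨(J.card + 1) / 2 - 1, by omega⟩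
        rw [hx, hy]
        nlinarith [Nat.zero_le (x * y)]
      omega

end DeterminantCount

/-- Uniform bounds for the number of matrices of given determinant over a finite set of units from
a group of rank `ρ`, in a field with enough absolute values. -/
theorem exists_det_bound (n ρ : ℕ) (hn : 2 ≤ n) : ∃ C : ℕ, 1 ≤ C ∧ ∀ (L : Type u) [Field L]
    [CharZero L], HasPlaceSystems L → ∀ G : Subgroup Lˣ, RankLE G ρ → ∀ A : Finset Lˣ,
    (∀ a ∈ A, a ∈ G) → ∀ (d : L) (F : Finset (Fin n → Fin n → Lˣ)),
    (∀ X ∈ F, ∀ i j, X i j ∈ A) →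
    (∀ X ∈ F, Matrix.det (Matrix.of fun i j => (X i j : L)) = d) →
    (d = 0 → F.card ≤ C * A.card ^ (n ^ 2 - (n + 1) / 2)) ∧
    (d ≠ 0 → F.card ≤ C * A.card ^ (n ^ 2 - (n + 2) / 2)) := by
  choose C hC using fun k => exists_linearBound.{u} ρ k
  have hlin : ∀ k ≤ n, LinearBound.{u} ρ k (1 + ∑ k ∈ Finset.range (n + 1), C k) := fun k hk =>
    (hC k).mono ((Finset.single_le_sum (f := C) (fun _ _ => Nat.zero_le _)
      (Finset.mem_range.2 (Nat.lt_succ_of_le hk))).trans (Nat.le_add_left _ _))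
  set D := 1 + ∑ k ∈ Finset.range (n + 1), C k with hD
  have hD1 : 1 ≤ D := Nat.le_add_right _ _
  refine ⟨2 ^ n * (2 ^ n * D ^ n), Nat.one_le_iff_ne_zero.2 (by positivity), ?_⟩
  intro L _ _ hL G hG A hA d F hF hdet
  refine ⟨fun hd => ?_, fun hd => card_le_of_det_ne_zero hlin hD1 hn hL hG hA hd hF hdet⟩
  subst hd
  exact card_le_of_det_eq_zero hlin hD1 hn hL hG hA hF hdet

section Specialization

/-- A nontrivial algebra of finite type over `ℚ` has a homomorphism to a number field. -/
lemma exists_ringHom_numberField (R : Type u) [CommRing R] [Nontrivial R] [Algebra ℚ R]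
    [Algebra.FiniteType ℚ R] :
    ∃ (L : Type u) (_ : Field L) (_ : NumberField L), Nonempty (R →+* L) := by
  obtain ⟨m, hm⟩ := Ideal.exists_maximal R
  let _ : Field (R ⧸ m) := Ideal.Quotient.field m
  have hchar : CharZero (R ⧸ m) := algebraRat.charZero _
  have : Algebra.FiniteType ℚ (R ⧸ m) :=
    Algebra.FiniteType.of_surjective (Ideal.Quotient.mk m).toRatAlgHom Ideal.Quotient.mk_surjective
  have hfin := finite_of_finite_type_of_isJacobsonRing ℚ (R ⧸ m)
  refine ⟨R ⧸ m, inferInstance, { }, ⟨Ideal.Quotient.mk m⟩⟩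

/-- A homomorphism from a finitely generated subalgebra of a field of characteristic zero,
in which given elements are invertible, to a number field. -/
lemma exists_specialization (K : Type u) [Field K] [CharZero K] (T : Finset K) :
    ∃ (R : Subalgebra ℚ K) (L : Type u) (_ : Field L) (_ : NumberField L) (_ : R →+* L),
      ∀ x ∈ T, x ∈ R ∧ x⁻¹ ∈ R := by
  classical
  have hR : Algebra.FiniteType ℚ
      (Algebra.adjoin ℚ ((T ∪ T.image fun x => x⁻¹ : Finset K) : Set K)) :=
    (Subalgebra.fg_iff_finiteType _).1 ⟨_, rfl⟩
  obtain ⟨L, hL, hL', ⟨π⟩⟩ := exists_ringHom_numberField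
    (Algebra.adjoin ℚ ((T ∪ T.image fun x => x⁻¹ : Finset K) : Set K))
  refine ⟨_, L, hL, hL', π, fun x hx => ⟨?_, ?_⟩⟩ <;>
    exact Algebra.subset_adjoin (by simp [hx])

lemma RankLE.map_comap {H H' M : Type*} [CommGroup H] [CommGroup H'] [CommGroup M] {ι : M →* H}
    (hι : Function.Injective ι) (σ : M →* H') {Γ : Subgroup H} {S : Finset H}
    (hS : ∀ s ∈ S, s ∈ Set.range ι)
    (h : ∀ x ∈ Γ, ∃ k : ℕ, 0 < k ∧ x ^ k ∈ Subgroup.closure (S : Set H)) :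
    RankLE ((Γ.comap ι).map σ) S.card := by
  classical
  obtain ⟨S', -, rfl⟩ := Finset.subset_set_image_iff.1
    (show (S : Set H) ⊆ ι '' Set.univ by rw [Set.image_univ]; exact hS)
  refine ⟨S'.image σ, Finset.card_image_le.trans (Finset.card_image_of_injective _ hι).ge, ?_⟩
  rintro _ ⟨u, hu, rfl⟩
  obtain ⟨k, hk, hmem⟩ := h _ hu
  refine ⟨k, hk, ?_⟩
  rw [Finset.coe_image, ← MonoidHom.map_closure] at hmem ⊢
  obtain ⟨w, hw, hwk⟩ := hmem
  rw [← map_pow] at hwk ⊢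
  exact ⟨u ^ k, hι hwk ▸ hw, rfl⟩

/-- Matrices with entries in a finite set of units can be transported to a number field,
preserving the vanishing of the determinant. -/
lemma exists_numberField_matrices {K : Type u} [Field K] [CharZero K] {Γ : Subgroup Kˣ} {ρ : ℕ}
    {S : Finset Kˣ} (hSρ : S.card ≤ ρ)
    (hS : ∀ x ∈ Γ, ∃ k : ℕ, 0 < k ∧ x ^ k ∈ Subgroup.closure (S : Set Kˣ)) (n : ℕ) (d : K)
    {A : Finset K} (hA : ∀ a ∈ A, ∃ u : Kˣ, u ∈ Γ ∧ (u : K) = a) :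
    ∃ (L : Type u) (_ : Field L) (_ : NumberField L) (G : Subgroup Lˣ) (B : Finset Lˣ) (d' : L)
      (F : Finset (Fin n → Fin n → Lˣ)), RankLE G ρ ∧ (∀ b ∈ B, b ∈ G) ∧ B.card ≤ A.card ∧
      (d' = 0 ↔ d = 0) ∧ (∀ X ∈ F, ∀ i j, X i j ∈ B) ∧
      (∀ X ∈ F, Matrix.det (Matrix.of fun i j => (X i j : L)) = d') ∧
      {X : Matrix (Fin n) (Fin n) K | (∀ i j, X i j ∈ A) ∧ X.det = d}.ncard ≤ F.card := by
  classical
  obtain ⟨R, L, _, _, π, hT⟩ := exists_specialization K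
    (A ∪ S.image Units.val ∪ (A ×ˢ A).image (fun p => p.1 - p.2) ∪ {d})
  have hπ : ∀ x : R, (x : K)⁻¹ ∈ R → (x : K) ≠ 0 → π x ≠ 0 := by
    intro x hx hx0 h
    have h1 : x * ⟨(x : K)⁻¹, hx⟩ = 1 := Subtype.ext (mul_inv_cancel₀ hx0)
    have h2 := congrArg π h1
    rw [map_mul, h, zero_mul, map_one] at h2
    exact zero_ne_one h2
  let ι : Rˣ →* Kˣ := Units.map (R.val : R →* K)
  let σ : Rˣ →* Lˣ := Units.map (π : R →* L)
  have hι : Function.Injective ι := Units.map_injective Subtype.val_injective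
  have hlift : ∀ u : Kˣ, (u : K) ∈ R → (u : K)⁻¹ ∈ R → ∃ r : Rˣ, ι r = u := fun u h1 h2 =>
    ⟨⟨⟨u, h1⟩, ⟨_, h2⟩, Subtype.ext (mul_inv_cancel₀ u.ne_zero),
      Subtype.ext (inv_mul_cancel₀ u.ne_zero)⟩, Units.ext rfl⟩
  have hAR : ∀ a : A, ∃ r : Rˣ, ι r ∈ Γ ∧ ((r : R) : K) = a := by
    rintro ⟨a, ha⟩
    obtain ⟨u, hu, rfl⟩ := hA a ha
    obtain ⟨h1, h2⟩ := hT u (by simp [ha])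
    obtain ⟨r, rfl⟩ := hlift u h1 h2
    exact ⟨r, hu, rfl⟩
  choose r hrΓ hr using hAR
  have hinj : Function.Injective fun a : A => σ (r a) := by
    intro a b hab
    by_contra hne
    have hne' : (a : K) - b ≠ 0 := sub_ne_zero.2 fun h => hne (Subtype.ext h)
    have hab' : π (r a : R) = π (r b : R) := congrArg Units.val hab
    have hsub : (((r a : R) - (r b : R) : R) : K) = a - b := by
      rw [← hr a, ← hr b]
      rfl
    refine hπ ((r a : R) - (r b : R)) ?_ ?_ (by rw [map_sub, hab', sub_self])
    · rw [hsub]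
      refine (hT _ ?_).2
      simp only [Finset.mem_union, Finset.mem_image, Finset.mem_product]
      exact Or.inl (Or.inr ⟨(a, b), ⟨a.2, b.2⟩, rfl⟩)
    · rwa [hsub]
  have hd : d ∈ R ∧ d⁻¹ ∈ R := hT d (by simp)
  let B : Finset Lˣ := A.attach.image fun a => σ (r a)
  let d' : L := π ⟨d, hd.1⟩
  let F : Finset (Fin n → Fin n → Lˣ) :=
    (Fintype.piFinset fun _ => Fintype.piFinset fun _ => B).filter fun X =>
      Matrix.det (Matrix.of fun i j => (X i j : L)) = d'
  have hF : ∀ X ∈ F, (∀ i j, X i j ∈ B) ∧ Matrix.det (Matrix.of fun i j => (X i j : L)) = d' := by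
    intro X hX
    simpa [F, Fintype.mem_piFinset] using hX
  refine ⟨L, inferInstance, inferInstance, (Γ.comap ι).map σ, B, d', F,
    (RankLE.map_comap hι σ (fun s hs => ?_) hS).mono le_rfl hSρ, fun b hb => ?_,
    Finset.card_image_le.trans Finset.card_attach.le, ⟨fun h => ?_, fun h => ?_⟩,
    fun X hX => (hF X hX).1, fun X hX => (hF X hX).2, ?_⟩
  · obtain ⟨h1, h2⟩ := hT s (by
      simp only [Finset.mem_union, Finset.mem_image]
      exact Or.inl (Or.inl (Or.inr ⟨s, hs, rfl⟩)))
    exact hlift s h1 h2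
  · obtain ⟨a, -, rfl⟩ := Finset.mem_image.1 hb
    exact ⟨r a, hrΓ a, rfl⟩
  · by_contra h0
    exact hπ ⟨d, hd.1⟩ hd.2 h0 h
  · have : (⟨d, hd.1⟩ : R) = 0 := Subtype.ext h
    rw [show d' = π ⟨d, hd.1⟩ from rfl, this, map_zero]
  rw [← Set.ncard_coe_finset F]
  refine Set.ncard_le_ncard_of_injOn
    (fun X i j => if h : X i j ∈ A then σ (r ⟨X i j, h⟩) else 1) ?_ ?_ F.finite_toSet
  · rintro X ⟨hX, hXd⟩
    have hdet : Matrix.det (Matrix.of fun i j => (r ⟨X i j, hX i j⟩ : R)) = ⟨d, hd.1⟩ := by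
      refine Subtype.ext ?_
      change R.val _ = d
      rw [AlgHom.map_det, ← hXd]
      congr 1
      ext i j
      exact hr ⟨X i j, hX i j⟩
    refine Finset.mem_coe.2 (Finset.mem_filter.2 ⟨Fintype.mem_piFinset.2 fun i =>
      Fintype.mem_piFinset.2 fun j => ?_, ?_⟩)
    · simp only [hX i j, dif_pos]
      exact Finset.mem_image_of_mem _ (Finset.mem_attach _ _)
    · rw [show d' = π ⟨d, hd.1⟩ from rfl, ← hdet, RingHom.map_det]
      congr 1
      ext i j
      simp [hX i j, σ]
  · rintro X ⟨hX, -⟩ Y ⟨hY, -⟩ hXY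
    ext i j
    have h := congrFun (congrFun hXY i) j
    simp only [hX i j, hY i j, dif_pos] at h
    exact congrArg Subtype.val (hinj h)

end Specialization

theorem count_matrices_of_det (n ρ : ℕ) (hn : 2 ≤ n) :
    ∃ C : ℝ, 0 < C ∧ ∀ (K : Type*) [Field K] [CharZero K] (Γ : Subgroup Kˣ),
      FinRank Γ ρ →
      ∀ (d : K) (A : Finset K), (∀ a ∈ A, ∃ u : Kˣ, u ∈ Γ ∧ (u : K) = a) →
      ((d = 0 →
          ({X : Matrix (Fin n) (Fin n) K | (∀ i j, X i j ∈ A) ∧ X.det = d}.ncard : ℝ) ≤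
            C * (A.card : ℝ) ^ (n ^ 2 - (n + 1) / 2)) ∧
       (d ≠ 0 →
          ({X : Matrix (Fin n) (Fin n) K | (∀ i j, X i j ∈ A) ∧ X.det = d}.ncard : ℝ) ≤
            C * (A.card : ℝ) ^ (n ^ 2 - (n + 2) / 2))) := by
  obtain ⟨C, hC1, hC⟩ := exists_det_bound n ρ hn
  refine ⟨C, by exact_mod_cast hC1, fun K _ _ Γ ⟨S, hSρ, _, hS⟩ d A hA => ?_⟩
  obtain ⟨L, _, _, G, B, d', F, hG, hBG, hBA, hd, hFB, hFd, hcard⟩ :=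
    exists_numberField_matrices hSρ.le hS n d hA
  obtain ⟨h0, h1⟩ := hC L (hasPlaceSystems_of_numberField L) G hG B hBG d' F hFB hFd
  refine ⟨fun h => ?_, fun h => ?_⟩
  · exact_mod_cast hcard.trans ((h0 (hd.2 h)).trans
      (Nat.mul_le_mul_left _ (Nat.pow_le_pow_left hBA _)))
  · exact_mod_cast hcard.trans ((h1 (hd.not.2 h)).trans
      (Nat.mul_le_mul_left _ (Nat.pow_le_pow_left hBA _)))
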